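/- arXiv:1709.00204 — 2 statements merged into one kernel-verified Lean document; each statement's English description precedes it below -/
import Mathlib

section
/- Let f be a Gaussian stationary process on T ∈ {ℤ, ℝ} with spectral measure ρ satisfying m₀ = 1 and m_δ < ∞ for some δ > 0. Then there exist constants β > 0 and ℓ₀ ≥ 0 — with β = 2√2 and ℓ₀ = 0 when T = ℤ, and β, ℓ₀ depending only on δ and m_δ when T = ℝ — such that for all ℓ > ℓ₀ and all N > 0: P_f(N) ≥ ℙ(σ_N Z > ℓ) · ℙ(β|Z| < ℓ)^N, where Z is a standard Gaussian random variable. -/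
open MeasureTheory ProbabilityTheory Real Set
open scoped ENNReal NNReal

noncomputable section

/-- The `d`-th absolute spectral moment `m_d(ρ) = ∫ |λ|^d dρ(λ)`, valued in `[0,∞]`. -/
def specMom (ρ : Measure ℝ) (d : ℝ) : ℝ≥0∞ := ∫⁻ l, (ENNReal.ofReal |l|) ^ d ∂ρ

/-- `σ_N² = ρ([0, 1/N])`. -/
def sig2 (ρ : Measure ℝ) (N : ℝ) : ℝ := (ρ (Set.Icc 0 (1/N))).toReal

/-- `f` is a Gaussian stationary process on `ℝ` with spectral measure `ρ`, on the
probability space `(Ω, P)`: `ρ` is finite, symmetric and nonnegative; paths are a.s.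
continuous; and every finite linear combination `∑ aᵢ f(tᵢ)` is a centered Gaussian with
variance `∑ᵢⱼ aᵢ aⱼ r(tᵢ - tⱼ)` where `r(t) = ∫ cos(λ t) dρ(λ)`. -/
def IsGSPR {Ω : Type*} [MeasurableSpace Ω] (ρ : Measure ℝ) (P : Measure Ω)
    (f : ℝ → Ω → ℝ) : Prop :=
  IsFiniteMeasure ρ ∧ ρ.map (fun x => -x) = ρ ∧ IsProbabilityMeasure P ∧
  Measurable (fun p : ℝ × Ω => f p.1 p.2) ∧
  (∀ᵐ ω ∂P, Continuous fun t => f t ω) ∧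
  ∀ (n : ℕ) (t a : Fin n → ℝ),
    P.map (fun ω => ∑ i, a i * f (t i) ω)
      = gaussianReal 0 (∑ i, ∑ j, a i * a j * ∫ l, Real.cos (l * (t i - t j)) ∂ρ).toNNReal

/-- `f` is a Gaussian stationary process on `ℤ` with spectral measure `ρ` (supported on
`[-π,π]`), on the probability space `(Ω, P)`. -/
def IsGSPZ {Ω : Type*} [MeasurableSpace Ω] (ρ : Measure ℝ) (P : Measure Ω)
    (f : ℤ → Ω → ℝ) : Prop :=
  IsFiniteMeasure ρ ∧ ρ.map (fun x => -x) = ρ ∧ ρ (Set.Icc (-Real.pi) Real.pi)ᶜ = 0 ∧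
  IsProbabilityMeasure P ∧ (∀ n : ℤ, Measurable (f n)) ∧
  ∀ (n : ℕ) (t : Fin n → ℤ) (a : Fin n → ℝ),
    P.map (fun ω => ∑ i, a i * f (t i) ω)
      = gaussianReal 0
          (∑ i, ∑ j, a i * a j * ∫ l, Real.cos (l * ((t i : ℝ) - (t j : ℝ))) ∂ρ).toNNReal

/-- Persistence probability `P_f(N) = ℙ(f(t) > 0 ∀ t ∈ (0,N])` for a process on `ℝ`. -/
def persR {Ω : Type*} [MeasurableSpace Ω] (P : Measure Ω) (f : ℝ → Ω → ℝ) (N : ℝ) : ℝ :=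
  (P {ω | ∀ t ∈ Set.Ioc (0:ℝ) N, 0 < f t ω}).toReal

/-- Persistence probability `P_f(N) = ℙ(f(n) > 0 ∀ n ∈ (0,N] ∩ ℤ)` for a process on `ℤ`. -/
def persZ {Ω : Type*} [MeasurableSpace Ω] (P : Measure Ω) (f : ℤ → Ω → ℝ) (N : ℝ) : ℝ :=
  (P {ω | ∀ n : ℤ, 0 < n → (n : ℝ) ≤ N → 0 < f n ω}).toReal

/-- The standard Gaussian measure on `ℝ` (law of `Z ~ N(0,1)`). -/
def stdGauss : Measure ℝ := gaussianReal 0 1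



/-- 1D Brunn-Minkowski for compact sets -/
lemma bm_compact (A B : Set ℝ) (hA : IsCompact A) (hB : IsCompact B) (hA0 : A.Nonempty)
    (hB0 : B.Nonempty) (C : Set ℝ) (h : ∀ x ∈ A, ∀ y ∈ B, x + y ∈ C) :
    volume A + volume B ≤ volume C := by
  obtain ⟨a, haA, ha⟩ := hA.exists_isGreatest hA0
  obtain ⟨b, hbB, hb⟩ := hB.exists_isLeast hB0
  have h1 : volume ((fun x => x + b) '' A) = volume A := by
    simp
  have h2 : volume ((fun x => x + a) '' B) = volume B := by
    simp
  have hm2 : MeasurableSet ((fun x => x + a) '' B) :=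
    (hB.image (by fun_prop)).measurableSet
  have hd : AEDisjoint volume ((fun x => x + b) '' A) ((fun x => x + a) '' B) := by
    refine measure_mono_null (t := {a + b}) ?_ (by simp)
    rintro z ⟨⟨x, hx, rfl⟩, ⟨y, hy, hxy⟩⟩
    have := ha hx; have := hb hy
    simp only at hxy ⊢
    simp only [mem_singleton_iff]
    linarith
  rw [← h1, ← h2, ← measure_union₀ hm2.nullMeasurableSet hd]
  apply measure_mono
  rintro z (⟨x, hx, rfl⟩ | ⟨y, hy, rfl⟩)
  · exact h x hx b hbB
  · show y + a ∈ C
    rw [add_comm]; exact h a haA y hy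

lemma bm_meas (A B : Set ℝ) (hA : MeasurableSet A) (hB : MeasurableSet B) (hA0 : A.Nonempty)
    (hB0 : B.Nonempty) (C : Set ℝ) (h : ∀ x ∈ A, ∀ y ∈ B, x + y ∈ C) :
    volume A + volume B ≤ volume C := by
  obtain ⟨a, ha⟩ := hA0
  obtain ⟨b, hb⟩ := hB0
  have key : ∀ K ⊆ A, IsCompact K → ∀ L ⊆ B, IsCompact L → volume K + volume L ≤ volume C := by
    intro K hK hKc L hL hLc
    have := bm_compact (K ∪ {a}) (L ∪ {b}) (hKc.union isCompact_singleton)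
      (hLc.union isCompact_singleton) ⟨a, by simp⟩ ⟨b, by simp⟩ C (by
        intro x hx y hy
        apply h
        · rcases hx with hx | hx
          · exact hK hx
          · rw [hx]; exact ha
        · rcases hy with hx | hx
          · exact hL hx
          · rw [hx]; exact hb)
    refine le_trans ?_ this
    gcongr <;> simp
  by_contra hcon
  push Not at hcon
  rcases eq_or_ne (volume A) 0 with hA0 | hA0
  · rw [hA0, zero_add] at hcon
    obtain ⟨L, hL, hLc, hh⟩ := hB.exists_lt_isCompact hcon
    have := key {a} (by simpa) isCompact_singleton L hL hLc
    simp at this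
    exact absurd this (not_le.2 hh)
  rcases eq_or_ne (volume B) 0 with hB0 | hB0
  · rw [hB0, add_zero] at hcon
    obtain ⟨L, hL, hLc, hh⟩ := hA.exists_lt_isCompact hcon
    have := key L hL hLc {b} (by simpa) isCompact_singleton
    simp at this
    exact absurd this (not_le.2 hh)
  obtain ⟨x, hx, y, hy, hxy⟩ := ENNReal.exists_lt_add_of_lt_add hcon hA0 hB0
  obtain ⟨K, hK, hKc, hh⟩ := hA.exists_lt_isCompact hx
  obtain ⟨L, hL, hLc, hh'⟩ := hB.exists_lt_isCompact hy
  have := key K hK hKc L hL hLc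
  exact absurd this (not_le.2 (lt_trans hxy (ENNReal.add_lt_add hh hh')))


lemma pl_core (f g h : ℝ → ℝ) (hf : Measurable f) (hg : Measurable g) (hh : Measurable h)
    (f0 : ∀ x, 0 ≤ f x) (g0 : ∀ x, 0 ≤ g x) (h0 : ∀ x, 0 ≤ h x)
    (f1 : ∀ x, f x ≤ 1) (g1 : ∀ x, g x ≤ 1)
    (f2 : ∀ t < 1, ∃ x, t < f x) (g2 : ∀ t < 1, ∃ x, t < g x)
    (a b : ℝ) (ha : 0 < a) (hb : 0 < b) (hab : a + b = 1)
    (H : ∀ x y, f x ^ a * g y ^ b ≤ h (a * x + b * y)) :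
    ENNReal.ofReal a * (∫⁻ x, ENNReal.ofReal (f x)) + ENNReal.ofReal b *
      (∫⁻ x, ENNReal.ofReal (g x)) ≤ ∫⁻ x, ENNReal.ofReal (h x) := by
  rw [lintegral_eq_lintegral_meas_lt volume (ae_of_all _ f0) hf.aemeasurable,
    lintegral_eq_lintegral_meas_lt volume (ae_of_all _ g0) hg.aemeasurable,
    lintegral_eq_lintegral_meas_lt volume (ae_of_all _ h0) hh.aemeasurable]
  have mf : Measurable fun t => volume {x | t < f x} :=
    Antitone.measurable (fun s t hst => measure_mono fun x hx => lt_of_le_of_lt hst hx)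
  have mg : Measurable fun t => volume {x | t < g x} :=
    Antitone.measurable (fun s t hst => measure_mono fun x hx => lt_of_le_of_lt hst hx)
  rw [← lintegral_const_mul _ mf, ← lintegral_const_mul _ mg,
    ← lintegral_add_left (mf.const_mul _)]
  refine setLIntegral_mono' measurableSet_Ioi ?_
  intro t ht
  have ht : 0 < t := ht
  rcases le_or_gt 1 t with h1 | h1
  · have e1 : {x | t < f x} = ∅ := by
      ext x; simp; exact (f1 x).trans h1
    have e2 : {x | t < g x} = ∅ := by
      ext x; simp; exact (g1 x).trans h1
    simp [e1, e2]
  have s1 : volume ((fun x => a * x) '' {x | t < f x}) = ENNReal.ofReal a * volume {x | t < f x} := by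
    have := Measure.addHaar_smul (volume : Measure ℝ) a {x | t < f x}
    simpa [← image_smul, abs_of_pos ha] using this
  have s2 : volume ((fun x => b * x) '' {x | t < g x}) = ENNReal.ofReal b * volume {x | t < g x} := by
    have := Measure.addHaar_smul (volume : Measure ℝ) b {x | t < g x}
    simpa [← image_smul, abs_of_pos hb] using this
  rw [← s1, ← s2]
  have m1 : MeasurableSet ((fun x => a * x) '' {x | t < f x}) := by
    have := (measurableSet_lt measurable_const hf : MeasurableSet {x | t < f x}).const_smul₀ a
    simpa [← image_smul] using this
  have m2 : MeasurableSet ((fun x => b * x) '' {x | t < g x}) := by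
    have := (measurableSet_lt measurable_const hg : MeasurableSet {x | t < g x}).const_smul₀ b
    simpa [← image_smul] using this
  obtain ⟨x0, hx0⟩ := f2 t h1
  obtain ⟨y0, hy0⟩ := g2 t h1
  refine bm_meas _ _ m1 m2 ⟨_, mem_image_of_mem _ hx0⟩ ⟨_, mem_image_of_mem _ hy0⟩ _ ?_
  rintro _ ⟨x, hx, rfl⟩ _ ⟨y, hy, rfl⟩
  have hx : t < f x := hx
  have hy : t < g y := hy
  refine lt_of_lt_of_le ?_ (H x y)
  calc t = t ^ a * t ^ b := by rw [← rpow_add ht, hab, rpow_one]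
    _ < f x ^ a * g y ^ b := by
      have := rpow_lt_rpow ht.le hx ha
      have := rpow_lt_rpow ht.le hy hb
      have := rpow_pos_of_pos ht a
      have := rpow_pos_of_pos ht b
      gcongr

lemma ennreal_amgm (x y : ℝ≥0∞) (a b : ℝ) (ha : 0 < a) (hb : 0 < b) (hab : a + b = 1) :
    x ^ a * y ^ b ≤ ENNReal.ofReal a * x + ENNReal.ofReal b * y := by
  rcases eq_or_ne x ⊤ with rfl | hx
  · rw [ENNReal.mul_top (by simpa using ha), top_add]; exact le_top
  rcases eq_or_ne y ⊤ with rfl | hy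
  · rw [ENNReal.mul_top (by simpa using hb), add_top]; exact le_top
  have := Real.geom_mean_le_arith_mean2_weighted ha.le hb.le (ENNReal.toReal_nonneg (a := x))
    (ENNReal.toReal_nonneg (a := y)) hab
  rw [← ENNReal.ofReal_toReal hx, ← ENNReal.ofReal_toReal hy,
    ENNReal.ofReal_rpow_of_nonneg ENNReal.toReal_nonneg ha.le,
    ENNReal.ofReal_rpow_of_nonneg ENNReal.toReal_nonneg hb.le,
    ← ENNReal.ofReal_mul (by positivity), ← ENNReal.ofReal_mul ha.le, ← ENNReal.ofReal_mul hb.le,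
    ← ENNReal.ofReal_add (by positivity) (by positivity)]
  exact ENNReal.ofReal_le_ofReal this

lemma pl_real (f g h : ℝ → ℝ) (hf : Measurable f) (hg : Measurable g) (hh : Measurable h)
    (f0 : ∀ x, 0 ≤ f x) (g0 : ∀ x, 0 ≤ g x) (h0 : ∀ x, 0 ≤ h x)
    (f1 : ∀ x, f x ≤ 1) (g1 : ∀ x, g x ≤ 1)
    (a b : ℝ) (ha : 0 < a) (hb : 0 < b) (hab : a + b = 1)
    (H : ∀ x y, f x ^ a * g y ^ b ≤ h (a * x + b * y)) :
    (∫⁻ x, ENNReal.ofReal (f x)) ^ a * (∫⁻ x, ENNReal.ofReal (g x)) ^ b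
      ≤ ∫⁻ x, ENNReal.ofReal (h x) := by
  have bf : BddAbove (range f) := ⟨1, by rintro _ ⟨x, rfl⟩; exact f1 x⟩
  have bg : BddAbove (range g) := ⟨1, by rintro _ ⟨x, rfl⟩; exact g1 x⟩
  set F := ⨆ x, f x with hF
  set G := ⨆ x, g x with hG
  have fF : ∀ x, f x ≤ F := fun x => le_ciSup bf x
  have gG : ∀ x, g x ≤ G := fun x => le_ciSup bg x
  rcases eq_or_lt_of_le ((f0 0).trans (fF 0)) with h | Fp
  · have : ∀ x, f x = 0 := fun x => le_antisymm (by rw [h]; exact fF x) (f0 x)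
    simp [this, ENNReal.zero_rpow_of_pos ha]
  rcases eq_or_lt_of_le ((g0 0).trans (gG 0)) with h | Gp
  · have : ∀ x, g x = 0 := fun x => le_antisymm (by rw [h]; exact gG x) (g0 x)
    simp [this, ENNReal.zero_rpow_of_pos hb]
  have Fa := rpow_pos_of_pos Fp a
  have Gb := rpow_pos_of_pos Gp b
  have key := pl_core (fun x => f x / F) (fun x => g x / G) (fun x => h x / (F ^ a * G ^ b))
    (hf.div_const _) (hg.div_const _) (hh.div_const _) (fun x => div_nonneg (f0 x) Fp.le)
    (fun x => div_nonneg (g0 x) Gp.le) (fun x => div_nonneg (h0 x) (by positivity))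
    (fun x => (div_le_one Fp).2 (fF x)) (fun x => (div_le_one Gp).2 (gG x))
    (fun t ht => by
      have : t * F < ⨆ x, f x := by rw [← hF]; nlinarith
      obtain ⟨x, hx⟩ := exists_lt_of_lt_ciSup this
      exact ⟨x, (lt_div_iff₀ Fp).2 hx⟩)
    (fun t ht => by
      have : t * G < ⨆ x, g x := by rw [← hG]; nlinarith
      obtain ⟨x, hx⟩ := exists_lt_of_lt_ciSup this
      exact ⟨x, (lt_div_iff₀ Gp).2 hx⟩) a b ha hb hab
    (fun x y => by
      rw [div_rpow (f0 x) Fp.le, div_rpow (g0 y) Gp.le, div_mul_div_comm]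
      gcongr
      exact H x y)
  have ediv : ∀ (u : ℝ → ℝ) (hu : Measurable u) (c : ℝ), 0 < c →
      ∫⁻ x, ENNReal.ofReal (u x / c) = (∫⁻ x, ENNReal.ofReal (u x)) * ENNReal.ofReal c⁻¹ := by
    intro u hu c hc
    rw [← lintegral_mul_const _ (by fun_prop)]
    congr 1 with x
    rw [div_eq_mul_inv, ENNReal.ofReal_mul' (by positivity)]
  rw [ediv f hf F Fp, ediv g hg G Gp, ediv h hh _ (by positivity)] at key
  set I := ∫⁻ x, ENNReal.ofReal (f x)
  set J := ∫⁻ x, ENNReal.ofReal (g x)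
  set K := ∫⁻ x, ENNReal.ofReal (h x)
  have amgm := ennreal_amgm (I * ENNReal.ofReal F⁻¹) (J * ENNReal.ofReal G⁻¹) a b ha hb hab
  have e : (I * ENNReal.ofReal F⁻¹) ^ a * (J * ENNReal.ofReal G⁻¹) ^ b =
      I ^ a * J ^ b * ENNReal.ofReal (F ^ a * G ^ b)⁻¹ := by
    rw [ENNReal.mul_rpow_of_nonneg _ _ ha.le, ENNReal.mul_rpow_of_nonneg _ _ hb.le,
      ENNReal.ofReal_rpow_of_pos (by positivity), ENNReal.ofReal_rpow_of_pos (by positivity),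
      mul_inv, ENNReal.ofReal_mul (by positivity), inv_rpow Fp.le, inv_rpow Gp.le]
    ring
  have := (e ▸ amgm).trans key
  rwa [ENNReal.mul_le_mul_iff_left (by simp; positivity) (by simp)] at this

/-- Prekopa-Leindler property of a measure -/
def PLm {E : Type*} [MeasurableSpace E] [AddCommGroup E] [Module ℝ E] (μ : Measure E) : Prop :=
  ∀ a b : ℝ, 0 < a → 0 < b → a + b = 1 → ∀ f g h : E → ℝ≥0∞, Measurable f → Measurable g →
    Measurable h → (∀ x, f x ≤ 1) → (∀ x, g x ≤ 1) → (∀ x, h x ≤ 1) →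
    (∀ x y, f x ^ a * g y ^ b ≤ h (a • x + b • y)) →
    (∫⁻ x, f x ∂μ) ^ a * (∫⁻ x, g x ∂μ) ^ b ≤ ∫⁻ x, h x ∂μ

lemma PLm.map {E F : Type*} [MeasurableSpace E] [AddCommGroup E] [Module ℝ E]
    [MeasurableSpace F] [AddCommGroup F] [Module ℝ F] {μ : Measure E} (hμ : PLm μ)
    (L : E →ₗ[ℝ] F) (hL : Measurable L) : PLm (μ.map L) := by
  intro a b ha hb hab f g h hf hg hh f1 g1 h1 H
  rw [lintegral_map hf hL, lintegral_map hg hL, lintegral_map hh hL]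
  exact hμ a b ha hb hab _ _ _ (hf.comp hL) (hg.comp hL) (hh.comp hL) (fun x => f1 _)
    (fun x => g1 _) (fun x => h1 _) (fun x y => by simpa using H (L x) (L y))

lemma PLm.prod {E F : Type*} [MeasurableSpace E] [AddCommGroup E] [Module ℝ E]
    [MeasurableSpace F] [AddCommGroup F] [Module ℝ F] {μ : Measure E} {ν : Measure F}
    [IsProbabilityMeasure μ] [IsProbabilityMeasure ν] (hμ : PLm μ) (hν : PLm ν) :
    PLm (μ.prod ν) := by
  intro a b ha hb hab f g h hf hg hh f1 g1 h1 H
  rw [lintegral_prod _ hf.aemeasurable, lintegral_prod _ hg.aemeasurable,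
    lintegral_prod _ hh.aemeasurable]
  have bd : ∀ f : E × F → ℝ≥0∞, (∀ x, f x ≤ 1) → ∀ x, ∫⁻ y, f (x, y) ∂ν ≤ 1 := by
    intro f f1 x
    calc ∫⁻ y, f (x, y) ∂ν ≤ ∫⁻ y, 1 ∂ν := lintegral_mono fun y => f1 _
      _ = 1 := by simp
  refine hμ a b ha hb hab _ _ _ hf.lintegral_prod_right' hg.lintegral_prod_right'
    hh.lintegral_prod_right' (bd f f1) (bd g g1) (bd h h1) ?_
  intro x1 x2
  refine hν a b ha hb hab _ _ _ (hf.comp measurable_prodMk_left) (hg.comp measurable_prodMk_left)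
    (hh.comp measurable_prodMk_left) (fun x => f1 _)
    (fun x => g1 _) (fun x => h1 _) (fun x y => by simpa using H (x1, x) (x2, y))

lemma PLm_gauss : PLm (gaussianReal 0 1) := by
  intro a b ha hb hab f g h hf hg hh f1 g1 h1 H
  have e : ∀ f : ℝ → ℝ≥0∞, Measurable f → (∀ x, f x ≤ 1) → ∫⁻ x, f x ∂(gaussianReal 0 1) =
      ∫⁻ x, ENNReal.ofReal (gaussianPDFReal 0 1 x * (f x).toReal) := by
    intro f hf f1
    rw [gaussianReal_of_var_ne_zero _ one_ne_zero,
      lintegral_withDensity_eq_lintegral_mul _ (measurable_gaussianPDF 0 1) hf]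
    congr 1 with x
    rw [ENNReal.ofReal_mul (gaussianPDFReal_nonneg _ _ _), ENNReal.ofReal_toReal
      (ne_top_of_le_ne_top ENNReal.one_ne_top (f1 x))]
    rfl
  have tr1 : ∀ f : ℝ → ℝ≥0∞, (∀ x, f x ≤ 1) → ∀ x, (f x).toReal ≤ 1 := fun f f1 x =>
    ENNReal.toReal_le_of_le_ofReal zero_le_one (by simpa using f1 x)
  have pdf1 : ∀ x, gaussianPDFReal 0 1 x ≤ 1 := by
    intro x
    rw [gaussianPDFReal]
    have h1 : (√(2 * π * ((1 : ℝ≥0) : ℝ)))⁻¹ ≤ 1 := by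
      apply inv_le_one_of_one_le₀
      rw [one_le_sqrt]
      have := Real.pi_gt_three
      simp; linarith
    have h2 : rexp (-(x - 0) ^ 2 / (2 * ((1 : ℝ≥0) : ℝ))) ≤ 1 := by
      rw [exp_le_one_iff]
      simp; nlinarith [sq_nonneg x]
    exact mul_le_one₀ h1 (exp_pos _).le h2
  rw [e f hf f1, e g hg g1, e h hh h1]
  have mp := measurable_gaussianPDFReal 0 1
  refine pl_real _ _ _ (by fun_prop) (by fun_prop) (by fun_prop)
    (fun x => mul_nonneg (gaussianPDFReal_nonneg _ _ _) ENNReal.toReal_nonneg)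
    (fun x => mul_nonneg (gaussianPDFReal_nonneg _ _ _) ENNReal.toReal_nonneg)
    (fun x => mul_nonneg (gaussianPDFReal_nonneg _ _ _) ENNReal.toReal_nonneg)
    (fun x => mul_le_one₀ (pdf1 x) ENNReal.toReal_nonneg (tr1 f f1 x))
    (fun x => mul_le_one₀ (pdf1 x) ENNReal.toReal_nonneg (tr1 g g1 x)) a b ha hb hab ?_
  intro x y
  have hH : (f x).toReal ^ a * (g y).toReal ^ b ≤ (h (a * x + b * y)).toReal := by
    have := ENNReal.toReal_mono (ne_top_of_le_ne_top ENNReal.one_ne_top (h1 _)) (H x y)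
    simpa [ENNReal.toReal_rpow] using this
  have hp : gaussianPDFReal 0 1 x ^ a * gaussianPDFReal 0 1 y ^ b ≤
      gaussianPDFReal 0 1 (a * x + b * y) := by
    simp only [gaussianPDFReal]
    set c := (√(2 * π * ((1 : ℝ≥0) : ℝ)))⁻¹
    have hc : 0 < c := by positivity
    rw [mul_rpow hc.le (exp_pos _).le, mul_rpow hc.le (exp_pos _).le, ← exp_mul, ← exp_mul]
    calc _ = (c ^ a * c ^ b) * (rexp (-(x - 0) ^ 2 / (2 * ((1 : ℝ≥0) : ℝ)) * a) *
          rexp (-(y - 0) ^ 2 / (2 * ((1 : ℝ≥0) : ℝ)) * b)) := by ring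
      _ = c * rexp (-(x - 0) ^ 2 / (2 * ((1 : ℝ≥0) : ℝ)) * a +
          -(y - 0) ^ 2 / (2 * ((1 : ℝ≥0) : ℝ)) * b) := by
        rw [← rpow_add hc, hab, rpow_one, exp_add]
      _ ≤ _ := by
        gcongr
        simp
        obtain rfl : b = 1 - a := by linarith
        nlinarith [mul_nonneg (mul_nonneg ha.le hb.le) (sq_nonneg (x - y))]
  rw [mul_rpow (gaussianPDFReal_nonneg _ _ _) ENNReal.toReal_nonneg,
    mul_rpow (gaussianPDFReal_nonneg _ _ _) ENNReal.toReal_nonneg]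
  calc _ = (gaussianPDFReal 0 1 x ^ a * gaussianPDFReal 0 1 y ^ b) *
        ((f x).toReal ^ a * (g y).toReal ^ b) := by ring
    _ ≤ _ := by
      have := gaussianPDFReal_nonneg 0 1 (a * x + b * y)
      gcongr

lemma PLm_pi (n : ℕ) : PLm (Measure.pi (fun _ : Fin n => gaussianReal 0 1)) := by
  induction n with
  | zero =>
    intro a b ha hb hab f g h hf hg hh f1 g1 h1 H
    rw [Measure.pi_of_empty]
    simp only [lintegral_dirac]
    have := H isEmptyElim isEmptyElim
    convert this
  | succ n ih =>
    have mp := measurePreserving_piFinSuccAbove (fun _ : Fin (n+1) => gaussianReal 0 1) 0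
    have mp' := mp.symm
    rw [← mp'.map_eq]
    let L : (ℝ × (Fin n → ℝ)) →ₗ[ℝ] (Fin (n+1) → ℝ) :=
      { toFun := fun p => Fin.cons p.1 p.2
        map_add' := by
          intro p q; ext i; refine Fin.cases ?_ (fun i => ?_) i <;> simp
        map_smul' := by
          intro p q; ext i; refine Fin.cases ?_ (fun i => ?_) i <;> simp }
    have hL : ⇑(MeasurableEquiv.piFinSuccAbove (fun _ : Fin (n+1) => ℝ) 0).symm = L := by
      ext p i
      simp [L, MeasurableEquiv.piFinSuccAbove]
    rw [hL]
    refine PLm.map (PLm.prod PLm_gauss ih) L ?_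
    rw [← hL]; exact MeasurableEquiv.measurable _

lemma PLm_std (E : Type*) [NormedAddCommGroup E] [InnerProductSpace ℝ E] [FiniteDimensional ℝ E]
    [MeasurableSpace E] [BorelSpace E] : PLm (stdGaussian E) := by
  rw [stdGaussian]
  let L : (Fin (Module.finrank ℝ E) → ℝ) →ₗ[ℝ] E :=
    { toFun := fun x => ∑ i, x i • stdOrthonormalBasis ℝ E i
      map_add' := by intro x y; simp [add_smul, Finset.sum_add_distrib]
      map_smul' := by intro c x; simp [Finset.smul_sum, smul_smul] }
  exact PLm.map (PLm_pi _) L (by show Measurable fun x : Fin (Module.finrank ℝ E) → ℝ => ∑ i, x i • stdOrthonormalBasis ℝ E i; fun_prop)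


section Sidak
variable {E : Type*} [NormedAddCommGroup E] [InnerProductSpace ℝ E] [FiniteDimensional ℝ E]
    [MeasurableSpace E] [BorelSpace E]

lemma anderson (μ : Measure E) [IsProbabilityMeasure μ] (hμ : PLm μ)
    (hs : μ.map (fun x => -x) = μ) (K : Set E) (hK : MeasurableSet K) (hc : Convex ℝ K)
    (hsym : ∀ x ∈ K, -x ∈ K) (v : E) (x x' : ℝ) (h : |x'| ≤ |x|) :
    μ {w | x • v + w ∈ K} ≤ μ {w | x' • v + w ∈ K} := by
  have mK : ∀ x : ℝ, MeasurableSet {w | x • v + w ∈ K} := fun x =>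
    (measurable_const.add measurable_id) hK
  have hneg : ∀ x : ℝ, μ {w | (-x) • v + w ∈ K} = μ {w | x • v + w ∈ K} := by
    intro x
    conv_lhs => rw [← hs, Measure.map_apply measurable_neg (mK _)]
    congr 1
    ext w
    simp only [mem_preimage, Set.mem_ofPred_eq]
    constructor
    · intro h; have := hsym _ h; simpa [add_comm] using this
    · intro h; have := hsym _ h; simpa [add_comm] using this
  rcases eq_or_lt_of_le h with h | h
  · rcases abs_eq_abs.1 h with rfl | rfl
    · rfl
    · rw [hneg]
  have hx : x ≠ 0 := by rintro rfl; simp at h; exact absurd h (not_lt.2 (abs_nonneg _))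
  set r := x' / x with hr
  have hr1 : |r| < 1 := by rw [hr, abs_div, div_lt_one (by positivity)]; exact h
  rw [abs_lt] at hr1
  have hx' : x' = r * x := by rw [hr]; field_simp
  have key := hμ ((1 + r) / 2) ((1 - r) / 2) (by linarith) (by linarith) (by ring)
    ({w | x • v + w ∈ K}.indicator 1) ({w | (-x) • v + w ∈ K}.indicator 1)
    ({w | x' • v + w ∈ K}.indicator 1) (measurable_one.indicator (mK _))
    (measurable_one.indicator (mK _)) (measurable_one.indicator (mK _))
    (fun w => indicator_le_self' (by simp) w) (fun w => indicator_le_self' (by simp) w)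
    (fun w => indicator_le_self' (by simp) w) (by
      intro w w'
      by_cases h1 : w ∈ {w | x • v + w ∈ K}
      · by_cases h2 : w' ∈ {w | (-x) • v + w ∈ K}
        · have h3 : ((1 + r) / 2) • w + ((1 - r) / 2) • w' ∈ {w | x' • v + w ∈ K} := by
            have := hc h1 h2 (by linarith : 0 ≤ (1 + r) / 2) (by linarith : 0 ≤ (1 - r) / 2)
              (by ring)
            simp only [Set.mem_ofPred_eq]
            convert this using 1
            rw [hx']
            module
          rw [indicator_of_mem h1, indicator_of_mem h2, indicator_of_mem h3]
          simp
        · rw [indicator_of_notMem h2, ENNReal.zero_rpow_of_pos (by linarith)]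
          simp
      · rw [indicator_of_notMem h1, ENNReal.zero_rpow_of_pos (by linarith)]
        simp)
  rw [lintegral_indicator_one (mK _), lintegral_indicator_one (mK _),
    lintegral_indicator_one (mK _), hneg, ← ENNReal.rpow_add_of_nonneg _ _ (by linarith) (by linarith)] at key
  convert key
  rw [show (1 + r) / 2 + (1 - r) / 2 = 1 by ring, ENNReal.rpow_one]

lemma cheb (μ : Measure ℝ) [IsProbabilityMeasure μ] (h : ℝ → ℝ≥0∞) (hm : Measurable h)
    (h1 : ∀ x, h x ≤ 1) (hh : ∀ x x', |x'| ≤ |x| → h x ≤ h x') (b : ℝ) :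
    μ {x | |x| ≤ b} * ∫⁻ x, h x ∂μ ≤ ∫⁻ x in {x | |x| ≤ b}, h x ∂μ := by
  rcases lt_or_ge b 0 with hb | hb
  · have : {x : ℝ | |x| ≤ b} = ∅ := by
      ext x; simp; exact hb.trans_le (abs_nonneg x)
    simp [this]
  set S := {x : ℝ | |x| ≤ b} with hS
  have mS : MeasurableSet S := measurableSet_le (by fun_prop) measurable_const
  have e1 : h b * μ S ≤ ∫⁻ x in S, h x ∂μ := by
    rw [← setLIntegral_const]
    refine setLIntegral_mono' mS fun x hx => hh _ _ ?_
    rw [abs_of_nonneg hb]; exact hx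
  have e2 : ∫⁻ x in Sᶜ, h x ∂μ ≤ h b * μ Sᶜ := by
    rw [← setLIntegral_const]
    refine setLIntegral_mono' mS.compl fun x hx => hh _ _ ?_
    rw [abs_of_nonneg hb]
    simp [hS] at hx
    exact hx.le
  rw [← lintegral_add_compl h mS, mul_add]
  calc _ ≤ μ S * ∫⁻ x in S, h x ∂μ + μ S * (h b * μ Sᶜ) := by gcongr
    _ = μ S * ∫⁻ x in S, h x ∂μ + (h b * μ S) * μ Sᶜ := by ring
    _ ≤ μ S * ∫⁻ x in S, h x ∂μ + (∫⁻ x in S, h x ∂μ) * μ Sᶜ := by gcongr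
    _ = (μ S + μ Sᶜ) * ∫⁻ x in S, h x ∂μ := by ring
    _ = _ := by rw [measure_add_measure_compl mS, measure_univ, one_mul]

lemma std_neg : (stdGaussian E).map (fun x => -x) = stdGaussian E :=
  stdGaussian_map (LinearIsometryEquiv.neg ℝ (E := E))

lemma cov_std (x y : E) : cov[fun z => inner ℝ x z, fun z => inner ℝ y z; stdGaussian E] = inner ℝ x y := by
  rw [← covarianceBilin_apply_eq_cov, covarianceBilin_stdGaussian]
  · rfl
  · exact IsGaussian.memLp_two_id

lemma corr (K : Set E) (hK : MeasurableSet K) (hc : Convex ℝ K)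
    (hsym : ∀ x ∈ K, -x ∈ K) (u : E) (b : ℝ) :
    stdGaussian E {z | |inner ℝ u z| ≤ b} * stdGaussian E K ≤
      stdGaussian E ({z | |inner ℝ u z| ≤ b} ∩ K) := by
  rcases eq_or_ne u 0 with rfl | hu
  · simp only [inner_zero_left, abs_zero]
    by_cases hb : 0 ≤ b <;> simp [hb]
  set γ := stdGaussian E
  set v : E := (‖u‖ ^ 2)⁻¹ • u with hv
  have hu2 : ‖u‖ ^ 2 ≠ 0 := by positivity
  let X : E →L[ℝ] ℝ := innerSL ℝ u
  let W : E →L[ℝ] E := ContinuousLinearMap.id ℝ E - X.smulRight v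
  have hX : ∀ z, X z = inner ℝ u z := fun z => rfl
  have hW : ∀ z, W z = z - inner ℝ u z • v := fun z => rfl
  have hG : HasGaussianLaw (fun z => (X z, W z)) γ :=
    (IsGaussian.hasGaussianLaw_id (μ := γ)).map (X.prod W)
  have hI : IndepFun X W γ := by
    refine hG.indepFun_of_covariance_inner ?_
    intro x y
    have e1 : (fun z => inner ℝ x (X z)) = fun z => inner ℝ (x • u) z := by
      ext z; rw [hX, inner_smul_left]; simp [mul_comm]
    have e2 : (fun z => inner ℝ y (W z)) = fun z => inner ℝ (y - (inner ℝ y v) • u) z := by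
      ext z; rw [hW, inner_sub_right, inner_smul_right, inner_sub_left, inner_smul_left]
      simp [mul_comm]
    rw [e1, e2, cov_std, inner_smul_left, inner_sub_right, inner_smul_right, hv, inner_smul_right,
      real_inner_self_eq_norm_sq, real_inner_comm y u]
    field_simp
    simp
  have hmap := (indepFun_iff_map_prod_eq_prod_map_map (by fun_prop) (by fun_prop)).1 hI
  have iX : IsProbabilityMeasure (γ.map X) := Measure.isProbabilityMeasure_map (by fun_prop)
  have iW : IsProbabilityMeasure (γ.map W) := Measure.isProbabilityMeasure_map (by fun_prop)
  let h : ℝ → ℝ≥0∞ := fun x => (γ.map W) {w | x • v + w ∈ K}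
  have mA : MeasurableSet {p : ℝ × E | p.1 • v + p.2 ∈ K} :=
    (by fun_prop : Measurable fun p : ℝ × E => p.1 • v + p.2) hK
  have hm : Measurable h := measurable_measure_prodMk_left mA
  have hPL : PLm (γ.map W) := PLm.map (PLm_std E) W.toLinearMap (by
    show Measurable W; fun_prop)
  have hneg : (γ.map W).map (fun x => -x) = γ.map W := by
    conv_rhs => rw [show γ = γ.map (fun x => -x) from std_neg.symm]
    rw [Measure.map_map (by fun_prop) (by fun_prop), Measure.map_map (by fun_prop) (by fun_prop)]
    congr 1
    ext z; simp
  have key := cheb (γ.map X) h hm (fun x => prob_le_one)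
    (fun x x' hx => anderson _ hPL hneg K hK hc hsym v x x' hx) b
  have mS : MeasurableSet {x : ℝ | |x| ≤ b} := measurableSet_le (by fun_prop) measurable_const
  have hdec : ∀ z, X z • v + W z = z := by intro z; rw [hW, hX]; abel
  have g1 : γ {z | |inner ℝ u z| ≤ b} = γ.map X {x | |x| ≤ b} := by
    rw [Measure.map_apply (by fun_prop) mS]; rfl
  have g2 : γ K = ∫⁻ x, h x ∂(γ.map X) := by
    have e : ∫⁻ x, h x ∂(γ.map X) = ((γ.map X).prod (γ.map W)) {p : ℝ × E | p.1 • v + p.2 ∈ K} := by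
      rw [Measure.prod_apply mA]; rfl
    rw [e, ← hmap, Measure.map_apply (by fun_prop) mA]
    congr 1
    ext z
    simp [hdec]
  have g3 : γ ({z | |inner ℝ u z| ≤ b} ∩ K) = ∫⁻ x in {x | |x| ≤ b}, h x ∂(γ.map X) := by
    have mB : MeasurableSet ({p : ℝ × E | |p.1| ≤ b} ∩ {p : ℝ × E | p.1 • v + p.2 ∈ K}) :=
      (measurable_fst mS).inter mA
    have : γ ({z | |inner ℝ u z| ≤ b} ∩ K) =
        ((γ.map X).prod (γ.map W)) ({p : ℝ × E | |p.1| ≤ b} ∩ {p : ℝ × E | p.1 • v + p.2 ∈ K}) := by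
      rw [← hmap, Measure.map_apply (by fun_prop) mB]
      congr 1
      ext z
      have := hdec z
      rw [hX] at this
      simp [this, hX]
    rw [this, Measure.prod_apply mB, ← lintegral_indicator mS]
    congr 1 with x
    by_cases hx : |x| ≤ b
    · rw [indicator_of_mem (by exact hx)]
      simp [hx, h]
    · rw [indicator_of_notMem (by exact hx)]
      simp [hx]
  rw [g1, g2, g3]
  exact key

lemma sidak {ι : Type*} (s : Finset ι) (u : ι → E) (b : ι → ℝ) :
    ∏ i ∈ s, stdGaussian E {z | |inner ℝ (u i) z| ≤ b i} ≤
      stdGaussian E {z | ∀ i ∈ s, |inner ℝ (u i) z| ≤ b i} := by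
  classical
  induction s using Finset.induction_on with
  | empty => simp
  | insert j s hj ih =>
    rw [Finset.prod_insert hj]
    have hset : {z : E | ∀ i ∈ insert j s, |inner ℝ (u i) z| ≤ b i} =
      {z | |inner ℝ (u j) z| ≤ b j} ∩ {z | ∀ i ∈ s, |inner ℝ (u i) z| ≤ b i} := by
      ext z; simp
    rw [hset]
    refine le_trans (by gcongr) (corr _ ?_ ?_ ?_ (u j) (b j))
    · have : {z : E | ∀ i ∈ s, |inner ℝ (u i) z| ≤ b i} = ⋂ i ∈ s, {z | |inner ℝ (u i) z| ≤ b i} := by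
        ext z; simp
      rw [this]
      exact Finset.measurableSet_biInter s fun i _ => measurableSet_le (by fun_prop) measurable_const
    · intro x hx y hy p q hp hq hpq i hi
      rw [inner_add_right, inner_smul_right, inner_smul_right]
      have h1 := abs_le.1 (hx i hi)
      have h2 := abs_le.1 (hy i hi)
      obtain rfl : q = 1 - p := by linarith
      rw [abs_le]
      constructor <;> nlinarith
    · intro x hx i hi
      rw [inner_neg_right, abs_neg]
      exact hx i hi

end Sidak


section Decomp

lemma map_inner_std {E : Type*} [NormedAddCommGroup E] [InnerProductSpace ℝ E]
    [FiniteDimensional ℝ E] [MeasurableSpace E] [BorelSpace E] (u : E) :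
    (stdGaussian E).map (fun z => inner ℝ u z) = gaussianReal 0 (‖u‖ ^ 2).toNNReal := by
  have h := (IsGaussian.hasGaussianLaw_id (μ := stdGaussian E)).map_fun (innerSL ℝ u)
  have h2 := h.map_eq_gaussianReal
  have e1 : (stdGaussian E)[innerSL ℝ u] = 0 := integral_strongDual_stdGaussian _
  have e2 : Var[innerSL ℝ u; stdGaussian E] = ‖u‖ ^ 2 := by
    rw [variance_dual_stdGaussian, innerSL_apply_norm]
  simp only [id] at h2
  rw [e1, e2] at h2
  exact h2

lemma slab_ge {E : Type*} [NormedAddCommGroup E] [InnerProductSpace ℝ E]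
    [FiniteDimensional ℝ E] [MeasurableSpace E] [BorelSpace E] (u : E) (V b : ℝ) (hV : ‖u‖ ≤ V) :
    gaussianReal 0 1 {x | V * |x| ≤ b} ≤ stdGaussian E {z | |inner ℝ u z| ≤ b} := by
  have mS : MeasurableSet {x : ℝ | |x| ≤ b} := measurableSet_le (by fun_prop) measurable_const
  have h1 : stdGaussian E {z | |inner ℝ u z| ≤ b} =
      (stdGaussian E).map (fun z => inner ℝ u z) {x | |x| ≤ b} := by
    rw [Measure.map_apply (by fun_prop) mS]; rfl
  have h2 : gaussianReal 0 (‖u‖ ^ 2).toNNReal = (gaussianReal 0 1).map (‖u‖ * ·) := by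
    rw [gaussianReal_map_const_mul]
    congr 1
    · simp
    · ext; simp
  rw [h1, map_inner_std, h2, Measure.map_apply (by fun_prop) mS]
  apply measure_mono
  intro x hx
  have hx : V * |x| ≤ b := hx
  show |‖u‖ * x| ≤ b
  rw [abs_mul, abs_norm]
  exact le_trans (by gcongr) hx

lemma map_pair {E : Type*} [NormedAddCommGroup E] [InnerProductSpace ℝ E]
    [FiniteDimensional ℝ E] [MeasurableSpace E] [BorelSpace E] (α : ℝ) (u : E) :
    ((gaussianReal 0 1).prod (stdGaussian E)).map (fun p => α * p.1 + inner ℝ u p.2)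
      = gaussianReal 0 (α ^ 2 + ‖u‖ ^ 2).toNNReal := by
  have hi : IndepFun (fun p : ℝ × E => α * p.1) (fun p : ℝ × E => inner ℝ u p.2)
      ((gaussianReal 0 1).prod (stdGaussian E)) :=
    indepFun_prod (X := fun x : ℝ => α * x) (Y := fun z : E => inner ℝ u z) (by fun_prop) (by fun_prop)
  have h1 : ((gaussianReal 0 1).prod (stdGaussian E)).map (fun p : ℝ × E => α * p.1) =
      gaussianReal 0 (α ^ 2).toNNReal := by
    rw [show (fun p : ℝ × E => α * p.1) = (fun x => α * x) ∘ Prod.fst from rfl,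
      ← Measure.map_map (by fun_prop) (by fun_prop), Measure.map_fst_prod]
    simp only [measure_univ, one_smul]
    rw [gaussianReal_map_const_mul]
    congr 1
    · simp
    · ext; simp [sq_nonneg]
  have h2 : ((gaussianReal 0 1).prod (stdGaussian E)).map (fun p : ℝ × E => inner ℝ u p.2) =
      gaussianReal 0 (‖u‖ ^ 2).toNNReal := by
    rw [show (fun p : ℝ × E => inner ℝ u p.2) = (fun z => inner ℝ u z) ∘ Prod.snd from rfl,
      ← Measure.map_map (by fun_prop) (by fun_prop), Measure.map_snd_prod]
    simp only [measure_univ, one_smul]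
    exact map_inner_std u
  have h3 := gaussianReal_add_gaussianReal_of_indepFun hi h1 h2
  rw [Real.toNNReal_add (by positivity) (by positivity)]
  rw [add_zero] at h3
  exact h3

open scoped MatrixOrder in
lemma gram_exists {ι : Type*} [Fintype ι] [DecidableEq ι] (K : ι → ι → ℝ)
    (hs : ∀ i j, K i j = K j i) (hp : ∀ c : ι → ℝ, 0 ≤ ∑ i, ∑ j, c i * c j * K i j) :
    ∃ B : ι → EuclideanSpace ℝ ι, ∀ i j, inner ℝ (B i) (B j) = K i j := by
  have hK : (Matrix.of K).PosSemidef := by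
    apply Matrix.PosSemidef.of_dotProduct_mulVec_nonneg
    · ext i j; exact hs j i
    · intro x
      refine le_of_le_of_eq (hp x) ?_
      simp only [dotProduct, Matrix.mulVec, Finset.mul_sum, Pi.star_apply, star_trivial, Matrix.of_apply]
      exact Finset.sum_congr rfl fun i _ => Finset.sum_congr rfl fun j _ => by ring
  obtain ⟨M, hM⟩ := CStarAlgebra.nonneg_iff_eq_star_mul_self.1 hK.nonneg
  refine ⟨fun i => WithLp.toLp 2 (fun k => M k i), fun i j => ?_⟩
  have := congrFun (congrFun hM i) j
  simp [Matrix.mul_apply] at this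
  rw [this]
  simp [PiLp.inner_apply, mul_comm]

lemma law_eq {ι : Type*} [Fintype ι] [DecidableEq ι] {μ ν : Measure (ι → ℝ)} [IsFiniteMeasure μ]
    [IsFiniteMeasure ν] (h : ∀ c : ι → ℝ, μ.map (fun x => ∑ i, c i * x i) = ν.map (fun x => ∑ i, c i * x i)) :
    μ = ν := by
  apply Measure.ext_of_charFunDual
  ext L
  rw [charFunDual_eq_charFun_map_one, charFunDual_eq_charFun_map_one]
  have : ⇑L = fun x => ∑ i, L (Pi.single i 1) * x i := by
    ext x
    conv_lhs => rw [← Finset.univ_sum_single x]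
    rw [map_sum]
    refine Finset.sum_congr rfl fun i _ => ?_
    have : (Pi.single i (x i) : ι → ℝ) = x i • Pi.single i 1 := by
      rw [← Pi.single_smul]; simp
    rw [this, map_smul, smul_eq_mul, mul_comm]
  rw [this, h]

end Decomp

section LemA

lemma int_cos (ρ : Measure ℝ) [IsFiniteMeasure ρ] (x : ℝ) : Integrable (fun l => Real.cos (l * x)) ρ :=
  Integrable.of_bound (C := 1) (by fun_prop) (Filter.Eventually.of_forall fun l => by
    simpa using Real.abs_cos_le_one _)

lemma int_bdd (ρ : Measure ℝ) [IsFiniteMeasure ρ] (g : ℝ → ℝ) (hg : Continuous g) (C : ℝ)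
    (h : ∀ x, |g x| ≤ C) : Integrable g ρ :=
  Integrable.of_bound (C := C) hg.aestronglyMeasurable (Filter.Eventually.of_forall fun l => by
    simpa using h l)

lemma cs_int (ρ : Measure ℝ) [IsFiniteMeasure ρ] (u : ℝ → ℝ) (h1 : Integrable u ρ)
    (h2 : Integrable (fun l => u l ^ 2) ρ) (hp : 0 < ρ.real univ) :
    (∫ l, u l ∂ρ) ^ 2 / ρ.real univ ≤ ∫ l, u l ^ 2 ∂ρ := by
  set r := ρ.real univ
  set I := ∫ l, u l ∂ρ with hI
  have h : 0 ≤ ∫ l, (u l - I / r) ^ 2 ∂ρ := integral_nonneg fun l => sq_nonneg _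
  have e : ∫ l, (u l - I / r) ^ 2 ∂ρ = ∫ l, u l ^ 2 ∂ρ - 2 * (I / r) * I + r * (I / r) ^ 2 := by
    have : ∀ l, (u l - I / r) ^ 2 = u l ^ 2 - 2 * (I / r) * u l + (I / r) ^ 2 := fun l => by ring
    simp_rw [this]
    have h3 : Integrable (fun l => u l ^ 2 - 2 * (I / r) * u l) ρ := h2.sub (h1.const_mul _)
    rw [integral_add h3 (integrable_const _), integral_sub h2 (h1.const_mul _),
      integral_const_mul, integral_const, smul_eq_mul]
  rw [e] at h
  have : 2 * (I / r) * I - r * (I / r) ^ 2 = I ^ 2 / r := by field_simp; ring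
  linarith

lemma quad_id {ι : Type*} [Fintype ι] (c t : ι → ℝ) (τ l : ℝ) :
    ∑ i, ∑ j, c i * c j * Real.cos (l * (t i - t j)) =
      (∑ i, c i * Real.cos (l * (t i - τ))) ^ 2 + (∑ i, c i * Real.sin (l * (t i - τ))) ^ 2 := by
  rw [sq, sq, Finset.sum_mul_sum, Finset.sum_mul_sum, ← Finset.sum_add_distrib]
  refine Finset.sum_congr rfl fun i _ => ?_
  rw [← Finset.sum_add_distrib]
  refine Finset.sum_congr rfl fun j _ => ?_
  have : l * (t i - t j) = l * (t i - τ) - l * (t j - τ) := by ring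
  rw [this, Real.cos_sub]; ring

lemma decomp {ι : Type*} [Fintype ι] [DecidableEq ι] {Ω : Type*} [MeasurableSpace Ω]
    (P : Measure Ω) [IsProbabilityMeasure P] (ρ : Measure ℝ) [IsProbabilityMeasure ρ]
    (X : ι → Ω → ℝ) (hX : ∀ i, Measurable (X i)) (t : ι → ℝ)
    (hlaw : ∀ c : ι → ℝ, P.map (fun ω => ∑ i, c i * X i ω)
      = gaussianReal 0 (∑ i, ∑ j, c i * c j * ∫ l, Real.cos (l * (t i - t j)) ∂ρ).toNNReal)
    (N : ℝ) (hN : 0 < N) (hI : 0 < ρ.real (Icc (-(1/N)) (1/N))) :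
    ∃ (a : ι → ℝ) (B : ι → EuclideanSpace ℝ ι),
      P.map (fun ω i => X i ω) = ((gaussianReal 0 1).prod (stdGaussian (EuclideanSpace ℝ ι))).map
        (fun p i => √(ρ.real (Icc (-(1/N)) (1/N))) * a i * p.1 + inner ℝ (B i) p.2) ∧
      (∀ i, 0 ≤ t i → t i ≤ N → 7 / 8 ≤ a i) ∧ (∀ i, ‖B i‖ ≤ 1) ∧
      (∀ i j, ‖B i - B j‖ ^ 2 ≤ ∫ l, 2 * (1 - Real.cos (l * (t i - t j))) ∂ρ) := by
  set I := Icc (-(1/N)) (1/N) with hIdef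
  set r := ρ.real I with hr
  set τ := N / 2 with hτ
  set C : ι → ι → ℝ := fun i j => ∫ l, Real.cos (l * (t i - t j)) ∂ρ with hC
  set D : ι → ℝ := fun i => ∫ l in I, Real.cos (l * (t i - τ)) ∂ρ with hD
  have hCs : ∀ i j, C i j = C j i := by
    intro i j
    simp only [hC]
    congr 1; ext l
    rw [← Real.cos_neg]; congr 1; ring
  have hCd : ∀ i, C i i = 1 := by intro i; simp [hC]
  set K : ι → ι → ℝ := fun i j => C i j - D i * D j / r with hK
  have hQ : ∀ c : ι → ℝ, (∑ i, c i * D i) ^ 2 / r ≤ ∑ i, ∑ j, c i * c j * C i j := by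
    intro c
    set u : ℝ → ℝ := fun l => ∑ i, c i * Real.cos (l * (t i - τ)) with hu
    set v : ℝ → ℝ := fun l => ∑ i, c i * Real.sin (l * (t i - τ)) with hv
    have bu : ∀ l, |u l| ≤ ∑ i, |c i| := fun l =>
      (Finset.abs_sum_le_sum_abs _ _).trans (Finset.sum_le_sum fun i _ => by
        rw [abs_mul]; exact mul_le_of_le_one_right (abs_nonneg _) (Real.abs_cos_le_one _))
    have bv : ∀ l, |v l| ≤ ∑ i, |c i| := fun l =>
      (Finset.abs_sum_le_sum_abs _ _).trans (Finset.sum_le_sum fun i _ => by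
        rw [abs_mul]; exact mul_le_of_le_one_right (abs_nonneg _) (Real.abs_sin_le_one _))
    have cu : Continuous u := by fun_prop
    have cv : Continuous v := by fun_prop
    have iu : ∀ (μ : Measure ℝ) [IsFiniteMeasure μ], Integrable u μ := fun μ _ => int_bdd μ u cu _ bu
    have iu2 : ∀ (μ : Measure ℝ) [IsFiniteMeasure μ], Integrable (fun l => u l ^ 2) μ := fun μ _ =>
      int_bdd μ _ (by fun_prop) ((∑ i, |c i|) ^ 2) fun l => by
        rw [abs_pow]; exact pow_le_pow_left₀ (abs_nonneg _) (bu l) 2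
    have iv2 : ∀ (μ : Measure ℝ) [IsFiniteMeasure μ], Integrable (fun l => v l ^ 2) μ := fun μ _ =>
      int_bdd μ _ (by fun_prop) ((∑ i, |c i|) ^ 2) fun l => by
        rw [abs_pow]; exact pow_le_pow_left₀ (abs_nonneg _) (bv l) 2
    have e1 : ∑ i, ∑ j, c i * c j * C i j = ∫ l, (u l ^ 2 + v l ^ 2) ∂ρ := by
      simp only [hC, hu, hv]
      simp_rw [← quad_id c t τ]
      rw [integral_finsetSum _ fun i _ => integrable_finsetSum _ fun j _ => (int_cos ρ _).const_mul _]
      refine Finset.sum_congr rfl fun i _ => ?_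
      rw [integral_finsetSum _ fun j _ => (int_cos ρ _).const_mul _]
      refine Finset.sum_congr rfl fun j _ => ?_
      rw [integral_const_mul]
    have e2 : ∑ i, c i * D i = ∫ l in I, u l ∂ρ := by
      simp only [hD, hu]
      rw [integral_finsetSum _ fun i _ => (int_cos _ _).const_mul _]
      refine Finset.sum_congr rfl fun j _ => ?_
      rw [integral_const_mul]
    have hru : (ρ.restrict I).real univ = r := by simp [hr]
    have e3 := cs_int (ρ.restrict I) u (iu _) (iu2 _) (by rw [hru]; exact hI)
    rw [hru] at e3
    rw [e1, e2, integral_add (iu2 _) (iv2 _)]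
    have e4 : ∫ l in I, u l ^ 2 ∂ρ ≤ ∫ l, u l ^ 2 ∂ρ :=
      setIntegral_le_integral (iu2 _) (Filter.Eventually.of_forall fun l => sq_nonneg _)
    have e5 : 0 ≤ ∫ l, v l ^ 2 ∂ρ := integral_nonneg fun l => sq_nonneg _
    linarith
  have hKe : ∀ c : ι → ℝ, ∑ i, ∑ j, c i * c j * K i j =
      ∑ i, ∑ j, c i * c j * C i j - (∑ i, c i * D i) ^ 2 / r := by
    intro c
    rw [sq, Finset.sum_mul_sum, Finset.sum_div, ← Finset.sum_sub_distrib]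
    refine Finset.sum_congr rfl fun i _ => ?_
    rw [Finset.sum_div, ← Finset.sum_sub_distrib]
    refine Finset.sum_congr rfl fun j _ => ?_
    simp only [hK]; ring
  obtain ⟨B, hB⟩ := gram_exists K (fun i j => by simp only [hK]; rw [hCs i j, mul_comm (D i)])
    (fun c => by rw [hKe]; linarith [hQ c])
  have hrs : √r ^ 2 = r := Real.sq_sqrt hI.le
  refine ⟨fun i => D i / r, B, ?_, ?_, ?_, ?_⟩
  · have : IsProbabilityMeasure (P.map (fun ω i => X i ω)) :=
      Measure.isProbabilityMeasure_map (by fun_prop)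
    have : IsProbabilityMeasure (((gaussianReal 0 1).prod (stdGaussian (EuclideanSpace ℝ ι))).map
        (fun p i => √r * (D i / r) * p.1 + inner ℝ (B i) p.2)) :=
      Measure.isProbabilityMeasure_map (by fun_prop)
    apply law_eq
    intro c
    rw [Measure.map_map (by fun_prop) (by fun_prop), Measure.map_map (by fun_prop) (by fun_prop)]
    have e1 : ((fun x : ι → ℝ => ∑ i, c i * x i) ∘ fun ω i => X i ω) = fun ω => ∑ i, c i * X i ω := rfl
    have e2 : ((fun x : ι → ℝ => ∑ i, c i * x i) ∘ fun (p : ℝ × EuclideanSpace ℝ ι) i =>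
        √r * (D i / r) * p.1 + inner ℝ (B i) p.2) =
        fun p => (∑ i, c i * (√r * (D i / r))) * p.1 + inner ℝ (∑ i, c i • B i) p.2 := by
      ext p
      simp only [Function.comp, sum_inner, inner_smul_left, Finset.sum_mul, RCLike.conj_to_real]
      rw [← Finset.sum_add_distrib]
      refine Finset.sum_congr rfl fun i _ => by ring
    rw [e1, e2, hlaw, map_pair]
    congr 2
    have e3 : ‖∑ i, c i • B i‖ ^ 2 = ∑ i, ∑ j, c i * c j * K i j := by
      rw [← real_inner_self_eq_norm_sq, sum_inner]
      refine Finset.sum_congr rfl fun i _ => ?_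
      rw [inner_sum]
      refine Finset.sum_congr rfl fun j _ => ?_
      rw [inner_smul_left, inner_smul_right, hB, RCLike.conj_to_real]; ring
    have e4 : ∑ i, c i * (√r * (D i / r)) = √r / r * ∑ i, c i * D i := by
      rw [Finset.mul_sum]; exact Finset.sum_congr rfl fun i _ => by ring
    rw [e3, hKe, e4, mul_pow, div_pow, hrs]
    have : r / r ^ 2 = 1 / r := by field_simp
    rw [this]; ring
  · intro i h0 h1
    rw [le_div_iff₀ hI]
    have : ∫ l in I, (7 / 8 : ℝ) ∂ρ ≤ D i := by
      apply setIntegral_mono_on (integrable_const _).integrableOn (int_cos _ _) measurableSet_Icc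
      intro l hl
      have h2 : |l * (t i - τ)| ≤ 1 / 2 := by
        rw [abs_mul]
        have a1 : |l| ≤ 1 / N := abs_le.2 hl
        have a2 : |t i - τ| ≤ N / 2 := abs_le.2 ⟨by linarith, by linarith⟩
        calc |l| * |t i - τ| ≤ (1 / N) * (N / 2) := by gcongr
          _ = 1 / 2 := by field_simp
      have h3 := Real.one_sub_sq_div_two_le_cos (x := l * (t i - τ))
      have h4 : (l * (t i - τ)) ^ 2 ≤ 1 / 4 := by
        rw [← sq_abs]; nlinarith [abs_nonneg (l * (t i - τ))]
      linarith
    simpa [hr, mul_comm] using this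
  · intro i
    have : ‖B i‖ ^ 2 ≤ 1 := by
      rw [← real_inner_self_eq_norm_sq, hB]
      simp only [hK, hCd]
      have : 0 ≤ D i * D i / r := div_nonneg (mul_self_nonneg _) hI.le
      linarith
    exact (sq_le_one_iff₀ (norm_nonneg _)).1 this
  · intro i j
    rw [@norm_sub_sq_real, ← real_inner_self_eq_norm_sq, ← real_inner_self_eq_norm_sq, hB, hB, hB]
    rw [integral_const_mul, integral_sub (integrable_const _) (int_cos _ _)]
    simp only [hK, hCd]
    have : 0 ≤ (D i - D j) ^ 2 / r := div_nonneg (sq_nonneg _) hI.le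
    have e : (D i - D j) ^ 2 / r = D i * D i / r - 2 * (D i * D j / r) + D j * D j / r := by ring
    have e2 : ∫ (l : ℝ), (1:ℝ) ∂ρ = 1 := by simp
    rw [e2]
    change 1 - _ - 2 * (C i j - _) + (1 - _) ≤ 2 * (1 - C i j)
    linarith

end LemA

section CoreB

lemma core_bound {ι κ Ω E : Type*} [Fintype ι] [Fintype κ] [MeasurableSpace Ω]
    [NormedAddCommGroup E] [InnerProductSpace ℝ E]
    [FiniteDimensional ℝ E] [MeasurableSpace E] [BorelSpace E]
    (P : Measure Ω) (X : ι → Ω → ℝ) (hX : ∀ i, Measurable (X i)) (s : ℝ) (a : ι → ℝ) (B : ι → E)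
    (hlaw : P.map (fun ω i => X i ω) = ((gaussianReal 0 1).prod (stdGaussian E)).map
        (fun p i => s * a i * p.1 + inner ℝ (B i) p.2))
    (u : κ → E) (V b : κ → ℝ) (hV : ∀ k, ‖u k‖ ≤ V k) (L ε : ℝ) (S : ι → Prop)
    (hdet : ∀ (x : ℝ) (z : E), L < s * x → (∀ k, |inner ℝ (u k) z| ≤ b k) →
      ∀ i, S i → ε ≤ s * a i * x + inner ℝ (B i) z) :
    gaussianReal 0 1 {x | L < s * x} * ∏ k, gaussianReal 0 1 {x | V k * |x| ≤ b k} ≤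
      P {ω | ∀ i, S i → ε ≤ X i ω} := by
  have mT : MeasurableSet {x : ι → ℝ | ∀ i, S i → ε ≤ x i} := by
    have : {x : ι → ℝ | ∀ i, S i → ε ≤ x i} = ⋂ i, ⋂ (_ : S i), {x | ε ≤ x i} := by
      ext x; simp
    rw [this]
    exact MeasurableSet.iInter fun i => MeasurableSet.iInter fun _ =>
      measurableSet_le measurable_const (by fun_prop)
  have e : P {ω | ∀ i, S i → ε ≤ X i ω} =
      P.map (fun ω i => X i ω) {x : ι → ℝ | ∀ i, S i → ε ≤ x i} := by
    rw [Measure.map_apply (by fun_prop) mT]; rfl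
  rw [e, hlaw, Measure.map_apply (by fun_prop) mT]
  have h1 : ∏ k, gaussianReal 0 1 {x | V k * |x| ≤ b k} ≤
      stdGaussian E {z | ∀ k ∈ Finset.univ, |inner ℝ (u k) z| ≤ b k} :=
    (Finset.prod_le_prod' fun k _ => slab_ge (u k) (V k) (b k) (hV k)).trans (sidak _ _ _)
  calc _ ≤ gaussianReal 0 1 {x | L < s * x} *
        stdGaussian E {z | ∀ k ∈ Finset.univ, |inner ℝ (u k) z| ≤ b k} := by gcongr
    _ = ((gaussianReal 0 1).prod (stdGaussian E)) ({x | L < s * x} ×ˢ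
        {z | ∀ k ∈ Finset.univ, |inner ℝ (u k) z| ≤ b k}) := (Measure.prod_prod _ _).symm
    _ ≤ _ := by
      apply measure_mono
      rintro ⟨x, z⟩ ⟨hx, hz⟩
      exact fun i hi => hdet x z hx (fun k => hz k (Finset.mem_univ _)) i hi

lemma sig2_le (ρ : Measure ℝ) [IsFiniteMeasure ρ] (N : ℝ) (hN : 0 < N) :
    sig2 ρ N ≤ ρ.real (Icc (-(1/N)) (1/N)) := by
  refine measureReal_mono ?_ (measure_ne_top _ _)
  apply Icc_subset_Icc_left
  have : 0 < 1 / N := by positivity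
  linarith

lemma tail_mono (σ s L : ℝ) (h0 : 0 ≤ σ) (h : σ ≤ s) (hL : 0 < L) :
    gaussianReal 0 1 {x | σ * x > L} ≤ gaussianReal 0 1 {x | L < s * x} := by
  apply measure_mono
  intro x hx
  have hx : L < σ * x := hx
  have : 0 < x := by
    by_contra hn
    nlinarith
  show L < s * x
  nlinarith

lemma tail_zero (L : ℝ) (hL : 0 < L) (μ : Measure ℝ) : μ {x | (0:ℝ) * x > L} = 0 := by
  have : {x : ℝ | (0:ℝ) * x > L} = ∅ := by
    ext x; simp; exact hL.le
  rw [this]; simp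

lemma caseZ {Ω : Type*} [MeasurableSpace Ω] (P : Measure Ω) (ρ : Measure ℝ)
    (f : ℤ → Ω → ℝ) (hf : IsGSPZ ρ P f) (h1 : ρ Set.univ = 1) (ℓ : ℝ) (hℓ : 0 < ℓ) (N : ℝ) (hN : 0 < N) :
      (stdGauss {x : ℝ | Real.sqrt (sig2 ρ N) * x > ℓ}).toReal *
              (stdGauss {x : ℝ | 2 * Real.sqrt 2 * |x| < ℓ}).toReal ^ N
            ≤ persZ P f N := by
  obtain ⟨-, -, -, hP, hm, hlaw⟩ := hf
  have : IsProbabilityMeasure ρ := ⟨h1⟩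
  unfold persZ stdGauss
  set r := ρ.real (Icc (-(1/N)) (1/N)) with hr
  have hsr := sig2_le ρ N hN
  rcases (measureReal_nonneg : 0 ≤ r).eq_or_lt with h0 | h0
  · have : sig2 ρ N ≤ 0 := by rw [h0]; exact hsr
    rw [Real.sqrt_eq_zero_of_nonpos this, tail_zero ℓ hℓ]
    simp
  rw [ENNReal.toReal_rpow, ← ENNReal.toReal_mul]
  apply ENNReal.toReal_mono (measure_ne_top _ _)
  set n := ⌊N⌋₊ with hn
  let T : Fin n → ℤ := fun i => (i : ℕ) + 1
  obtain ⟨a, B, hL, ha, hB, -⟩ := decomp P ρ (fun i : Fin n => f (T i)) (fun i => hm _)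
    (fun i => (T i : ℝ)) (fun c => hlaw n T c) N hN h0
  have key := core_bound P (fun i : Fin n => f (T i)) (fun i => hm _) _ a B hL B (fun _ => 1)
    (fun _ => ℓ / 2) hB ℓ (3 / 8 * ℓ) (fun _ => True) (by
      intro x z hx hz i _
      have h2 := ha i (by simp [T]; positivity) (by
        have : ((i : ℕ) + 1 : ℕ) ≤ N := (Nat.le_floor_iff hN.le).1 (by omega)
        simpa [T] using this)
      have h3 := (abs_le.1 (hz i)).1
      have h4 : √r * a i * x = a i * (√r * x) := by ring
      rw [h4]
      nlinarith)
  calc _ ≤ gaussianReal 0 1 {x | ℓ < √r * x} * ∏ k : Fin n, gaussianReal 0 1 {x | (1:ℝ) * |x| ≤ ℓ / 2} := by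
        refine mul_le_mul' ?_ ?_
        · exact tail_mono _ _ _ (Real.sqrt_nonneg _) (Real.sqrt_le_sqrt hsr) hℓ
        · rw [Finset.prod_const, Finset.card_univ, Fintype.card_fin]
          have hp : gaussianReal 0 1 {x : ℝ | 2 * Real.sqrt 2 * |x| < ℓ} ≤
              gaussianReal 0 1 {x | (1:ℝ) * |x| ≤ ℓ / 2} := by
            apply measure_mono
            intro x hx
            have hx : 2 * √2 * |x| < ℓ := hx
            show 1 * |x| ≤ ℓ / 2
            have : 1 ≤ √2 := Real.one_le_sqrt.2 (by norm_num)
            nlinarith [abs_nonneg x]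
          calc _ ≤ (gaussianReal 0 1 {x : ℝ | 2 * Real.sqrt 2 * |x| < ℓ}) ^ (n : ℝ) :=
                ENNReal.rpow_le_rpow_of_exponent_ge prob_le_one (Nat.floor_le hN.le)
            _ ≤ _ := by
                rw [ENNReal.rpow_natCast]
                gcongr
    _ ≤ _ := key
    _ ≤ _ := by
        apply measure_mono
        intro ω hω m hm0 hmN
        have hω : ∀ i : Fin n, True → 3 / 8 * ℓ ≤ f (T i) ω := hω
        have hk : m.toNat ≤ n := by
          apply Nat.le_floor
          have : ((m.toNat : ℤ) : ℝ) = m := by rw [Int.toNat_of_nonneg hm0.le]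
          have h2 : ((m.toNat : ℕ) : ℝ) = m := by exact_mod_cast this
          rw [h2]; exact hmN
        have h3 := hω ⟨m.toNat - 1, by omega⟩ trivial
        have : T ⟨m.toNat - 1, by omega⟩ = m := by simp only [T]; omega
        rw [this] at h3
        have : 0 < 3 / 8 * ℓ := by positivity
        exact this.trans_le h3

end CoreB

section Tails

lemma up_tail (y : ℝ) (hy : 0 ≤ y) : (gaussianReal 0 1).real {x | y ≤ x} ≤ Real.exp (-y ^ 2 / 2) := by
  have h : HasSubgaussianMGF id 1 (gaussianReal 0 1) :=
    ⟨fun t => integrable_exp_mul_gaussianReal t, fun t => by rw [mgf_id_gaussianReal]; simp⟩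
  simpa using h.measure_ge_le hy

lemma abs_tail (y : ℝ) (hy : 0 ≤ y) : 1 - 2 * Real.exp (-y ^ 2 / 2) ≤ (gaussianReal 0 1).real {x | |x| < y} := by
  have h1 := up_tail y hy
  have h2 : (gaussianReal 0 1).real {x | x ≤ -y} ≤ Real.exp (-y ^ 2 / 2) := by
    have e : gaussianReal 0 1 = (gaussianReal 0 1).map (fun x => -x) := by
      rw [gaussianReal_map_neg]; simp
    have : (gaussianReal 0 1).real {x | x ≤ -y} = (gaussianReal 0 1).real {x | y ≤ x} := by
      conv_lhs => rw [e]
      rw [map_measureReal_apply (by fun_prop) (measurableSet_le (by fun_prop) (by fun_prop))]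
      congr 1; ext x; simp
    rw [this]; exact h1
  have h3 : (gaussianReal 0 1).real ({x | |x| < y}ᶜ) ≤ (gaussianReal 0 1).real {x | y ≤ x} +
      (gaussianReal 0 1).real {x | x ≤ -y} := by
    refine (measureReal_mono ?_ (measure_ne_top _ _)).trans (measureReal_union_le _ _)
    intro x hx
    have hx : ¬ |x| < y := hx
    rw [not_lt, le_abs] at hx
    rcases hx with hx | hx
    · left; exact hx
    · right; show x ≤ -y; linarith
  rw [probReal_compl_eq_one_sub (measurableSet_lt (by fun_prop) (by fun_prop))] at h3
  linarith

def cG : ℝ := Real.exp (-1) / √(2 * π)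

lemma cG_pos : 0 < cG := by unfold cG; positivity

lemma low_tail (y : ℝ) (hy : 0 ≤ y) : cG * Real.exp (-y ^ 2) ≤ (gaussianReal 0 1).real {x | y < x} := by
  have h1 : (gaussianReal 0 1).real (Ioc y (y + 1)) ≤ (gaussianReal 0 1).real {x | y < x} :=
    measureReal_mono (fun x hx => hx.1) (measure_ne_top _ _)
  refine le_trans ?_ h1
  have h2 : (gaussianReal 0 1).real (Ioc y (y + 1)) = ∫ x in Ioc y (y + 1), gaussianPDFReal 0 1 x := by
    rw [measureReal_def, gaussianReal_apply_eq_integral _ one_ne_zero, ENNReal.toReal_ofReal]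
    exact integral_nonneg fun x => gaussianPDFReal_nonneg _ _ _
  rw [h2]
  have h3 : ∫ x in Ioc y (y + 1), cG * Real.exp (-y ^ 2) ≤ ∫ x in Ioc y (y + 1), gaussianPDFReal 0 1 x := by
    apply setIntegral_mono_on (integrableOn_const (by simp)) (integrable_gaussianPDFReal _ _).integrableOn measurableSet_Ioc
    intro x hx
    have e : cG * Real.exp (-y ^ 2) = (√(2 * π))⁻¹ * Real.exp (-1 + -y ^ 2) := by
      rw [Real.exp_add]; unfold cG; ring
    rw [e, gaussianPDFReal]
    simp only [NNReal.coe_one, mul_one, sub_zero]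
    gcongr
    have : 0 < x := hy.trans_lt hx.1
    have := hx.2
    nlinarith [sq_nonneg (y - 1)]
  simpa using h3

lemma weier {α : Type*} (s : Finset α) (w : α → ℝ) (n : α → ℕ) (h0 : ∀ i, 0 ≤ w i) (h1 : ∀ i, w i ≤ 1) :
    1 - ∑ i ∈ s, n i * (1 - w i) ≤ ∏ i ∈ s, w i ^ n i := by
  classical
  induction s using Finset.induction_on with
  | empty => simp
  | insert a s ha ih =>
    rw [Finset.sum_insert ha, Finset.prod_insert ha]
    have a1 : w a ^ n a ≤ 1 := pow_le_one₀ (h0 a) (h1 a)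
    have a2 : ∏ i ∈ s, w i ^ n i ≤ 1 :=
      Finset.prod_le_one (fun i _ => pow_nonneg (h0 i) _) fun i _ => pow_le_one₀ (h0 i) (h1 i)
    have a3 := one_add_mul_sub_le_pow (a := w a) (by linarith [h0 a]) (n a)
    nlinarith [mul_nonneg (sub_nonneg.2 a1) (sub_nonneg.2 a2)]

lemma qk_bound (η κ ℓ S : ℝ) (b : ℕ → ℝ) (hη0 : 0 < η) (hη1 : η < 1) (hκ : 0 < κ) (hℓ : 0 < ℓ) (hS : 0 < S)
    (hb : ∀ j, b j = κ * S * ℓ * η ^ j)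
    (c1 : Real.exp (-(κ ^ 2 / 2 * ((η ^ 2)⁻¹ - 1) * ℓ ^ 2)) ≤ 1 / 4)
    (c2 : Real.exp (-(κ ^ 2 / 4 * ℓ ^ 2)) ≤ cG / 4) (k : ℕ) :
    (gaussianReal 0 1).real {x | 2 / κ * |x| < ℓ} ≤
      ∏ j ∈ Finset.range (k + 1), (gaussianReal 0 1).real {x | S * η ^ (2 * j) * |x| ≤ b j} ^ 2 ^ j := by
  have hw := weier (Finset.range (k + 1))
    (fun j => (gaussianReal 0 1).real {x | S * η ^ (2 * j) * |x| ≤ b j}) (fun j => 2 ^ j)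
    (fun j => measureReal_nonneg) (fun j => measureReal_le_one)
  refine le_trans ?_ hw
  set K := κ ^ 2 * ℓ ^ 2 / 2 with hK
  have hKp : 0 < K := by positivity
  have t1 : ∀ j : ℕ, ((2 ^ j : ℕ) : ℝ) * (1 - (gaussianReal 0 1).real {x | S * η ^ (2 * j) * |x| ≤ b j}) ≤
      2 * Real.exp (-K) * (1 / 2) ^ j := by
    intro j
    have e1 : 1 - 2 * Real.exp (-(κ * ℓ * (η ^ j)⁻¹) ^ 2 / 2) ≤
        (gaussianReal 0 1).real {x | S * η ^ (2 * j) * |x| ≤ b j} := by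
      refine (abs_tail (κ * ℓ * (η ^ j)⁻¹) (by positivity)).trans ?_
      refine measureReal_mono ?_ (measure_ne_top _ _)
      intro x hx
      have hx : |x| < κ * ℓ * (η ^ j)⁻¹ := hx
      show S * η ^ (2 * j) * |x| ≤ b j
      rw [hb]
      calc S * η ^ (2 * j) * |x| ≤ S * η ^ (2 * j) * (κ * ℓ * (η ^ j)⁻¹) := by gcongr
        _ = κ * S * ℓ * η ^ j := by
          rw [mul_comm 2 j, pow_mul]; field_simp
    have e2 : Real.exp (-(κ * ℓ * (η ^ j)⁻¹) ^ 2 / 2) ≤ Real.exp (-K) * (1 / 4) ^ j := by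
      have hz : 1 < (η ^ 2)⁻¹ := (one_lt_inv₀ (by positivity)).2 (by nlinarith)
      have e3 := one_add_mul_sub_le_pow (a := (η ^ 2)⁻¹) (by linarith) j
      have e4 : -(κ * ℓ * (η ^ j)⁻¹) ^ 2 / 2 = -(K * ((η ^ 2)⁻¹) ^ j) := by
        rw [hK, inv_pow, ← pow_mul, mul_comm 2 j, pow_mul]; field_simp
      rw [e4]
      calc Real.exp (-(K * ((η ^ 2)⁻¹) ^ j)) ≤ Real.exp (-K + j * (-(κ ^ 2 / 2 * ((η ^ 2)⁻¹ - 1) * ℓ ^ 2))) := by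
            apply Real.exp_le_exp.2
            have : K * (1 + j * ((η ^ 2)⁻¹ - 1)) ≤ K * ((η ^ 2)⁻¹) ^ j := by gcongr
            have h5 : K * (1 + j * ((η ^ 2)⁻¹ - 1)) = K + j * (κ ^ 2 / 2 * ((η ^ 2)⁻¹ - 1) * ℓ ^ 2) := by
              rw [hK]; ring
            linarith
        _ = Real.exp (-K) * Real.exp (-(κ ^ 2 / 2 * ((η ^ 2)⁻¹ - 1) * ℓ ^ 2)) ^ j := by
            rw [Real.exp_add, Real.exp_nat_mul]
        _ ≤ _ := by gcongr
    calc _ ≤ (2:ℝ) ^ j * (2 * (Real.exp (-K) * (1 / 4) ^ j)) := by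
          push_cast
          gcongr
          linarith
      _ = 2 * Real.exp (-K) * (2 ^ j * (1 / 4) ^ j) := by ring
      _ = _ := by rw [← mul_pow]; norm_num
  have t2 : ∑ j ∈ Finset.range (k + 1), ((2 ^ j : ℕ) : ℝ) * (1 - (gaussianReal 0 1).real {x | S * η ^ (2 * j) * |x| ≤ b j}) ≤
      4 * Real.exp (-K) := by
    refine (Finset.sum_le_sum fun j _ => t1 j).trans ?_
    rw [← Finset.mul_sum]
    have : ∑ j ∈ Finset.range (k + 1), (1 / 2 : ℝ) ^ j ≤ 2 := sum_geometric_two_le _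
    nlinarith [Real.exp_pos (-K)]
  have t3 : (gaussianReal 0 1).real {x | 2 / κ * |x| < ℓ} ≤ 1 - cG * Real.exp (-(κ * ℓ / 2) ^ 2) := by
    have h := low_tail (κ * ℓ / 2) (by positivity)
    have h2 : (gaussianReal 0 1).real {x | 2 / κ * |x| < ℓ} + (gaussianReal 0 1).real {x | κ * ℓ / 2 < x} ≤ 1 := by
      rw [← measureReal_union _ (measurableSet_lt (by fun_prop) (by fun_prop))]
      · exact measureReal_le_one
      · rw [Set.disjoint_left]
        intro x hx hx2
        have hx : 2 / κ * |x| < ℓ := hx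
        have hx2 : κ * ℓ / 2 < x := hx2
        have := le_abs_self x
        have h3 : 2 / κ * (κ * ℓ / 2) < ℓ := lt_of_le_of_lt (by gcongr; linarith) hx
        have h4 : 2 / κ * (κ * ℓ / 2) = ℓ := by field_simp
        linarith
    linarith
  have t4 : 4 * Real.exp (-K) ≤ cG * Real.exp (-(κ * ℓ / 2) ^ 2) := by
    have e1 : -(κ * ℓ / 2) ^ 2 = -(κ ^ 2 / 4 * ℓ ^ 2) := by ring
    have e2 : -K = -(κ ^ 2 / 4 * ℓ ^ 2) + -(κ ^ 2 / 4 * ℓ ^ 2) := by rw [hK]; ring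
    rw [e1, e2, Real.exp_add]
    nlinarith [Real.exp_pos (-(κ ^ 2 / 4 * ℓ ^ 2))]
  have t2' := t2
  linarith

lemma double_tail (σ ℓ : ℝ) (h0 : 0 ≤ σ) (h1 : σ ≤ 1) (hℓ : 0 < ℓ)
    (c3 : Real.exp (-(1 / 4 * ℓ ^ 2)) ≤ cG / 2) :
    2 * (gaussianReal 0 1).real {x | σ * x > ℓ} ≤ (gaussianReal 0 1).real {x | σ * x > ℓ / 2} := by
  rcases h0.eq_or_lt with h | h
  · rw [← h]
    rw [measureReal_def, tail_zero ℓ hℓ]; simp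
  set y := ℓ / σ with hy
  have hy0 : 0 < y := by positivity
  have hyl : ℓ ≤ y := by rw [hy, le_div_iff₀ h]; nlinarith
  have e1 : (gaussianReal 0 1).real {x | σ * x > ℓ} ≤ Real.exp (-y ^ 2 / 2) := by
    refine le_trans (measureReal_mono ?_ (measure_ne_top _ _)) (up_tail y hy0.le)
    intro x hx
    have hx : σ * x > ℓ := hx
    show y ≤ x
    rw [hy, div_le_iff₀ h]; linarith
  have e2 : cG * Real.exp (-(y / 2) ^ 2) ≤ (gaussianReal 0 1).real {x | σ * x > ℓ / 2} := by
    refine (low_tail (y / 2) (by positivity)).trans (measureReal_mono ?_ (measure_ne_top _ _))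
    intro x hx
    have hx : y / 2 < x := hx
    show σ * x > ℓ / 2
    have : σ * (y / 2) = ℓ / 2 := by rw [hy]; field_simp
    nlinarith
  have e3 : Real.exp (-(y / 2) ^ 2) ≤ cG / 2 := by
    refine le_trans (Real.exp_le_exp.2 ?_) c3
    nlinarith
  have e4 : -y ^ 2 / 2 = -(y / 2) ^ 2 + -(y / 2) ^ 2 := by ring
  rw [e4, Real.exp_add] at e1
  nlinarith [Real.exp_pos (-(y / 2) ^ 2)]

lemma ev_exp (a ε : ℝ) (ha : 0 < a) (hε : 0 < ε) : ∀ᶠ ℓ : ℝ in Filter.atTop, Real.exp (-(a * ℓ ^ 2)) ≤ ε := by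
  have h1 : Filter.Tendsto (fun ℓ : ℝ => Real.exp (-(a * ℓ ^ 2))) Filter.atTop (nhds 0) := by
    apply Real.tendsto_exp_neg_atTop_nhds_zero.comp
    exact (Filter.tendsto_pow_atTop two_ne_zero).const_mul_atTop ha
  exact h1.eventually_le_const hε

end Tails

section Incr

lemma cos_bd (d x : ℝ) (h0 : 0 < d) (h1 : d ≤ 1) : 2 * (1 - Real.cos x) ≤ 4 * |x| ^ d := by
  rcases le_total |x| 1 with h | h
  · have e1 := Real.one_sub_sq_div_two_le_cos (x := x)
    have e2 : |x| ^ (2:ℝ) ≤ |x| ^ d :=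
      Real.rpow_le_rpow_of_exponent_ge_of_imp (abs_nonneg _) h (by linarith) (by intro _ h; linarith)
    rw [Real.rpow_two, sq_abs] at e2
    have : 0 ≤ |x| ^ d := by positivity
    linarith
  · have : 1 ≤ |x| ^ d := Real.one_le_rpow h h0.le
    have := Real.neg_one_le_cos x
    linarith

lemma incr (ρ : Measure ℝ) [IsProbabilityMeasure ρ] (δ m : ℝ) (hδ : 0 < δ)
    (hm : specMom ρ δ = ENNReal.ofReal m) (Δ : ℝ) :
    ∫ l, 2 * (1 - Real.cos (l * Δ)) ∂ρ ≤ 4 * (1 + max m 0) * |Δ| ^ (min δ 1) := by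
  set d := min δ 1 with hd
  have hd0 : 0 < d := lt_min hδ one_pos
  have hd1 : d ≤ 1 := min_le_right _ _
  have hl : ∫⁻ l, ENNReal.ofReal (|l| ^ δ) ∂ρ = ENNReal.ofReal m := by
    rw [← hm, specMom]
    congr 1; ext l
    rw [ENNReal.ofReal_rpow_of_nonneg (abs_nonneg _) hδ.le]
  have hmeas : Measurable fun l : ℝ => |l| ^ δ := by fun_prop
  have hint : Integrable (fun l : ℝ => |l| ^ δ) ρ := by
    refine ⟨hmeas.aestronglyMeasurable, ?_⟩
    rw [hasFiniteIntegral_iff_ofReal (Filter.Eventually.of_forall fun l => by positivity), hl]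
    exact ENNReal.ofReal_lt_top
  have hval : ∫ l, |l| ^ δ ∂ρ = max m 0 := by
    rw [integral_eq_lintegral_of_nonneg_ae (Filter.Eventually.of_forall fun l => by positivity)
      hmeas.aestronglyMeasurable, hl, ENNReal.toReal_ofReal']
  have hpt : ∀ l : ℝ, 2 * (1 - Real.cos (l * Δ)) ≤ 4 * |Δ| ^ d * (1 + |l| ^ δ) := by
    intro l
    have h1 := cos_bd d (l * Δ) hd0 hd1
    rw [abs_mul, Real.mul_rpow (abs_nonneg _) (abs_nonneg _)] at h1
    have h2 : |l| ^ d ≤ 1 + |l| ^ δ := by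
      rcases le_total |l| 1 with h | h
      · have : |l| ^ d ≤ 1 := Real.rpow_le_one (abs_nonneg _) h hd0.le
        have : 0 ≤ |l| ^ δ := by positivity
        linarith
      · have : |l| ^ d ≤ |l| ^ δ := Real.rpow_le_rpow_of_exponent_le h (min_le_left _ _)
        linarith
    have h3 : 0 ≤ |Δ| ^ d := by positivity
    nlinarith
  calc ∫ l, 2 * (1 - Real.cos (l * Δ)) ∂ρ ≤ ∫ l, 4 * |Δ| ^ d * (1 + |l| ^ δ) ∂ρ := by
        apply integral_mono (((integrable_const _).sub (int_cos ρ Δ)).const_mul _)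
          (((integrable_const _).add hint).const_mul _) hpt
    _ = _ := by
        rw [integral_const_mul, integral_add (integrable_const _) hint, hval]
        simp; ring

lemma reindex {ι Ω : Type*} [Fintype ι] [MeasurableSpace Ω] (ρ : Measure ℝ) (P : Measure Ω)
    (f : ℝ → Ω → ℝ) (hf : IsGSPR ρ P f) (t c : ι → ℝ) :
    P.map (fun ω => ∑ i, c i * f (t i) ω)
      = gaussianReal 0 (∑ i, ∑ j, c i * c j * ∫ l, Real.cos (l * (t i - t j)) ∂ρ).toNNReal := by
  obtain ⟨-, -, -, -, -, h⟩ := hf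
  have := h (Fintype.card ι) (t ∘ (Fintype.equivFin ι).symm) (c ∘ (Fintype.equivFin ι).symm)
  convert this using 2
  · ext ω
    exact ((Fintype.equivFin ι).symm.sum_comp (fun i => c i * f (t i) ω)).symm
  · congr 1
    rw [← (Fintype.equivFin ι).symm.sum_comp]
    refine Finset.sum_congr rfl fun i _ => ?_
    rw [← (Fintype.equivFin ι).symm.sum_comp]
    rfl

lemma half_diff (j q : ℕ) : |(q : ℝ) / 2 ^ (j + 1) - ((q / 2 : ℕ) : ℝ) / 2 ^ j| ≤ (1 / 2) ^ (j + 1) := by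
  have h : ((q % 2 : ℕ) : ℝ) + 2 * ((q / 2 : ℕ) : ℝ) = q := by exact_mod_cast Nat.mod_add_div q 2
  have h2 : ((q % 2 : ℕ) : ℝ) ≤ 1 := by
    have : q % 2 ≤ 1 := by omega
    exact_mod_cast this
  have e : (q : ℝ) / 2 ^ (j + 1) - ((q / 2 : ℕ) : ℝ) / 2 ^ j = ((q % 2 : ℕ) : ℝ) / 2 ^ (j + 1) := by
    rw [← h, pow_succ]; field_simp; ring
  rw [e, abs_of_nonneg (by positivity), one_div, inv_pow, div_eq_mul_inv]
  exact mul_le_of_le_one_left (by positivity) h2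

lemma chain {E : Type*} [NormedAddCommGroup E] [InnerProductSpace ℝ E] (k M : ℕ) (Bx : ℕ → ℕ → E) (z : E)
    (b : ℕ → ℝ) (h0 : ∀ q < M, |inner ℝ (Bx 0 q) z| ≤ b 0)
    (h1 : ∀ j < k, ∀ q < M * 2 ^ (j + 1), |inner ℝ (Bx (j + 1) q - Bx j (q / 2)) z| ≤ b (j + 1)) :
    ∀ j ≤ k, ∀ q < M * 2 ^ j, |inner ℝ (Bx j q) z| ≤ ∑ i ∈ Finset.range (j + 1), b i := by
  intro j
  induction j with
  | zero => intro _ q hq; simpa using h0 q (by simpa using hq)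
  | succ j ih =>
    intro hj q hq
    rw [Finset.sum_range_succ]
    have hq2 : q / 2 < M * 2 ^ j := by rw [pow_succ, ← mul_assoc] at hq; omega
    have a1 := ih (by omega) (q / 2) hq2
    have a2 := h1 j (by omega) q hq
    rw [inner_sub_left] at a2
    have := abs_add_le (inner ℝ (Bx (j + 1) q) z - inner ℝ (Bx j (q / 2)) z) (inner ℝ (Bx j (q / 2)) z)
    rw [sub_add_cancel] at this
    linarith

lemma dyadic {Ω : Type*} [MeasurableSpace Ω] (P : Measure Ω) (ρ : Measure ℝ) [IsProbabilityMeasure ρ]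
    [IsProbabilityMeasure P]
    (f : ℝ → Ω → ℝ) (hf : IsGSPR ρ P f) (hmeas : ∀ t, Measurable (f t)) (δ m : ℝ) (hδ : 0 < δ)
    (hm : specMom ρ δ = ENNReal.ofReal m) (N : ℝ) (hN : 0 < N) (h0 : 0 < ρ.real (Icc (-(1/N)) (1/N)))
    (η S ℓ : ℝ) (hη : η = (2:ℝ) ^ (-(min δ 1) / 4)) (hη1 : η < 1) (hS : S = 2 * √(1 + max m 0)) (hℓ : 0 < ℓ)
    (b : ℕ → ℝ) (hb : ∀ j, b j = 3 / 8 * ℓ * (1 - η) * η ^ j) (M k : ℕ) :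
    gaussianReal 0 1 {x | ℓ / 2 < √(ρ.real (Icc (-(1/N)) (1/N))) * x} *
      (∏ j ∈ Finset.range (k + 1), gaussianReal 0 1 {x | S * η ^ (2 * j) * |x| ≤ b j} ^ 2 ^ j) ^ M ≤
    P {ω | ∀ j ≤ k, ∀ q < M * 2 ^ j, (q : ℝ) / 2 ^ j ≤ N → ℓ / 16 ≤ f (q / 2 ^ j) ω} := by
  set r := ρ.real (Icc (-(1/N)) (1/N)) with hr
  have hη0 : 0 < η := by rw [hη]; positivity
  have hS1 : 1 ≤ S := by
    have : 1 ≤ √(1 + max m 0) := Real.one_le_sqrt.2 (by linarith [le_max_right m 0])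
    linarith
  let ι := Σ j : Fin (k + 1), Fin (M * 2 ^ (j : ℕ))
  let t : ι → ℝ := fun i => ((i.2 : ℕ) : ℝ) / 2 ^ (i.1 : ℕ)
  obtain ⟨a, B, hL, ha, hB, hBd⟩ := decomp P ρ (fun i : ι => f (t i)) (fun i => hmeas _)
    t (fun c => reindex ρ P f hf t c) N hN h0
  let Bx : ℕ → ℕ → EuclideanSpace ℝ ι := fun j q =>
    if h : j < k + 1 ∧ q < M * 2 ^ j then B ⟨⟨j, h.1⟩, ⟨q, h.2⟩⟩ else 0
  have hBx : ∀ i : ι, Bx i.1 i.2 = B i := by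
    rintro ⟨⟨j, hj⟩, ⟨q, hq⟩⟩
    simp only [Bx]
    rw [dif_pos ⟨hj, hq⟩]
  have hBx' : ∀ j q (hj : j < k + 1) (hq : q < M * 2 ^ j), Bx j q = B ⟨⟨j, hj⟩, ⟨q, hq⟩⟩ := by
    intro j q hj hq
    exact dif_pos ⟨hj, hq⟩
  let u : ι → EuclideanSpace ℝ ι := fun i =>
    if (i.1 : ℕ) = 0 then Bx i.1 i.2 else Bx i.1 i.2 - Bx ((i.1 : ℕ) - 1) ((i.2 : ℕ) / 2)
  have hu : ∀ i : ι, ‖u i‖ ≤ S * η ^ (2 * (i.1 : ℕ)) := by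
    rintro ⟨⟨j, hj⟩, ⟨q, hq⟩⟩
    simp only [u]
    rcases j with _ | j
    · rw [if_pos rfl, hBx' _ _ hj hq]
      simpa using (hB _).trans hS1
    · rw [if_neg (by simp)]
      have hq' : q < M * 2 ^ (j + 1) := hq
      have hq2 : q / 2 < M * 2 ^ j := by rw [pow_succ, ← mul_assoc] at hq'; omega
      simp only [Nat.add_sub_cancel]
      rw [hBx' _ _ hj hq, hBx' j (q / 2) (by omega) hq2]
      apply le_of_sq_le_sq _ (by positivity)
      refine (hBd _ _).trans ((incr ρ δ m hδ hm _).trans ?_)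
      have e1 : |t ⟨⟨j + 1, hj⟩, ⟨q, hq⟩⟩ - t ⟨⟨j, by omega⟩, ⟨q / 2, hq2⟩⟩| ≤ (1 / 2) ^ (j + 1) := half_diff j q
      have e2 : (S * η ^ (2 * (j + 1))) ^ 2 = 4 * (1 + max m 0) * (η ^ 4) ^ (j + 1) := by
        rw [mul_pow, hS, mul_pow, Real.sq_sqrt (by linarith [le_max_right m 0])]
        ring
      have e3 : η ^ 4 = (1 / 2 : ℝ) ^ (min δ 1) := by
        rw [hη, ← Real.rpow_natCast, ← Real.rpow_mul (by norm_num), one_div, Real.inv_rpow (by norm_num),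
          ← Real.rpow_neg (by norm_num)]
        congr 1; push_cast; ring
      have e4 : ((1 / 2 : ℝ) ^ (j + 1)) ^ (min δ 1) = (η ^ 4) ^ (j + 1) := by
        rw [e3, ← Real.rpow_natCast, ← Real.rpow_mul (by norm_num), mul_comm, Real.rpow_mul (by norm_num),
          Real.rpow_natCast]
      rw [e2, ← e4]
      have : 0 ≤ max m 0 := le_max_right _ _
      have : 0 ≤ min δ 1 := (lt_min hδ one_pos).le
      gcongr
  have hsum : ∀ n, ∑ i ∈ Finset.range n, b i ≤ 3 / 8 * ℓ := by
    intro n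
    simp_rw [hb]
    rw [← Finset.mul_sum]
    have e := geom_sum_mul_neg η n
    have : 0 ≤ η ^ n := by positivity
    calc 3 / 8 * ℓ * (1 - η) * ∑ i ∈ Finset.range n, η ^ i = 3 / 8 * ℓ * ((∑ i ∈ Finset.range n, η ^ i) * (1 - η)) := by ring
      _ = 3 / 8 * ℓ * (1 - η ^ n) := by rw [e]
      _ ≤ _ := by nlinarith
  have key := core_bound P (fun i : ι => f (t i)) (fun i => hmeas _) _ a B hL u
    (fun i => S * η ^ (2 * (i.1 : ℕ))) (fun i => b i.1) hu (ℓ / 2) (ℓ / 16) (fun i => t i ≤ N) (by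
      intro x z hx hz i hi
      have h2 := ha i (by simp only [t]; positivity) hi
      have h3 := chain k M Bx z b (by
        intro q hq
        have := hz ⟨⟨0, by omega⟩, ⟨q, by simpa using hq⟩⟩
        simpa [u] using this) (by
        intro j hj q hq
        have := hz ⟨⟨j + 1, by omega⟩, ⟨q, hq⟩⟩
        simpa [u] using this) i.1 (by omega) i.2 i.2.2
      rw [hBx] at h3
      have h3 := (abs_le.1 (h3.trans (hsum _))).1
      have h4 : √r * a i * x = a i * (√r * x) := by ring
      rw [h4]
      nlinarith)
  refine le_trans (le_of_eq ?_) (key.trans (measure_mono ?_))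
  · congr 1
    rw [Fintype.prod_sigma]
    simp only [Finset.prod_const, Finset.card_univ, Fintype.card_fin]
    rw [Fin.prod_univ_eq_prod_range (fun j => gaussianReal 0 1 {x | S * η ^ (2 * j) * |x| ≤ b j} ^ (M * 2 ^ j)),
      ← Finset.prod_pow]
    refine Finset.prod_congr rfl fun j _ => ?_
    rw [← pow_mul, Nat.mul_comm M]
  · intro ω hω j hj q hq hqN
    exact hω ⟨⟨j, by omega⟩, ⟨q, hq⟩⟩ hqN

end Incr

section CaseR

lemma path_pos (g : ℝ → ℝ) (hg : Continuous g) (N ε : ℝ) (M : ℕ) (hM : N < M)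
    (h : ∀ k : ℕ, ∀ j ≤ k, ∀ q < M * 2 ^ j, (q : ℝ) / 2 ^ j ≤ N → ε ≤ g (q / 2 ^ j)) (t : ℝ)
    (ht : t ∈ Ioc 0 N) : ε ≤ g t := by
  have h1 : Filter.Tendsto (fun j : ℕ => ((⌊t * 2 ^ j⌋₊ : ℕ) : ℝ) / 2 ^ j) Filter.atTop (nhds t) :=
    (tendsto_nat_floor_mul_div_atTop ht.1.le).comp
      (tendsto_pow_atTop_atTop_of_one_lt (by norm_num : (1:ℝ) < 2))
  have h2 := (hg.tendsto t).comp h1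
  refine ge_of_tendsto' h2 fun j => ?_
  have hfl : ((⌊t * 2 ^ j⌋₊ : ℕ) : ℝ) ≤ t * 2 ^ j := Nat.floor_le (by have := ht.1; positivity)
  apply h j j le_rfl
  · have : ((⌊t * 2 ^ j⌋₊ : ℕ) : ℝ) < ((M * 2 ^ j : ℕ) : ℝ) := by
      push_cast
      have : t < M := lt_of_le_of_lt ht.2 hM
      exact lt_of_le_of_lt hfl (by gcongr)
    exact_mod_cast this
  · refine le_trans ?_ ht.2
    rw [div_le_iff₀ (by positivity)]; exact hfl

lemma caseR (δ m : ℝ) (hδ : 0 < δ) :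
      ∃ β : ℝ, 0 < β ∧ ∃ ℓ₀ : ℝ, 0 ≤ ℓ₀ ∧
        ∀ (Ω : Type) (_ : MeasurableSpace Ω) (P : Measure Ω) (ρ : Measure ℝ)
          (f : ℝ → Ω → ℝ), IsGSPR ρ P f → ρ Set.univ = 1 →
          specMom ρ δ = ENNReal.ofReal m →
          ∀ ℓ : ℝ, ℓ₀ < ℓ → ∀ N : ℝ, 0 < N →
            (stdGauss {x : ℝ | Real.sqrt (sig2 ρ N) * x > ℓ}).toReal *
                (stdGauss {x : ℝ | β * |x| < ℓ}).toReal ^ N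
              ≤ persR P f N := by
  obtain ⟨η, hη⟩ : ∃ η : ℝ, η = (2:ℝ) ^ (-(min δ 1) / 4) := ⟨_, rfl⟩
  obtain ⟨S, hS⟩ : ∃ S : ℝ, S = 2 * √(1 + max m 0) := ⟨_, rfl⟩
  have hη0 : 0 < η := by rw [hη]; positivity
  have hη1 : η < 1 := by
    rw [hη]
    apply Real.rpow_lt_one_of_one_lt_of_neg (by norm_num)
    have : 0 < min δ 1 := lt_min hδ one_pos
    linarith
  have hS0 : 0 < S := by
    have : 0 < 1 + max m 0 := by linarith [le_max_right m 0]
    rw [hS]; positivity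
  obtain ⟨κ, hκ⟩ : ∃ κ : ℝ, κ = 3 / 8 * (1 - η) / S := ⟨_, rfl⟩
  have hκ0 : 0 < κ := by
    have : 0 < 1 - η := by linarith
    rw [hκ]; positivity
  have hz : 1 < (η ^ 2)⁻¹ := (one_lt_inv₀ (by positivity)).2 (by nlinarith)
  have hz' : 0 < κ ^ 2 / 2 * ((η ^ 2)⁻¹ - 1) := mul_pos (by positivity) (by linarith)
  have hc := cG_pos
  have ev := (ev_exp (κ ^ 2 / 2 * ((η ^ 2)⁻¹ - 1)) (1 / 4) hz' (by norm_num)).and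
    ((ev_exp (κ ^ 2 / 4) (cG / 4) (by positivity) (by positivity)).and
    ((ev_exp (1 / 4) (cG / 2) (by positivity) (by positivity)).and
    (ev_exp (κ ^ 2 / 8) (1 / 4) (by positivity) (by positivity))))
  obtain ⟨ℓ₁, hℓ₁⟩ := Filter.eventually_atTop.1 ev
  refine ⟨2 / κ, by positivity, max ℓ₁ 0, le_max_right _ _, ?_⟩
  intro Ω _ P ρ f hf h1 hm ℓ hℓ N hN
  have hℓ0 : 0 < ℓ := lt_of_le_of_lt (le_max_right _ _) hℓ
  obtain ⟨c1, c2, c3, c4⟩ := hℓ₁ ℓ (le_of_lt (lt_of_le_of_lt (le_max_left _ _) hℓ))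
  have hf' := hf
  obtain ⟨-, -, hP, hjm, hcont, -⟩ := hf'
  have hmeas : ∀ t, Measurable (f t) := fun t => hjm.comp measurable_prodMk_left
  have : IsProbabilityMeasure ρ := ⟨h1⟩
  unfold persR stdGauss
  obtain ⟨r, hr⟩ : ∃ r : ℝ, r = ρ.real (Icc (-(1/N)) (1/N)) := ⟨_, rfl⟩
  have hsr := sig2_le ρ N hN
  rw [← hr] at hsr
  have hr0 : 0 ≤ r := by rw [hr]; exact measureReal_nonneg
  have hr1 : r ≤ 1 := by rw [hr]; exact measureReal_le_one
  rcases hr0.eq_or_lt with h0 | h0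
  · rw [← h0] at hsr
    rw [Real.sqrt_eq_zero_of_nonpos hsr, tail_zero ℓ hℓ0]
    simp
  obtain ⟨σ, hσ⟩ : ∃ σ : ℝ, σ = √(sig2 ρ N) := ⟨_, rfl⟩
  have hσ0 : 0 ≤ σ := by rw [hσ]; exact Real.sqrt_nonneg _
  have hσr : σ ≤ √r := by rw [hσ]; exact Real.sqrt_le_sqrt hsr
  have hσ1 : σ ≤ 1 := hσr.trans (Real.sqrt_le_one.2 hr1)
  rw [← hσ]
  change (gaussianReal 0 1).real {x : ℝ | σ * x > ℓ} * (gaussianReal 0 1).real {x : ℝ | 2 / κ * |x| < ℓ} ^ N ≤ _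
  obtain ⟨A, hA⟩ : ∃ A : ℝ, A = (gaussianReal 0 1).real {x : ℝ | σ * x > ℓ} := ⟨_, rfl⟩
  obtain ⟨p, hp⟩ : ∃ p : ℝ, p = (gaussianReal 0 1).real {x : ℝ | 2 / κ * |x| < ℓ} := ⟨_, rfl⟩
  have hA0 : 0 ≤ A := by rw [hA]; exact measureReal_nonneg
  have hp1 : p ≤ 1 := by rw [hp]; exact measureReal_le_one
  have hp2 : 1 / 2 ≤ p := by
    have e1 := abs_tail (κ * ℓ / 2) (by positivity)
    have e2 : -(κ * ℓ / 2) ^ 2 / 2 = -(κ ^ 2 / 8 * ℓ ^ 2) := by ring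
    rw [e2] at e1
    have e3 : (gaussianReal 0 1).real {x : ℝ | |x| < κ * ℓ / 2} ≤ p := by
      rw [hp]
      refine measureReal_mono ?_ (measure_ne_top _ _)
      intro x hx
      have hx : |x| < κ * ℓ / 2 := hx
      show 2 / κ * |x| < ℓ
      calc 2 / κ * |x| < 2 / κ * (κ * ℓ / 2) := by gcongr
        _ = ℓ := by field_simp
    linarith
  have hdt := double_tail σ ℓ hσ0 hσ1 hℓ0 c3
  rw [← hA] at hdt
  rw [← hA, ← hp]
  obtain ⟨M, hM⟩ : ∃ M : ℕ, M = ⌊N⌋₊ + 1 := ⟨_, rfl⟩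
  have hM1 : N < M := by rw [hM]; push_cast; exact Nat.lt_floor_add_one N
  have hM2 : (M : ℝ) ≤ N + 1 := by rw [hM]; push_cast; linarith [Nat.floor_le hN.le]
  let b : ℕ → ℝ := fun j => 3 / 8 * ℓ * (1 - η) * η ^ j
  have hκS : κ * S = 3 / 8 * (1 - η) := by rw [hκ]; field_simp
  let Ak : ℕ → Set Ω := fun k =>
    {ω | ∀ j ≤ k, ∀ q < M * 2 ^ j, (q : ℝ) / 2 ^ j ≤ N → ℓ / 16 ≤ f (q / 2 ^ j) ω}
  have hAk : ∀ k, ENNReal.ofReal (A * p ^ N) ≤ P (Ak k) := by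
    intro k
    have d := dyadic P ρ f hf hmeas δ m hδ hm N hN (by rw [← hr]; exact h0) η S ℓ hη hη1 hS hℓ0 b
      (fun j => rfl) M k
    rw [← hr] at d
    refine le_trans ?_ d
    have q := qk_bound η κ ℓ S b hη0 hη1 hκ0 hℓ0 hS0 (fun j => by
      simp only [b]; rw [hκS]; ring) c1 c2 k
    rw [← hp] at q
    apply ENNReal.ofReal_le_of_le_toReal
    rw [ENNReal.toReal_mul, ENNReal.toReal_pow, ENNReal.toReal_prod]
    simp_rw [ENNReal.toReal_pow]
    have t1 : 2 * A ≤ (gaussianReal 0 1 {x | ℓ / 2 < √r * x}).toReal :=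
      hdt.trans (ENNReal.toReal_mono (measure_ne_top _ _) (tail_mono σ (√r) (ℓ / 2) hσ0 hσr (by positivity)))
    have t2 : p ^ M ≤ (∏ j ∈ Finset.range (k + 1),
        (gaussianReal 0 1 {x | S * η ^ (2 * j) * |x| ≤ b j}).toReal ^ 2 ^ j) ^ M :=
      pow_le_pow_left₀ (by linarith) q M
    have t3 : p ^ N * (1 / 2) ≤ p ^ M := by
      have hp0 : 0 < p := by linarith
      calc p ^ N * (1 / 2) ≤ p ^ N * p := by gcongr
        _ = p ^ (N + 1) := by rw [Real.rpow_add hp0, Real.rpow_one]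
        _ ≤ p ^ (M : ℝ) := Real.rpow_le_rpow_of_exponent_ge hp0 hp1 hM2
        _ = p ^ M := Real.rpow_natCast _ _
    calc A * p ^ N = 2 * A * (p ^ N * (1 / 2)) := by ring
      _ ≤ 2 * A * p ^ M := by gcongr
      _ ≤ _ := by gcongr
  have hmA : ∀ k, MeasurableSet (Ak k) := by
    intro k
    have : Ak k = ⋂ j : ℕ, ⋂ (_ : j ≤ k), ⋂ q : ℕ, ⋂ (_ : q < M * 2 ^ j), ⋂ (_ : (q : ℝ) / 2 ^ j ≤ N),
        {ω | ℓ / 16 ≤ f (q / 2 ^ j) ω} := by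
      ext ω; simp [Ak]
    rw [this]
    exact MeasurableSet.iInter fun j => MeasurableSet.iInter fun _ => MeasurableSet.iInter fun q =>
      MeasurableSet.iInter fun _ => MeasurableSet.iInter fun _ => measurableSet_le measurable_const (hmeas _)
  have hanti : Antitone Ak := by
    intro k k' hkk ω hω j hj
    exact hω j (hj.trans hkk)
  have hinf : ENNReal.ofReal (A * p ^ N) ≤ P (⋂ k, Ak k) := by
    rw [hanti.measure_iInter (fun k => (hmA k).nullMeasurableSet) ⟨0, measure_ne_top _ _⟩]
    exact le_iInf hAk
  have hfin : P (⋂ k, Ak k) ≤ P {ω | ∀ t ∈ Set.Ioc (0:ℝ) N, 0 < f t ω} := by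
    apply measure_mono_ae
    filter_upwards [hcont] with ω hω hmem t ht
    have hmem : ω ∈ ⋂ k, Ak k := hmem
    rw [mem_iInter] at hmem
    have := path_pos (fun t => f t ω) hω N (ℓ / 16) M hM1 (fun k => hmem k) t ht
    have h16 : 0 < ℓ / 16 := by positivity
    exact h16.trans_le this
  exact (ENNReal.ofReal_le_iff_le_toReal (measure_ne_top _ _)).1 (hinf.trans hfin)

end CaseR

/-- **General lower bound for persistence (Theorem 2.1).**
Over `ℤ`: with `β = 2√2` and `ℓ₀ = 0`, for any normalized GSP with a finite positive
moment, all `ℓ > 0` and `N > 0`: `P_f(N) ≥ ℙ(σ_N Z > ℓ)·ℙ(β|Z| < ℓ)^N`.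
Over `ℝ`: there are `β > 0`, `ℓ₀ ≥ 0` depending only on `δ` and `m_δ` such that the same
inequality holds for all `ℓ > ℓ₀` and `N > 0`. -/
theorem statement1 :
    (∀ (Ω : Type) (_ : MeasurableSpace Ω) (P : Measure Ω) (ρ : Measure ℝ)
        (f : ℤ → Ω → ℝ), IsGSPZ ρ P f → ρ Set.univ = 1 →
        (∃ δ : ℝ, 0 < δ ∧ specMom ρ δ < ⊤) →
        ∀ ℓ : ℝ, 0 < ℓ → ∀ N : ℝ, 0 < N →
          (stdGauss {x : ℝ | Real.sqrt (sig2 ρ N) * x > ℓ}).toReal *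
              (stdGauss {x : ℝ | 2 * Real.sqrt 2 * |x| < ℓ}).toReal ^ N
            ≤ persZ P f N) ∧
    (∀ δ m : ℝ, 0 < δ →
      ∃ β : ℝ, 0 < β ∧ ∃ ℓ₀ : ℝ, 0 ≤ ℓ₀ ∧
        ∀ (Ω : Type) (_ : MeasurableSpace Ω) (P : Measure Ω) (ρ : Measure ℝ)
          (f : ℝ → Ω → ℝ), IsGSPR ρ P f → ρ Set.univ = 1 →
          specMom ρ δ = ENNReal.ofReal m →
          ∀ ℓ : ℝ, ℓ₀ < ℓ → ∀ N : ℝ, 0 < N →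
            (stdGauss {x : ℝ | Real.sqrt (sig2 ρ N) * x > ℓ}).toReal *
                (stdGauss {x : ℝ | β * |x| < ℓ}).toReal ^ N
              ≤ persR P f N) := by
  refine ⟨?_, fun δ m hδ => caseR δ m hδ⟩
  intro Ω _ P ρ f hf h1 _ ℓ hℓ N hN
  exact caseZ P ρ f hf h1 ℓ hℓ N hN

end
end

section
/- Let f be a Gaussian stationary process on T ∈ {ℤ, ℝ} with spectral measure ρ satisfying m₀ = 1 and m_δ < ∞ for some δ > 0, and suppose σ_N² ≥ b N^{−γ} holds for all N in an unbounded set S ⊆ (0,∞), where b, γ > 0 are constants. Then there exist C, N₀ > 0, depending only on b, γ, δ, m_δ, such that for all N ∈ S with N > N₀: if γ < 1 then log P_f(N) ≥ −C N^{γ} log N; if γ = 1 then log P_f(N) ≥ −C N; and if γ > 1 and T = ℤ then log P_f(N) ≥ −C(γ−1) N log N. -/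
open MeasureTheory ProbabilityTheory Real Set
open scoped ENNReal NNReal

noncomputable section

lemma aux_cramer_wold {ι Ω Ω' : Type*} [Fintype ι] [MeasurableSpace Ω] [MeasurableSpace Ω']
    (P : Measure Ω) (P' : Measure Ω') [IsFiniteMeasure P] [IsFiniteMeasure P']
    (X : ι → Ω → ℝ) (X' : ι → Ω' → ℝ) (hX : ∀ i, Measurable (X i)) (hX' : ∀ i, Measurable (X' i))
    (h : ∀ a : ι → ℝ, P.map (fun ω => ∑ i, a i * X i ω) = P'.map (fun ω => ∑ i, a i * X' i ω)) :
    P.map (fun ω i => X i ω) = P'.map (fun ω i => X' i ω) := by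
  have m1 : Measurable (fun ω i => X i ω) := measurable_pi_lambda _ hX
  have m2 : Measurable (fun ω i => X' i ω) := measurable_pi_lambda _ hX'
  apply Measure.ext_of_charFunDual
  ext L
  rw [charFunDual_eq_charFun_map_one, charFunDual_eq_charFun_map_one,
    Measure.map_map (by fun_prop) m1, Measure.map_map (by fun_prop) m2]
  classical
  have hL : ∀ x : ι → ℝ, L x = ∑ i, L (Pi.single i 1) * x i := by
    intro x
    conv_lhs => rw [pi_eq_sum_univ' x]
    simp [map_sum, mul_comm]
  have e1 : (L ∘ fun ω i => X i ω) = fun ω => ∑ i, L (Pi.single i 1) * X i ω := by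
    ext ω; simp only [Function.comp]; rw [hL]
  have e2 : (L ∘ fun ω i => X' i ω) = fun ω => ∑ i, L (Pi.single i 1) * X' i ω := by
    ext ω; simp only [Function.comp]; rw [hL]
  rw [e1, e2, h]

lemma aux_ext_mgf (μ ν : Measure ℝ) [IsProbabilityMeasure μ] [IsProbabilityMeasure ν]
    (h : mgf id μ = mgf id ν) (hi : ∀ t, Integrable (fun x => rexp (t * id x)) μ) : μ = ν := by
  have h2 := eqOn_complexMGF_of_mgf h
  have hu : integrableExpSet id μ = Set.univ := by
    ext t; simpa [integrableExpSet] using hi t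
  rw [hu] at h2
  apply Measure.ext_of_complexMGF_id_eq
  ext z
  exact h2 (by simp)

lemma aux_gauss_int {Ω : Type*} [MeasurableSpace Ω] (P : Measure Ω) (Y : Ω → ℝ) (hY : Measurable Y)
    (v : ℝ≥0) (h : P.map Y = gaussianReal 0 v) (t : ℝ) :
    Integrable (fun ω => rexp (t * Y ω)) P ∧ ∫ ω, rexp (t * Y ω) ∂P = rexp (v * t ^ 2 / 2) := by
  constructor
  · have := integrable_exp_mul_gaussianReal (μ := 0) (v := v) t
    rw [← h] at this
    exact this.comp_measurable hY
  · have := mgf_gaussianReal h t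
    simpa [mgf] using this

/-- Cameron-Martin type bound. -/
lemma aux_cm {ι Ω : Type*} [Fintype ι] [MeasurableSpace Ω] (P : Measure Ω) [IsProbabilityMeasure P]
    (X : ι → Ω → ℝ) (hX : ∀ i, Measurable (X i)) (K : ι → ι → ℝ) (hK : ∀ i j, K i j = K j i)
    (hpos : ∀ a : ι → ℝ, 0 ≤ ∑ i, ∑ j, a i * a j * K i j)
    (hG : ∀ a : ι → ℝ, P.map (fun ω => ∑ i, a i * X i ω)
      = gaussianReal 0 (∑ i, ∑ j, a i * a j * K i j).toNNReal)
    (a : ι → ℝ) (y : ℝ) :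
    rexp (-(∑ i, ∑ j, a i * a j * K i j) / 2) * P.real {ω | ∀ i, |X i ω| ≤ y} ≤
      P.real {ω | ∀ i, |X i ω + ∑ j, K i j * a j| ≤ y} := by
  set v := ∑ i, ∑ j, a i * a j * K i j with hv
  set ξ : Ω → ℝ := fun ω => ∑ i, a i * X i ω with hξ
  have mcomb : ∀ c : ι → ℝ, Measurable (fun ω => ∑ i, c i * X i ω) := fun c => by fun_prop
  have hint : ∀ c : ι → ℝ, Integrable (fun ω => rexp (∑ i, c i * X i ω)) P ∧
      ∫ ω, rexp (∑ i, c i * X i ω) ∂P = rexp ((∑ i, ∑ j, c i * c j * K i j) / 2) := by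
    intro c
    have := aux_gauss_int P _ (mcomb c) _ (hG c) 1
    simp only [one_mul] at this
    rw [Real.coe_toNNReal _ (hpos c)] at this
    simpa using this
  have hξi : Integrable (fun ω => rexp (ξ ω)) P := (hint a).1
  have hξe : ∫ ω, rexp (ξ ω) ∂P = rexp (v / 2) := (hint a).2
  have : IsProbabilityMeasure (P.tilted ξ) := isProbabilityMeasure_tilted hξi
  set h : ι → ℝ := fun i => ∑ j, K i j * a j with hh
  have mh : ∀ i, Measurable (fun ω => X i ω + h i) := fun i => (hX i).add_const _
  have key : (P.tilted ξ).map (fun ω i => X i ω) = P.map (fun ω i => X i ω + h i) := by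
    apply aux_cramer_wold (P.tilted ξ) P X (fun i ω => X i ω + h i) hX mh
    intro c
    have mc2 : Measurable (fun ω => ∑ i, c i * (X i ω + h i)) := by fun_prop
    have : IsProbabilityMeasure ((P.tilted ξ).map (fun ω => ∑ i, c i * X i ω)) :=
      Measure.isProbabilityMeasure_map (mcomb c).aemeasurable
    have : IsProbabilityMeasure (P.map (fun ω => ∑ i, c i * (X i ω + h i))) :=
      Measure.isProbabilityMeasure_map mc2.aemeasurable
    have split : ∀ ω, ∑ i, c i * (X i ω + h i) = ∑ i, c i * X i ω + ∑ i, c i * h i := by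
      intro ω; simp [mul_add, Finset.sum_add_distrib]
    symm
    apply aux_ext_mgf
    · rw [mgf_id_map mc2.aemeasurable, mgf_id_map (mcomb c).aemeasurable]
      ext t
      simp only [mgf]
      have e1 : ∀ ω, rexp (t * ∑ i, c i * (X i ω + h i)) =
          rexp (t * ∑ i, c i * h i) * rexp (∑ i, (t * c i) * X i ω) := by
        intro ω
        rw [split, ← Real.exp_add, mul_add, Finset.mul_sum, add_comm]
        simp [mul_assoc]
      have e2 : ∀ ω, ξ ω + t * ∑ i, c i * X i ω = ∑ i, (a i + t * c i) * X i ω := by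
        intro ω
        simp only [hξ, Finset.mul_sum, ← Finset.sum_add_distrib]
        exact Finset.sum_congr rfl fun i _ => by ring
      rw [integral_congr_ae (Filter.Eventually.of_forall e1), integral_const_mul, (hint _).2,
        integral_exp_tilted]
      simp only [Pi.add_apply]
      rw [integral_congr_ae (Filter.Eventually.of_forall (fun ω => congrArg rexp (e2 ω))),
        (hint _).2, hξe, ← Real.exp_add, ← Real.exp_sub]
      congr 1
      have q : ∑ i, ∑ j, (a i + t * c i) * (a j + t * c j) * K i j =
          v + 2 * t * ∑ i, c i * h i + ∑ i, ∑ j, (t * c i) * (t * c j) * K i j := by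
        have s1 : ∑ i, ∑ j, a i * (t * c j) * K i j = t * ∑ i, c i * h i := by
          rw [Finset.sum_comm]
          simp only [hh, Finset.mul_sum]
          refine Finset.sum_congr rfl fun i _ => Finset.sum_congr rfl fun j _ => ?_
          rw [hK j i]; ring
        have s2 : ∑ i, ∑ j, (t * c i) * a j * K i j = t * ∑ i, c i * h i := by
          simp only [hh, Finset.mul_sum]
          refine Finset.sum_congr rfl fun i _ => Finset.sum_congr rfl fun j _ => ?_
          ring
        calc _ = v + ∑ i, ∑ j, a i * (t * c j) * K i j + ∑ i, ∑ j, (t * c i) * a j * K i j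
              + ∑ i, ∑ j, (t * c i) * (t * c j) * K i j := by
              rw [hv]
              simp only [← Finset.sum_add_distrib]
              refine Finset.sum_congr rfl fun i _ => Finset.sum_congr rfl fun j _ => ?_
              ring
          _ = _ := by rw [s1, s2]; ring
      rw [q]; ring
    · intro t
      have : Integrable (fun ω => rexp (t * ∑ i, c i * (X i ω + h i))) P := by
        have := ((hint (fun i => t * c i)).1).const_mul (rexp (t * ∑ i, c i * h i))
        refine this.congr (Filter.Eventually.of_forall fun ω => ?_)
        simp only
        rw [split, ← Real.exp_add, mul_add, add_comm]
        congr 2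
        rw [Finset.mul_sum]
        simp [mul_assoc]
      exact (integrable_map_measure (by fun_prop) mc2.aemeasurable).2 this
  have sym : P.map (fun ω i => X i ω) = P.map (fun ω i => - X i ω) := by
    apply aux_cramer_wold P P X (fun i ω => - X i ω) hX (fun i => (hX i).neg)
    intro c
    have := hG (fun i => - c i)
    simp only [neg_mul_neg] at this
    rw [hG c, ← this]
    congr 1
    ext ω; simp
  -- symmetric function integral
  set A : Set (ι → ℝ) := {z | ∀ i, |z i| ≤ y} with hA
  have mA : MeasurableSet A := by
    have : A = ⋂ i, {z | |z i| ≤ y} := by ext; simp [hA]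
    rw [this]
    exact MeasurableSet.iInter fun i => measurableSet_le (by fun_prop) measurable_const
  have mX : Measurable (fun ω i => X i ω) := measurable_pi_lambda _ hX
  have mX' : Measurable (fun ω i => - X i ω) := measurable_pi_lambda _ fun i => (hX i).neg
  have mXh : Measurable (fun ω i => X i ω + h i) := measurable_pi_lambda _ mh
  set B : Set Ω := {ω | ∀ i, |X i ω| ≤ y} with hB
  have mB : MeasurableSet B := mX mA
  have eL : P.real {ω | ∀ i, |X i ω + h i| ≤ y} = (P.tilted ξ).real B := by
    have h1 : P.map (fun ω i => X i ω + h i) A = P {ω | ∀ i, |X i ω + h i| ≤ y} :=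
      Measure.map_apply mXh mA
    have h2 : (P.tilted ξ).map (fun ω i => X i ω) A = (P.tilted ξ) B :=
      Measure.map_apply mX mA
    rw [measureReal_def, measureReal_def, ← h1, ← h2, key]
  have eI : (P.tilted ξ).real B = rexp (-v/2) * ∫ ω in B, rexp (ξ ω) ∂P := by
    rw [measureReal_def, tilted_apply_eq_ofReal_integral' _ mB, ENNReal.toReal_ofReal
      (integral_nonneg fun ω => by positivity), hξe, integral_div, neg_div, Real.exp_neg]
    ring
  have symI : ∫ ω in B, rexp (ξ ω) ∂P = ∫ ω in B, rexp (- ξ ω) ∂P := by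
    have g : Measurable (fun z : ι → ℝ => A.indicator (fun z => rexp (∑ i, a i * z i)) z) :=
      Measurable.indicator (by fun_prop) mA
    have i1 := integral_map (μ := P) mX.aemeasurable g.aestronglyMeasurable
    have i2 := integral_map (μ := P) mX'.aemeasurable g.aestronglyMeasurable
    rw [sym, i2] at i1
    rw [← integral_indicator mB, ← integral_indicator mB]
    have r1 : ∀ ω, B.indicator (fun ω => rexp (ξ ω)) ω =
      A.indicator (fun z => rexp (∑ i, a i * z i)) (fun i => X i ω) := by
      intro ω
      simp only [indicator, hA, hB, mem_ofPred_eq, hξ]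
    have r2 : ∀ ω, B.indicator (fun ω => rexp (- ξ ω)) ω =
      A.indicator (fun z => rexp (∑ i, a i * z i)) (fun i => - X i ω) := by
      intro ω
      simp only [indicator, hA, hB, mem_ofPred_eq, hξ, abs_neg, mul_neg, Finset.sum_neg_distrib]
    simp only [r1, r2]
    exact i1.symm
  have hneg : Integrable (fun ω => rexp (- ξ ω)) P := by
    have := (hint (fun i => - a i)).1
    simpa [hξ] using this
  have fin : P.real B ≤ ∫ ω in B, rexp (ξ ω) ∂P := by
    have : ∫ ω in B, (2:ℝ) ∂P ≤ ∫ ω in B, (rexp (ξ ω) + rexp (-ξ ω)) ∂P := by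
      apply integral_mono (integrable_const _) (hξi.restrict.add hneg.restrict)
      intro ω
      have h1 := Real.add_one_le_exp (ξ ω)
      have h2 := Real.add_one_le_exp (- ξ ω)
      change 2 ≤ rexp (ξ ω) + rexp (-ξ ω)
      linarith
    rw [integral_add hξi.restrict hneg.restrict, ← symI] at this
    simp at this
    linarith
  rw [eL, eI]
  exact mul_le_mul_of_nonneg_left fin (Real.exp_pos _).le

lemma aux_range {ι : Type*} [Fintype ι] (K : ι → ι → ℝ) (hK : ∀ i j, K i j = K j i)
    (hpos : ∀ a : ι → ℝ, 0 ≤ ∑ i, ∑ j, a i * a j * K i j) (h : ι → ℝ) (D : ℝ) (hD : 0 ≤ D)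
    (hh : ∀ c : ι → ℝ, (∑ i, c i * h i) ^ 2 ≤ D * ∑ i, ∑ j, c i * c j * K i j) :
    ∃ a : ι → ℝ, (∀ i, ∑ j, K i j * a j = h i) ∧ ∑ i, ∑ j, a i * a j * K i j ≤ D := by
  classical
  set T := Matrix.toEuclideanLin (Matrix.of K) with hT
  have Tapp : ∀ (x : EuclideanSpace ℝ ι) i, T x i = ∑ j, K i j * x j := by
    intro x i
    simp [hT, Matrix.toLpLin_apply, Matrix.mulVec, dotProduct]
  have hq : ∀ c : EuclideanSpace ℝ ι, ∑ i, ∑ j, c i * c j * K i j = ∑ i, c i * T c i := by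
    intro c
    refine Finset.sum_congr rfl fun i _ => ?_
    rw [Tapp, Finset.mul_sum]
    exact Finset.sum_congr rfl fun j _ => by ring
  have hsym : T.IsSymmetric := by
    intro x y
    simp only [PiLp.inner_apply, Tapp, RCLike.inner_apply, conj_trivial, Finset.mul_sum,
      Finset.sum_mul]
    rw [Finset.sum_comm]
    refine Finset.sum_congr rfl fun i _ => Finset.sum_congr rfl fun j _ => ?_
    rw [hK j i]; ring
  have hmem : (WithLp.toLp 2 h : EuclideanSpace ℝ ι) ∈ LinearMap.range T := by
    rw [← Submodule.orthogonal_orthogonal (LinearMap.range T), hsym.orthogonal_range,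
      Submodule.mem_orthogonal]
    intro u hu
    have hu' : T u = 0 := hu
    have := hh u
    rw [hq u, hu'] at this
    simp only [PiLp.zero_apply, mul_zero, Finset.sum_const_zero] at this
    have h0 : ∑ i, u i * h i = 0 := by
      have := le_antisymm this (sq_nonneg _)
      exact pow_eq_zero_iff (two_ne_zero) |>.1 this
    simp only [PiLp.inner_apply, RCLike.inner_apply, conj_trivial]
    rw [← h0]
    exact Finset.sum_congr rfl fun i _ => by ring
  obtain ⟨a, ha⟩ := hmem
  have ha' : ∀ i, ∑ j, K i j * a j = h i := by
    intro i; rw [← Tapp, ha]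
  refine ⟨a, ha', ?_⟩
  have e : ∑ i, ∑ j, a i * a j * K i j = ∑ i, a i * h i := by
    rw [hq]
    refine Finset.sum_congr rfl fun i _ => ?_
    rw [Tapp, ha']
  have h1 := hh a
  rw [← e] at h1
  have h2 := hpos a
  by_contra hc
  push Not at hc
  nlinarith

lemma aux_shift {ι Ω : Type*} [Fintype ι] [MeasurableSpace Ω] (P : Measure Ω)
    [IsProbabilityMeasure P] (ρ : Measure ℝ) [IsFiniteMeasure ρ]
    (X : ι → Ω → ℝ) (hX : ∀ i, Measurable (X i)) (t : ι → ℝ) (N : ℝ) (hN : 0 < N)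
    (ht : ∀ i, |t i| ≤ 1.1 * N)
    (hG : ∀ a : ι → ℝ, P.map (fun ω => ∑ i, a i * X i ω)
      = gaussianReal 0 (∑ i, ∑ j, a i * a j * ∫ l, Real.cos (l * (t i - t j)) ∂ρ).toNNReal)
    (hs : 0 < ρ.real (Set.Icc 0 (1/N))) (y : ℝ) (hy : 0 ≤ y) :
    rexp (-(32 * y ^ 2 / ρ.real (Set.Icc 0 (1/N)))) * P.real {ω | ∀ i, |X i ω| ≤ y} ≤
      P.real {ω | ∀ i, y ≤ X i ω} := by
  set I := Set.Icc (0:ℝ) (1/N) with hI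
  have mI : MeasurableSet I := measurableSet_Icc
  set s := ρ.real I with hsdef
  set K : ι → ι → ℝ := fun i j => ∫ l, Real.cos (l * (t i - t j)) ∂ρ with hKdef
  have bint : ∀ (g : ℝ → ℝ), Continuous g → (∃ C, ∀ x, |g x| ≤ C) → Integrable g ρ := by
    rintro g hg ⟨C, hC⟩
    exact Integrable.of_bound hg.aestronglyMeasurable C (Filter.Eventually.of_forall hC)
  have hK : ∀ i j, K i j = K j i := by
    intro i j
    simp only [hKdef]
    congr 1; ext l
    rw [← Real.cos_neg]; congr 1; ring
  set G : (ι → ℝ) → ℝ → ℝ := fun c l => ∑ i, c i * Real.cos (l * t i) with hGd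
  set H : (ι → ℝ) → ℝ → ℝ := fun c l => ∑ i, c i * Real.sin (l * t i) with hHd
  have Gb : ∀ c l, |G c l| ≤ ∑ i, |c i| := by
    intro c l
    refine (Finset.abs_sum_le_sum_abs _ _).trans (Finset.sum_le_sum fun i _ => ?_)
    rw [abs_mul]
    exact mul_le_of_le_one_right (abs_nonneg _) (Real.abs_cos_le_one _)
  have Hb : ∀ c l, |H c l| ≤ ∑ i, |c i| := by
    intro c l
    refine (Finset.abs_sum_le_sum_abs _ _).trans (Finset.sum_le_sum fun i _ => ?_)
    rw [abs_mul]
    exact mul_le_of_le_one_right (abs_nonneg _) (Real.abs_sin_le_one _)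
  have Gc : ∀ c, Continuous (G c) := fun c => by simp only [hGd]; fun_prop
  have Hc : ∀ c, Continuous (H c) := fun c => by simp only [hHd]; fun_prop
  have Gi : ∀ c, Integrable (G c) ρ := fun c => bint _ (Gc c) ⟨_, Gb c⟩
  have G2i : ∀ c, Integrable (fun l => G c l ^ 2) ρ := fun c => bint _ ((Gc c).pow 2)
    ⟨(∑ i, |c i|) ^ 2, fun l => by
      rw [abs_pow]; exact pow_le_pow_left₀ (abs_nonneg _) (Gb c l) 2⟩
  have H2i : ∀ c, Integrable (fun l => H c l ^ 2) ρ := fun c => bint _ ((Hc c).pow 2)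
    ⟨(∑ i, |c i|) ^ 2, fun l => by
      rw [abs_pow]; exact pow_le_pow_left₀ (abs_nonneg _) (Hb c l) 2⟩
  have hQ : ∀ c : ι → ℝ, ∑ i, ∑ j, c i * c j * K i j = ∫ l, (G c l ^ 2 + H c l ^ 2) ∂ρ := by
    intro c
    have e : ∀ l, G c l ^ 2 + H c l ^ 2 = ∑ i, ∑ j, c i * c j * Real.cos (l * (t i - t j)) := by
      intro l
      simp only [hGd, hHd, sq, Finset.sum_mul_sum, ← Finset.sum_add_distrib]
      refine Finset.sum_congr rfl fun i _ => Finset.sum_congr rfl fun j _ => ?_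
      rw [mul_sub, Real.cos_sub]; ring
    have ci : ∀ i j, Integrable (fun l => c i * c j * Real.cos (l * (t i - t j))) ρ := by
      intro i j
      apply Integrable.const_mul
      exact bint _ (by fun_prop) ⟨1, fun l => Real.abs_cos_le_one _⟩
    simp only [e]
    rw [integral_finsetSum _ (fun i _ => integrable_finsetSum _ fun j _ => ci i j)]
    refine Finset.sum_congr rfl fun i _ => ?_
    rw [integral_finsetSum _ (fun j _ => ci i j)]
    refine Finset.sum_congr rfl fun j _ => ?_
    rw [integral_const_mul]
  have hpos : ∀ a : ι → ℝ, 0 ≤ ∑ i, ∑ j, a i * a j * K i j := by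
    intro a; rw [hQ]; exact integral_nonneg fun l => by positivity
  set h : ι → ℝ := fun i => (∫ l in I, Real.cos (l * t i) ∂ρ) / s with hhd
  have hc1 : ∀ i, 1 / 4 ≤ h i := by
    intro i
    rw [hhd]
    simp only
    rw [le_div_iff₀ hs]
    have : ∫ l in I, (1/4 : ℝ) ∂ρ ≤ ∫ l in I, Real.cos (l * t i) ∂ρ := by
      apply setIntegral_mono_on (integrable_const _) _ mI
      · intro l hl
        have h1 : |l * t i| ≤ 1.1 := by
          rw [abs_mul, abs_of_nonneg hl.1]
          calc l * |t i| ≤ (1/N) * (1.1 * N) :=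
              mul_le_mul hl.2 (ht i) (abs_nonneg _) (by positivity)
            _ = 1.1 := by field_simp
        have h2 := Real.one_sub_sq_div_two_le_cos (x := l * t i)
        have h3 : (l * t i) ^ 2 ≤ 1.1 ^ 2 := by
          rw [← sq_abs]; exact pow_le_pow_left₀ (abs_nonneg _) h1 2
        norm_num at h3 ⊢
        linarith
      · exact (bint _ (by fun_prop) ⟨1, fun l => Real.abs_cos_le_one _⟩).restrict
    rw [setIntegral_const, smul_eq_mul] at this
    linarith
  have hh : ∀ c : ι → ℝ, (∑ i, c i * h i) ^ 2 ≤ (1/s) * ∑ i, ∑ j, c i * c j * K i j := by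
    intro c
    have e : ∑ i, c i * h i = (∫ l in I, G c l ∂ρ) / s := by
      simp only [hhd, hGd]
      rw [integral_finsetSum _ (fun i _ => ((bint (fun l => Real.cos (l * t i)) (by fun_prop)
        ⟨1, fun l => Real.abs_cos_le_one _⟩).const_mul _).restrict), Finset.sum_div]
      refine Finset.sum_congr rfl fun i _ => ?_
      rw [integral_const_mul]; ring
    set m := ∫ l in I, G c l ∂ρ with hm
    have h1 : 0 ≤ ∫ l in I, (G c l - m / s) ^ 2 ∂ρ := integral_nonneg fun l => by positivity
    have h2 : ∫ l in I, (G c l - m / s) ^ 2 ∂ρ = (∫ l in I, G c l ^ 2 ∂ρ) - m ^ 2 / s := by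
      have : ∀ l, (G c l - m / s) ^ 2 = (G c l ^ 2 - 2 * (m / s) * G c l) + (m/s)^2 := by
        intro l; ring
      simp only [this]
      have i1 : Integrable (fun l => G c l ^ 2 - 2 * (m / s) * G c l) (ρ.restrict I) :=
        (G2i c).restrict.sub ((Gi c).restrict.const_mul _)
      rw [integral_add i1 (integrable_const _),
        integral_sub (G2i c).restrict ((Gi c).restrict.const_mul _), integral_const_mul,
        setIntegral_const, smul_eq_mul, ← hm, ← hsdef]
      field_simp
      ring
    have h3 : ∫ l in I, G c l ^ 2 ∂ρ ≤ ∫ l, (G c l ^ 2 + H c l ^ 2) ∂ρ := by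
      calc ∫ l in I, G c l ^ 2 ∂ρ ≤ ∫ l, G c l ^ 2 ∂ρ :=
            setIntegral_le_integral (G2i c) (Filter.Eventually.of_forall fun l => sq_nonneg _)
        _ ≤ _ := integral_mono (G2i c) ((G2i c).add (H2i c)) fun l => by
            change G c l ^ 2 ≤ G c l ^ 2 + H c l ^ 2
            nlinarith [sq_nonneg (H c l)]
    rw [e, hQ, div_pow, sq s, ← div_div, div_eq_mul_one_div, mul_comm]
    apply mul_le_mul_of_nonneg_left _ (by positivity)
    linarith
  obtain ⟨a, ha, haQ⟩ := aux_range K hK hpos h (1/s) (by positivity) hh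
  have := aux_cm P X hX K hK hpos hG (fun i => -(8 * y) * a i) y
  have eQ : ∑ i, ∑ j, (-(8 * y) * a i) * (-(8 * y) * a j) * K i j
      = 64 * y ^ 2 * ∑ i, ∑ j, a i * a j * K i j := by
    simp only [Finset.mul_sum]
    refine Finset.sum_congr rfl fun i _ => Finset.sum_congr rfl fun j _ => ?_
    ring
  have eh : ∀ i, ∑ j, K i j * (-(8 * y) * a j) = - (8 * y * h i) := by
    intro i
    rw [← ha i, Finset.mul_sum, ← Finset.sum_neg_distrib]
    exact Finset.sum_congr rfl fun j _ => by ring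
  rw [eQ] at this
  simp only [eh] at this
  refine le_trans ?_ (this.trans ?_)
  · apply mul_le_mul_of_nonneg_right _ measureReal_nonneg
    apply Real.exp_le_exp.2
    have : 64 * y ^ 2 * ∑ i, ∑ j, a i * a j * K i j ≤ 64 * y ^ 2 * (1/s) :=
      mul_le_mul_of_nonneg_left haQ (by positivity)
    have e : 32 * y ^ 2 / s = 64 * y ^ 2 * (1/s) / 2 := by ring
    rw [e]
    linarith
  · apply measureReal_mono _ (measure_ne_top _ _)
    intro ω hω i
    have h1 := (abs_le.1 (hω i)).1
    have h2 : 8 * y * (1/4) ≤ 8 * y * h i := mul_le_mul_of_nonneg_left (hc1 i) (by positivity)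
    linarith

lemma aux_round (y : ℝ) : |(round y : ℝ)| ≤ 2 * |y| := by
  have h := round_le y 0
  simp only [Int.cast_zero, sub_zero] at h
  have : |(round y : ℝ)| ≤ |y| + |y - round y| := by
    have := abs_sub y (y - round y)
    simpa using this
  linarith

lemma aux_phi (a : ℝ) (ha : 0 < a) (F : Finset ℤ) :
    ∑ k ∈ F, rexp (-(2 * a * |(k:ℝ)|)) ≤ 1 + 2 / (rexp (2 * a) - 1) := by
  have hE : 1 < rexp (2 * a) := Real.one_lt_exp_iff.2 (by positivity)
  set r := rexp (-(2 * a)) with hr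
  have r0 : 0 ≤ r := (Real.exp_pos _).le
  have r1 : r < 1 := Real.exp_lt_one_iff.2 (by linarith)
  have hg := hasSum_geometric_of_lt_one r0 r1
  have e : ∀ n : ℕ, r ^ n = rexp (-(2 * a * n)) := by
    intro n; rw [hr, ← Real.exp_nat_mul]; congr 1; ring
  have h1 : HasSum (fun n : ℕ => rexp (-(2 * a * |((n:ℤ):ℝ)|))) (1 - r)⁻¹ := by
    convert hg using 2 with n
    rw [e]; simp
  have h2 : HasSum (fun n : ℕ => rexp (-(2 * a * |((-((n:ℤ)+1):ℤ):ℝ)|))) (r * (1 - r)⁻¹) := by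
    have h3 := hg.mul_left r
    have h4 : (fun n : ℕ => rexp (-(2 * a * |((-((n:ℤ)+1):ℤ):ℝ)|))) = fun n : ℕ => r * r ^ n := by
     ext n
     rw [← pow_succ', e, Int.cast_neg, abs_neg]
     push_cast
     rw [abs_of_nonneg (by positivity)]
    rw [h4]; exact h3
  have hs := HasSum.of_nat_of_neg_add_one (f := fun k : ℤ => rexp (-(2 * a * |(k:ℝ)|))) h1 h2
  have := sum_le_hasSum F (fun i _ => (Real.exp_pos _).le) hs
  refine this.trans (le_of_eq ?_)
  have hri : r = (rexp (2 * a))⁻¹ := by rw [hr, Real.exp_neg]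
  have : rexp (2*a) ≠ 0 := (Real.exp_pos _).ne'
  have h3 : rexp (2*a) - 1 ≠ 0 := by linarith
  rw [hri]
  have h4 : 1 - (rexp (2*a))⁻¹ = (rexp (2*a) - 1) / rexp (2*a) := by field_simp
  rw [h4]
  field_simp
  ring

lemma aux_sb {ι Ω : Type*} [Fintype ι] [MeasurableSpace Ω] (P : Measure Ω)
    [IsProbabilityMeasure P] (X : ι → Ω → ℝ) (hX : ∀ i, Measurable (X i))
    (hG : ∀ a : ι → ℝ, ∃ v : ℝ≥0, P.map (fun ω => ∑ i, a i * X i ω) = gaussianReal 0 v)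
    (w a κ : ι → ℝ) (hw : ∀ i, 0 < w i) (ha : ∀ i, 0 < a i)
    (hi : ∀ i, Integrable (X i) P)
    (hκ : ∀ i, ∫ ω, |(round (X i ω / w i) : ℝ)| ∂P ≤ κ i) :
    rexp (-∑ i, (2 * a i * κ i + Real.log (1 + 2 / (rexp (2 * a i) - 1))))
      ≤ P.real {ω | ∀ i, |X i ω| ≤ w i} := by
  classical
  set R := P.real {ω | ∀ i, |X i ω| ≤ w i} with hR
  set Φ : ι → ℝ := fun i => 1 + 2 / (rexp (2 * a i) - 1) with hΦ
  have Φ0 : ∀ i, 0 < Φ i := by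
    intro i
    have : 1 < rexp (2 * a i) := Real.one_lt_exp_iff.2 (by linarith [ha i])
    have : 0 < rexp (2 * a i) - 1 := by linarith
    simp only [hΦ]; positivity
  set K : Ω → ι → ℤ := fun ω i => round (X i ω / w i) with hKd
  have mK : Measurable K := by
    refine measurable_pi_lambda _ fun i => ?_
    simp only [hKd, round_eq]
    exact Int.measurable_floor.comp (((hX i).div_const _).add_const _)
  have mKs : ∀ k : ι → ℤ, MeasurableSet (K ⁻¹' {k}) := fun k => mK (measurableSet_singleton k)
  set p : (ι → ℤ) → ℝ := fun k => P.real (K ⁻¹' {k}) with hp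
  set φ : (ι → ℤ) → ℝ := fun k => rexp (-∑ i, a i * |(k i : ℝ)|) with hφ
  -- two copies
  have mY : ∀ i, Measurable (fun q : Ω × Ω => X i q.1 - X i q.2) := fun i =>
    ((hX i).comp measurable_fst).sub ((hX i).comp measurable_snd)
  have law : (P.prod P).map (fun q i => X i q.1 - X i q.2)
      = P.map (fun ω i => √2 * X i ω) := by
    apply aux_cramer_wold (P.prod P) P (fun i q => X i q.1 - X i q.2) (fun i ω => √2 * X i ω)
      mY (fun i => (hX i).const_mul _)
    intro c
    obtain ⟨v, hv⟩ := hG c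
    set Z : Ω → ℝ := fun ω => ∑ i, c i * X i ω with hZ
    have mZ : Measurable Z := by fun_prop
    have ind : IndepFun (fun q : Ω × Ω => Z q.1) (fun q : Ω × Ω => -Z q.2) (P.prod P) :=
      indepFun_prod mZ mZ.neg
    have l1 : (P.prod P).map (fun q : Ω × Ω => Z q.1) = gaussianReal 0 v := by
      have : (fun q : Ω × Ω => Z q.1) = Z ∘ Prod.fst := rfl
      rw [this, ← Measure.map_map mZ measurable_fst, Measure.map_fst_prod]
      simp [hv]
    have l2 : (P.prod P).map (fun q : Ω × Ω => -Z q.2) = gaussianReal 0 v := by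
      have : (fun q : Ω × Ω => -Z q.2) = (fun x => -x) ∘ Z ∘ Prod.snd := rfl
      rw [this, ← Measure.map_map measurable_neg (mZ.comp measurable_snd),
        ← Measure.map_map mZ measurable_snd, Measure.map_snd_prod]
      simp [hv, gaussianReal_map_neg]
    have l3 := gaussianReal_add_gaussianReal_of_indepFun ind l1 l2
    have e1 : (fun q : Ω × Ω => ∑ i, c i * (X i q.1 - X i q.2))
        = (fun q : Ω × Ω => Z q.1) + (fun q : Ω × Ω => -Z q.2) := by
      ext q; simp [hZ, mul_sub]; ring
    have e2 : (fun ω => ∑ i, c i * (√2 * X i ω)) = (fun x => √2 * x) ∘ Z := by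
      ext ω; simp only [hZ, Function.comp, Finset.mul_sum]
      exact Finset.sum_congr rfl fun i _ => by ring
    rw [e1, l3, e2, ← Measure.map_map (by fun_prop) mZ, hv, gaussianReal_map_const_mul]
    congr 1
    · simp
    · ext
      simp
      ring
  set A : Set (ι → ℝ) := {z | ∀ i, |z i| ≤ w i} with hA
  have mA : MeasurableSet A := by
    have : A = ⋂ i, {z | |z i| ≤ w i} := by ext; simp [hA]
    rw [this]
    exact MeasurableSet.iInter fun i => measurableSet_le (by fun_prop) measurable_const
  have hRge : (P.prod P).real {q : Ω × Ω | ∀ i, |X i q.1 - X i q.2| ≤ w i} ≤ R := by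
    have h1 : (P.prod P).map (fun q i => X i q.1 - X i q.2) A
        = (P.prod P) {q : Ω × Ω | ∀ i, |X i q.1 - X i q.2| ≤ w i} :=
      Measure.map_apply (measurable_pi_lambda _ mY) mA
    have h2 : P.map (fun ω i => √2 * X i ω) A = P {ω | ∀ i, |√2 * X i ω| ≤ w i} :=
      Measure.map_apply (measurable_pi_lambda _ fun i => (hX i).const_mul _) mA
    rw [measureReal_def, ← h1, law, h2, ← measureReal_def]
    apply measureReal_mono _ (measure_ne_top _ _)
    intro ω hω i
    have := hω i
    rw [abs_mul, abs_of_nonneg (Real.sqrt_nonneg 2)] at this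
    have h2 : (1:ℝ) ≤ √2 := Real.one_le_sqrt.2 (by norm_num)
    nlinarith [abs_nonneg (X i ω)]
  have hF1 : ∀ F : Finset (ι → ℤ), ∑ k ∈ F, p k ^ 2 ≤ R := by
    intro F
    refine le_trans ?_ hRge
    have e : ∑ k ∈ F, p k ^ 2 = (P.prod P).real (⋃ k ∈ F, (K ⁻¹' {k}) ×ˢ (K ⁻¹' {k})) := by
      rw [measureReal_biUnion_finset]
      · refine Finset.sum_congr rfl fun k _ => ?_
        rw [measureReal_prod_prod, sq]
      · intro k _ k' _ hne
        refine Set.disjoint_left.2 ?_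
        rintro ⟨x, y⟩ h1 h2
        have a1 : K x = k := h1.1
        have a2 : K x = k' := h2.1
        exact hne (a1.symm.trans a2)
      · intro k _; exact (mKs k).prod (mKs k)
    rw [e]
    apply measureReal_mono _ (measure_ne_top _ _)
    intro q hq i
    simp only [mem_iUnion] at hq
    obtain ⟨k, _, h1, h2⟩ := hq
    have a1 : round (X i q.1 / w i) = k i := congrFun (show K q.1 = k from h1) i
    have a2 : round (X i q.2 / w i) = k i := congrFun (show K q.2 = k from h2) i
    have b1 := abs_sub_round (X i q.1 / w i)
    have b2 := abs_sub_round (X i q.2 / w i)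
    rw [a1] at b1
    rw [a2] at b2
    have b3 : |X i q.1 / w i - X i q.2 / w i| ≤ 1 := by
      rw [abs_le] at *
      constructor <;> linarith
    rw [← sub_div, abs_div, abs_of_pos (hw i), div_le_one (hw i)] at b3
    exact b3
  have hF2 : ∀ F : Finset (ι → ℤ), ∑ k ∈ F, φ k ^ 2 ≤ ∏ i, Φ i := by
    intro F
    let G : ι → Finset ℤ := fun i => F.image (fun k => k i)
    have hsub : F ⊆ Fintype.piFinset G := by
      intro k hk
      rw [Fintype.mem_piFinset]
      intro i
      exact Finset.mem_image_of_mem (fun k => k i) hk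
    calc ∑ k ∈ F, φ k ^ 2 ≤ ∑ k ∈ Fintype.piFinset G, φ k ^ 2 :=
          Finset.sum_le_sum_of_subset_of_nonneg hsub fun _ _ _ => sq_nonneg _
      _ = ∑ k ∈ Fintype.piFinset G,
            ∏ i, rexp (-(2 * a i * |(k i : ℝ)|)) := by
          refine Finset.sum_congr rfl fun k _ => ?_
          rw [← Real.exp_sum]
          simp only [hφ]
          rw [← Real.exp_nat_mul]
          congr 1
          push_cast
          rw [Finset.sum_neg_distrib, mul_neg, Finset.mul_sum]
          congr 1
          exact Finset.sum_congr rfl fun i _ => by ring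
      _ = ∏ i, ∑ k ∈ G i, rexp (-(2 * a i * |(k : ℝ)|)) := by
          rw [Finset.prod_univ_sum]
      _ ≤ ∏ i, Φ i := by
          apply Finset.prod_le_prod
          · intro i _; exact Finset.sum_nonneg fun _ _ => (Real.exp_pos _).le
          · intro i _; exact aux_phi (a i) (ha i) _
  have hΦp : 0 < ∏ i, Φ i := Finset.prod_pos fun i _ => Φ0 i
  have hR0 : 0 ≤ R := measureReal_nonneg
  have hF3 : ∀ F : Finset (ι → ℤ), (∑ k ∈ F, p k * φ k) ^ 2 ≤ R * ∏ i, Φ i := by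
    intro F
    refine (Finset.sum_mul_sq_le_sq_mul_sq F p φ).trans ?_
    exact mul_le_mul (hF1 F) (hF2 F) (Finset.sum_nonneg fun _ _ => sq_nonneg _) hR0
  -- the integral
  have φle : ∀ k, φ k ≤ 1 := by
    intro k
    apply Real.exp_le_one_iff.2
    have : 0 ≤ ∑ i, a i * |(k i : ℝ)| :=
      Finset.sum_nonneg fun i _ => mul_nonneg (ha i).le (abs_nonneg _)
    linarith
  have : IsProbabilityMeasure (P.map K) := Measure.isProbabilityMeasure_map mK.aemeasurable
  have φi : Integrable φ (P.map K) := by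
    refine Integrable.of_bound (Measurable.of_discrete).aestronglyMeasurable 1
      (Filter.Eventually.of_forall fun k => ?_)
    rw [Real.norm_eq_abs, abs_of_pos (Real.exp_pos _)]
    exact φle k
  have hpe : ∀ k, (P.map K).real {k} = p k := by
    intro k
    rw [measureReal_def, Measure.map_apply mK (measurableSet_singleton k)]
    rfl
  have hsum : HasSum (fun k => p k * φ k) (∫ ω, φ (K ω) ∂P) := by
    have h1 := integral_countable φi
    simp only [hpe, smul_eq_mul] at h1
    rw [integral_map mK.aemeasurable φi.aestronglyMeasurable] at h1
    rw [h1]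
    apply Summable.hasSum
    refine summable_of_sum_le (c := √(R * ∏ i, Φ i)) ?_ ?_
    · intro k; exact mul_nonneg measureReal_nonneg (Real.exp_pos _).le
    · intro F
      exact Real.le_sqrt_of_sq_le (hF3 F)
  have hS2 : (∫ ω, φ (K ω) ∂P) ^ 2 ≤ R * ∏ i, Φ i := by
    have := (hsum.pow 2)
    exact le_of_tendsto this (Filter.Eventually.of_forall hF3)
  -- Jensen
  have rint : ∀ i, Integrable (fun ω => |(round (X i ω / w i) : ℝ)|) P := by
    intro i
    have m1 : Measurable (fun ω => |(round (X i ω / w i) : ℝ)|) := by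
      have : Measurable (fun ω => round (X i ω / w i)) := (measurable_pi_apply i).comp mK
      exact (measurable_norm.comp (Measurable.comp (g := fun z : ℤ => (z:ℝ)) .of_discrete this))
    refine Integrable.mono' (((hi i).div_const (w i)).abs.const_mul 2) m1.aestronglyMeasurable
      (Filter.Eventually.of_forall fun ω => ?_)
    rw [Real.norm_eq_abs, abs_abs]
    exact aux_round _
  set T : Ω → ℝ := fun ω => ∑ i, a i * |(round (X i ω / w i) : ℝ)| with hT
  have Tint : Integrable T P := integrable_finsetSum _ fun i _ => (rint i).const_mul _
  set τ := ∑ i, a i * κ i with hτ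
  have Tle : ∫ ω, T ω ∂P ≤ τ := by
    rw [hT, integral_finsetSum _ fun i _ => (rint i).const_mul _]
    refine Finset.sum_le_sum fun i _ => ?_
    rw [integral_const_mul]
    exact mul_le_mul_of_nonneg_left (hκ i) (ha i).le
  have hJ : rexp (-τ) ≤ ∫ ω, φ (K ω) ∂P := by
    have h1 : ∀ ω, rexp (-τ) * (1 + τ - T ω) ≤ φ (K ω) := by
      intro ω
      have : φ (K ω) = rexp (-τ) * rexp (τ - T ω) := by
        rw [← Real.exp_add, hφ]
        simp only [hT, hKd]
        congr 1; ring
      rw [this]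
      apply mul_le_mul_of_nonneg_left _ (Real.exp_pos _).le
      linarith [Real.add_one_le_exp (τ - T ω)]
    have h2 := integral_mono (((integrable_const (1 + τ)).sub Tint).const_mul (rexp (-τ)))
      ((integrable_map_measure φi.aestronglyMeasurable mK.aemeasurable).1 φi) h1
    refine le_trans ?_ h2
    rw [integral_const_mul, integral_sub' (integrable_const _) Tint]
    simp only [integral_const, probReal_univ, smul_eq_mul, one_mul]
    have : rexp (-τ) * 1 ≤ rexp (-τ) * (1 + τ - ∫ ω, T ω ∂P) :=
      mul_le_mul_of_nonneg_left (by linarith) (Real.exp_pos _).le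
    linarith
  have e : -∑ i, (2 * a i * κ i + Real.log (Φ i)) = (-τ) + (-τ) - Real.log (∏ i, Φ i) := by
    rw [Real.log_prod (fun i _ => (Φ0 i).ne'), Finset.sum_add_distrib]
    have : ∑ i, 2 * a i * κ i = 2 * τ := by
      rw [hτ, Finset.mul_sum]; exact Finset.sum_congr rfl fun i _ => by ring
    rw [this]; ring
  change rexp (-∑ i, (2 * a i * κ i + Real.log (Φ i))) ≤ R
  rw [e, Real.exp_sub, Real.exp_log hΦp, div_le_iff₀ hΦp, Real.exp_add]
  refine le_trans ?_ hS2
  rw [sq]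
  exact mul_le_mul hJ hJ (Real.exp_pos _).le ((Real.exp_pos _).le.trans hJ)

lemma aux_gi {Ω : Type*} [MeasurableSpace Ω] (P : Measure Ω) (Y : Ω → ℝ) (hY : Measurable Y)
    (v : ℝ≥0) (h : P.map Y = gaussianReal 0 v) : Integrable Y P := by
  have h1 : Integrable id (gaussianReal 0 v) :=
    memLp_one_iff_integrable.1 (memLp_id_gaussianReal' 1 (by simp))
  rw [← h] at h1
  exact h1.comp_measurable hY

lemma aux_cosh {Ω : Type*} [MeasurableSpace Ω] (P : Measure Ω) (Y : Ω → ℝ) (hY : Measurable Y)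
    (v : ℝ≥0) (h : P.map Y = gaussianReal 0 v) (s : ℝ) (hs : 0 < s) (hv : (v:ℝ) ≤ s ^ 2) (c : ℝ) :
    Integrable (fun ω => rexp (c / s * Y ω) + rexp (-(c / s) * Y ω)) P ∧
    ∫ ω, (rexp (c / s * Y ω) + rexp (-(c / s) * Y ω)) ∂P ≤ 2 * rexp (c ^ 2 / 2) := by
  have h1 := aux_gauss_int P Y hY v h (c / s)
  have h2 := aux_gauss_int P Y hY v h (-(c / s))
  refine ⟨h1.1.add h2.1, ?_⟩
  rw [integral_add h1.1 h2.1, h1.2, h2.2]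
  have : (v:ℝ) * (c / s) ^ 2 / 2 ≤ c ^ 2 / 2 := by
    have : (v:ℝ) * (c / s) ^ 2 ≤ s ^ 2 * (c / s) ^ 2 :=
      mul_le_mul_of_nonneg_right hv (sq_nonneg _)
    have e : s ^ 2 * (c / s) ^ 2 = c ^ 2 := by field_simp
    linarith
  have := Real.exp_le_exp.2 this
  rw [neg_sq]
  linarith

lemma aux_exp_abs (c z : ℝ) : rexp (c * |z|) ≤ rexp (c * z) + rexp (-c * z) := by
  rcases abs_cases z with ⟨h, _⟩ | ⟨h, _⟩ <;> rw [h]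
  · linarith [Real.exp_pos (-c * z)]
  · have : c * -z = -c * z := by ring
    rw [this]
    linarith [Real.exp_pos (c * z)]

lemma aux_k1 {Ω : Type*} [MeasurableSpace Ω] (P : Measure Ω) (Y : Ω → ℝ) (hY : Measurable Y)
    (v : ℝ≥0) (h : P.map Y = gaussianReal 0 v) (s : ℝ) (hs : 0 < s) (hv : (v:ℝ) ≤ s ^ 2)
    (w : ℝ) (hw : 0 < w) : ∫ ω, |(round (Y ω / w) : ℝ)| ∂P ≤ 8 * s / w := by
  have h1 := aux_cosh P Y hY v h s hs hv 1
  have pt : ∀ ω, |(round (Y ω / w) : ℝ)| ≤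
      2 * s / w * (rexp (1 / s * Y ω) + rexp (-(1 / s) * Y ω)) := by
    intro ω
    have a1 := aux_round (Y ω / w)
    have a2 := aux_exp_abs (1/s) (Y ω)
    have a3 := Real.add_one_le_exp (1 / s * |Y ω|)
    have e : 2 * |Y ω / w| = 2 * s / w * (1 / s * |Y ω|) := by
      rw [abs_div, abs_of_pos hw]; field_simp
    rw [e] at a1
    refine a1.trans (mul_le_mul_of_nonneg_left ?_ (by positivity))
    linarith
  have h2 := integral_mono_of_nonneg (Filter.Eventually.of_forall fun ω => abs_nonneg _)
    (h1.1.const_mul (2 * s / w)) (Filter.Eventually.of_forall pt)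
  refine h2.trans ?_
  rw [integral_const_mul]
  have h3 : rexp (1 ^ 2 / 2) ≤ 2 := by
    have : rexp (1 ^ 2 / 2) ^ 2 = rexp 1 := by rw [← Real.exp_nat_mul]; norm_num
    nlinarith [Real.exp_one_lt_d9, Real.exp_pos (1 ^ 2 / 2)]
  calc _ ≤ 2 * s / w * 4 := mul_le_mul_of_nonneg_left (by linarith [h1.2]) (by positivity)
    _ = 8 * s / w := by ring

lemma aux_k2 {Ω : Type*} [MeasurableSpace Ω] (P : Measure Ω) (Y : Ω → ℝ) (hY : Measurable Y)
    (v : ℝ≥0) (h : P.map Y = gaussianReal 0 v) (s : ℝ) (hs : 0 < s) (hv : (v:ℝ) ≤ s ^ 2)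
    (w : ℝ) (hw : s ≤ w) :
    ∫ ω, |(round (Y ω / w) : ℝ)| ∂P ≤ 20 * rexp (-((w / s) ^ 2 / 16)) := by
  have hw0 : 0 < w := hs.trans_le hw
  set u := w / s with hu
  have hu1 : 1 ≤ u := (one_le_div hs).2 hw
  set k := u / 2 with hk
  have h1 := aux_cosh P Y hY v h s hs hv (k + 1)
  have pt : ∀ ω, |(round (Y ω / w) : ℝ)| ≤
      2 * rexp (-k ^ 2) * (rexp ((k + 1) / s * Y ω) + rexp (-((k + 1) / s) * Y ω)) := by
    intro ω
    have a1 := aux_round (Y ω / w)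
    have a2 := aux_exp_abs ((k + 1)/s) (Y ω)
    by_cases hz : round (Y ω / w) = 0
    · rw [hz]; simp only [Int.cast_zero, abs_zero]; positivity
    have b1 : (1:ℝ) ≤ |(round (Y ω / w) : ℝ)| := by
      have := Int.one_le_abs hz
      exact_mod_cast this
    set z := |Y ω| / s with hzd
    have ez : 2 * |Y ω / w| = 2 * z / u := by
      rw [abs_div, abs_of_pos hw0, hzd, hu]; field_simp
    rw [ez] at a1
    have b2 : k ≤ z := by
      have : 1 ≤ 2 * z / u := b1.trans a1
      rw [le_div_iff₀ (by linarith)] at this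
      rw [hk]; linarith
    have z0 : 0 ≤ z := by positivity
    have b3 : 2 * z / u ≤ 2 * z := div_le_self (by positivity) hu1
    have b4 : z ≤ rexp z := by linarith [Real.add_one_le_exp z]
    have b5 : 1 ≤ rexp (k * (z - k)) := Real.one_le_exp (mul_nonneg (by positivity) (by linarith))
    have b6 : rexp z * rexp (k * (z - k)) = rexp (-k ^ 2) * rexp ((k + 1) / s * |Y ω|) := by
      rw [← Real.exp_add, ← Real.exp_add, hzd]; congr 1; field_simp; ring
    calc _ ≤ 2 * z := a1.trans b3
      _ ≤ 2 * (rexp z * rexp (k * (z - k))) := by nlinarith [Real.exp_pos z]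
      _ = 2 * rexp (-k ^ 2) * rexp ((k + 1) / s * |Y ω|) := by rw [b6]; ring
      _ ≤ _ := mul_le_mul_of_nonneg_left a2 (by positivity)
  have h2 := integral_mono_of_nonneg (Filter.Eventually.of_forall fun ω => abs_nonneg _)
    (h1.1.const_mul (2 * rexp (-k ^ 2))) (Filter.Eventually.of_forall pt)
  refine h2.trans ?_
  rw [integral_const_mul]
  have h3 : rexp (3/2) ≤ 5 := by
    have : rexp (3/2) ^ 2 = rexp 1 ^ 3 := by
      rw [← Real.exp_nat_mul, ← Real.exp_nat_mul]; norm_num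
    have h4 : rexp 1 ^ 3 ≤ 2.72 ^ 3 :=
      pow_le_pow_left₀ (Real.exp_pos _).le (by linarith [Real.exp_one_lt_d9]) 3
    have h5 : (2.72:ℝ) ^ 3 ≤ 25 := by norm_num
    nlinarith [Real.exp_pos (3/2)]
  calc _ ≤ 2 * rexp (-k ^ 2) * (2 * rexp ((k + 1) ^ 2 / 2)) :=
        mul_le_mul_of_nonneg_left h1.2 (by positivity)
    _ = 4 * rexp (-k ^ 2 + (k + 1) ^ 2 / 2) := by rw [Real.exp_add]; ring
    _ ≤ 4 * rexp (3/2 + -(u ^ 2 / 16)) := by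
        apply mul_le_mul_of_nonneg_left _ (by norm_num)
        apply Real.exp_le_exp.2
        have : u = 2 * k := by rw [hk]; ring
        rw [this]
        nlinarith [sq_nonneg (k - 2)]
    _ ≤ _ := by
        rw [Real.exp_add]
        nlinarith [Real.exp_pos (-(u ^ 2 / 16))]

lemma aux_one {ι Ω : Type*} [Fintype ι] [MeasurableSpace Ω] (P : Measure Ω)
    (X : ι → Ω → ℝ)
    (hG : ∀ a : ι → ℝ, ∃ v : ℝ≥0, P.map (fun ω => ∑ i, a i * X i ω) = gaussianReal 0 v) (i : ι) :
    ∃ v : ℝ≥0, P.map (X i) = gaussianReal 0 v := by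
  classical
  obtain ⟨v, hv⟩ := hG (fun j => if j = i then 1 else 0)
  refine ⟨v, ?_⟩
  rw [← hv]
  congr 1
  ext ω
  simp

lemma aux_sb2 {ι Ω : Type*} [Fintype ι] [MeasurableSpace Ω] (P : Measure Ω)
    [IsProbabilityMeasure P] (X : ι → Ω → ℝ) (hX : ∀ i, Measurable (X i))
    (hG : ∀ a : ι → ℝ, ∃ v : ℝ≥0, P.map (fun ω => ∑ i, a i * X i ω) = gaussianReal 0 v)
    (w a s : ι → ℝ) (hs : ∀ i, 0 < s i) (hw : ∀ i, s i ≤ w i) (ha : ∀ i, 1 ≤ a i)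
    (hv : ∀ i, ∃ v : ℝ≥0, P.map (X i) = gaussianReal 0 v ∧ (v:ℝ) ≤ s i ^ 2) :
    rexp (-∑ i, (40 * a i * rexp (-((w i / s i) ^ 2 / 16)) + 4 * rexp (-(2 * a i))))
      ≤ P.real {ω | ∀ i, |X i ω| ≤ w i} := by
  choose v hv1 hv2 using hv
  refine le_trans ?_ (aux_sb P X hX hG w a (fun i => 20 * rexp (-((w i / s i) ^ 2 / 16)))
    (fun i => (hs i).trans_le (hw i)) (fun i => by linarith [ha i])
    (fun i => aux_gi P _ (hX i) _ (hv1 i))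
    (fun i => aux_k2 P _ (hX i) _ (hv1 i) _ (hs i) (hv2 i) _ (hw i)))
  apply Real.exp_le_exp.2
  apply neg_le_neg
  refine Finset.sum_le_sum fun i _ => ?_
  have hE : 2 ≤ rexp (2 * a i) := by linarith [Real.add_one_le_exp (2 * a i), ha i]
  have h1 : 0 < rexp (2 * a i) - 1 := by linarith
  have h2 : Real.log (1 + 2 / (rexp (2 * a i) - 1)) ≤ 2 / (rexp (2 * a i) - 1) := by
    have := Real.log_le_sub_one_of_pos (x := 1 + 2 / (rexp (2 * a i) - 1)) (by positivity)
    linarith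
  have h3 : 2 / (rexp (2 * a i) - 1) ≤ 4 * rexp (-(2 * a i)) := by
    rw [Real.exp_neg, div_le_iff₀ h1]
    have : 4 * (rexp (2 * a i))⁻¹ * (rexp (2 * a i) - 1) = 4 - 4 * (rexp (2 * a i))⁻¹ := by
      field_simp
    rw [this]
    have : (rexp (2 * a i))⁻¹ ≤ 2⁻¹ := inv_anti₀ (by norm_num) hE
    linarith
  linarith

lemma aux_sb3 {ι Ω : Type*} [Fintype ι] [MeasurableSpace Ω] (P : Measure Ω)
    [IsProbabilityMeasure P] (X : ι → Ω → ℝ) (hX : ∀ i, Measurable (X i))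
    (hG : ∀ a : ι → ℝ, ∃ v : ℝ≥0, P.map (fun ω => ∑ i, a i * X i ω) = gaussianReal 0 v)
    (w : ℝ) (hw : 0 < w)
    (hv : ∀ i, ∃ v : ℝ≥0, P.map (X i) = gaussianReal 0 v ∧ (v:ℝ) ≤ 1) :
    rexp (-(Fintype.card ι * (16 + Real.log (1 + 1 / w))))
      ≤ P.real {ω | ∀ i, |X i ω| ≤ w} := by
  choose v hv1 hv2 using hv
  refine le_trans ?_ (aux_sb P X hX hG (fun _ => w) (fun _ => w) (fun i => 8 * 1 / w)
    (fun i => hw) (fun i => hw)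
    (fun i => aux_gi P _ (hX i) _ (hv1 i))
    (fun i => aux_k1 P _ (hX i) _ (hv1 i) 1 one_pos (by simpa using hv2 i) _ hw))
  apply Real.exp_le_exp.2
  apply neg_le_neg
  rw [Finset.sum_const, Finset.card_univ, nsmul_eq_mul]
  apply mul_le_mul_of_nonneg_left _ (by positivity)
  have hE := Real.add_one_le_exp (2 * w)
  have e : 2 * w * (8 * 1 / w) = 16 := by field_simp; norm_num
  rw [e]
  have h1 : 2 / (rexp (2 * w) - 1) ≤ 1 / w := by
    rw [div_le_div_iff₀ (by linarith) hw]; linarith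
  have : 0 ≤ 2 / (rexp (2 * w) - 1) := div_nonneg (by norm_num) (by linarith)
  have := Real.log_le_log (by linarith) (by linarith : 1 + 2 / (rexp (2 * w) - 1) ≤ 1 + 1 / w)
  linarith

lemma aux_final {Ω : Type*} [MeasurableSpace Ω] (p q A B s b γ N y : ℝ) (hb : 0 < b) (hN : 0 < N)
    (hs : b * N ^ (-γ) ≤ s)
    (h1 : rexp (-A) ≤ q) (h2 : rexp (-(32 * y ^ 2 / s)) * q ≤ p)
    (hB : 32 * y ^ 2 * N ^ γ / b + A ≤ B) : rexp (-B) ≤ p := by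
  have hbn : 0 < b * N ^ (-γ) := mul_pos hb (Real.rpow_pos_of_pos hN _)
  have h3 : 32 * y ^ 2 / s ≤ 32 * y ^ 2 * N ^ γ / b := by
    calc 32 * y ^ 2 / s ≤ 32 * y ^ 2 / (b * N ^ (-γ)) := by
          apply div_le_div_of_nonneg_left (by positivity) hbn hs
      _ = _ := by
          rw [Real.rpow_neg hN.le]
          have := (Real.rpow_pos_of_pos hN γ).ne'
          field_simp
  refine le_trans ?_ h2
  calc rexp (-B) ≤ rexp (-(32 * y ^ 2 / s)) * rexp (-A) := by
        rw [← Real.exp_add]; apply Real.exp_le_exp.2; linarith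
    _ ≤ _ := mul_le_mul_of_nonneg_left h1 (Real.exp_pos _).le

lemma aux_logle (p B : ℝ) (h : rexp (-B) ≤ p) : -B ≤ Real.log p :=
  (Real.le_log_iff_exp_le ((Real.exp_pos _).trans_le h)).2 h

lemma aux_Zcore {Ω : Type} [MeasurableSpace Ω] (P : Measure Ω) (ρ : Measure ℝ)
    (f : ℤ → Ω → ℝ) (h : IsGSPZ ρ P f) (b γ N y A B : ℝ) (hb : 0 < b) (hN : 0 < N) (hy : 0 < y)
    (hs : b * N ^ (-γ) ≤ sig2 ρ N)
    (h1 : rexp (-A) ≤ P.real {ω | ∀ i : Fin ⌊N⌋₊, |f ((i:ℕ) + 1 : ℤ) ω| ≤ y})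
    (hB : 32 * y ^ 2 * N ^ γ / b + A ≤ B) : -B ≤ Real.log (persZ P f N) := by
  obtain ⟨hf, -, -, hP, hm, hG⟩ := h
  have hbn : 0 < b * N ^ (-γ) := mul_pos hb (Real.rpow_pos_of_pos hN _)
  apply aux_logle
  have h2 := aux_shift P ρ (fun (i : Fin ⌊N⌋₊) => f ((i:ℕ) + 1 : ℤ)) (fun i => hm _)
    (fun i => (((i:ℕ) + 1 : ℤ) : ℝ)) N hN (fun i => by
      have h3 : (((i:ℕ) + 1 : ℕ) : ℝ) ≤ N :=
        (Nat.cast_le.2 i.2).trans (Nat.floor_le hN.le)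
      push_cast at h3 ⊢
      rw [abs_of_nonneg (by positivity)]; linarith)
    (fun a => hG _ _ a) (hbn.trans_le hs) y hy.le
  refine (aux_final (Ω := Ω) _ _ A B (sig2 ρ N) b γ N y hb hN hs h1 h2 hB).trans ?_
  unfold persZ
  refine measureReal_mono ?_ (measure_ne_top _ _)
  intro ω hω n hn hnN
  have h5 : n.toNat - 1 < ⌊N⌋₊ := by
    have : n.toNat ≤ ⌊N⌋₊ := by
      apply Nat.le_floor
      have : ((n.toNat : ℤ) : ℝ) = n := by rw [Int.toNat_of_nonneg hn.le]
      have h6 : ((n.toNat : ℕ) : ℝ) = n := by exact_mod_cast this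
      rw [h6]; exact hnN
    omega
  have := hω ⟨n.toNat - 1, h5⟩
  have h7 : ((n.toNat - 1 : ℕ) : ℤ) + 1 = n := by omega
  simp only [h7] at this
  exact hy.trans_le this

lemma aux_Zlaw {Ω : Type} [MeasurableSpace Ω] (P : Measure Ω) (ρ : Measure ℝ)
    (f : ℤ → Ω → ℝ) (h : IsGSPZ ρ P f) (hρ : ρ univ = 1) (n : ℤ) :
    P.map (f n) = gaussianReal 0 1 := by
  have := h.2.2.2.2.2 1 (fun _ => n) (fun _ => 1)
  simpa [measureReal_def, hρ] using this

lemma aux_Z1 {Ω : Type} [MeasurableSpace Ω] (P : Measure Ω) (ρ : Measure ℝ)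
    (f : ℤ → Ω → ℝ) (h : IsGSPZ ρ P f) (hρ : ρ univ = 1) (b γ N l : ℝ) (hb : 0 < b) (hN : 0 < N)
    (hl : 1 ≤ l)
    (hs : b * N ^ (-γ) ≤ sig2 ρ N) :
    -(512 * l * N ^ γ / b + 44 * N * l * rexp (-l)) ≤ Real.log (persZ P f N) := by
  have hsq : √l ^ 2 = l := Real.sq_sqrt (by linarith)
  have h1l : 1 ≤ √l := Real.one_le_sqrt.2 hl
  have hP := h.2.2.2.1
  have hm := h.2.2.2.2.1
  have hG := h.2.2.2.2.2
  refine aux_Zcore P ρ f h b γ N (4 * √l) _ _ hb hN (by linarith) hs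
    (aux_sb2 P (fun (i : Fin ⌊N⌋₊) => f ((i:ℕ) + 1 : ℤ)) (fun i => hm _)
      (fun a => ⟨_, hG _ _ a⟩) (fun _ => 4 * √l) (fun _ => l) (fun _ => 1)
      (fun _ => one_pos) (fun _ => by linarith) (fun _ => hl)
      (fun i => ⟨1, aux_Zlaw P ρ f h hρ _, by simp⟩)) ?_
  rw [Finset.sum_const, Finset.card_univ, Fintype.card_fin, nsmul_eq_mul]
  have e1 : (4 * √l / 1) ^ 2 / 16 = l := by rw [div_one, mul_pow, hsq]; ring
  rw [e1, mul_pow, hsq]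
  have h3 : rexp (-(2 * l)) ≤ rexp (-l) := Real.exp_le_exp.2 (by linarith)
  have h4 : rexp (-l) ≤ l * rexp (-l) := le_mul_of_one_le_left (Real.exp_pos _).le hl
  have h5 := Nat.floor_le hN.le
  have : (⌊N⌋₊:ℝ) * (40 * l * rexp (-l) + 4 * rexp (-(2*l))) ≤ N * (44 * (l * rexp (-l))) :=
    mul_le_mul h5 (by linarith) (by positivity) hN.le
  have e2 : 32 * (4 ^ 2 * l) * N ^ γ / b = 512 * l * N ^ γ / b := by ring
  rw [e2]; linarith

lemma aux_Z2 {Ω : Type} [MeasurableSpace Ω] (P : Measure Ω) (ρ : Measure ℝ)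
    (f : ℤ → Ω → ℝ) (h : IsGSPZ ρ P f) (hρ : ρ univ = 1) (b γ N : ℝ) (hb : 0 < b) (hN : 1 ≤ N)
    (hγ : 1 < γ)
    (hs : b * N ^ (-γ) ≤ sig2 ρ N) :
    -(32 * N / b + N * (17 + (γ - 1) / 2 * Real.log N)) ≤ Real.log (persZ P f N) := by
  have hP := h.2.2.2.1
  have hm := h.2.2.2.2.1
  have hG := h.2.2.2.2.2
  have hN0 : 0 < N := by linarith
  set w := N ^ (-((γ - 1) / 2)) with hw
  have hw0 : 0 < w := Real.rpow_pos_of_pos hN0 _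
  refine aux_Zcore P ρ f h b γ N w _ _ hb hN0 hw0 hs
    (aux_sb3 P (fun (i : Fin ⌊N⌋₊) => f ((i:ℕ) + 1 : ℤ)) (fun i => hm _)
      (fun a => ⟨_, hG _ _ a⟩) w hw0
      (fun i => ⟨1, aux_Zlaw P ρ f h hρ _, by simp⟩)) ?_
  rw [Fintype.card_fin]
  have e1 : w ^ 2 * N ^ γ = N := by
    rw [hw, ← Real.rpow_natCast, ← Real.rpow_mul hN0.le, ← Real.rpow_add hN0]
    convert Real.rpow_one N using 2
    push_cast; ring
  have e2 : 1 / w = N ^ ((γ - 1) / 2) := by rw [hw, Real.rpow_neg hN0.le]; simp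
  have h3 : 1 ≤ 1 / w := by
    rw [e2]; exact Real.one_le_rpow hN (by linarith)
  have h4 : Real.log (1 + 1 / w) ≤ 1 + (γ - 1) / 2 * Real.log N := by
    calc Real.log (1 + 1 / w) ≤ Real.log (2 * (1 / w)) :=
          Real.log_le_log (by linarith) (by linarith)
      _ = Real.log 2 + (γ - 1) / 2 * Real.log N := by
          rw [Real.log_mul (by norm_num) (by linarith), e2, Real.log_rpow hN0]
      _ ≤ _ := by linarith [Real.log_two_lt_d9]
  have h6 : 0 ≤ Real.log (1 + 1 / w) := Real.log_nonneg (by linarith)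
  have h5 := Nat.floor_le hN0.le
  have : (⌊N⌋₊:ℝ) * (16 + Real.log (1 + 1 / w)) ≤ N * (17 + (γ - 1) / 2 * Real.log N) :=
    mul_le_mul h5 (by linarith) (by positivity) hN0.le
  have e3 : 32 * w ^ 2 * N ^ γ / b = 32 * N / b := by rw [mul_assoc, e1]
  rw [e3]; linarith

lemma aux_Zmain (b γ δ m : ℝ) (hb : 0 < b) (hγ : 0 < γ) (hδ : 0 < δ) :
    (∃ C : ℝ, 0 < C ∧ ∃ N₀ : ℝ, 0 < N₀ ∧
      ∀ (Ω : Type) (_ : MeasurableSpace Ω) (P : Measure Ω) (ρ : Measure ℝ)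
        (f : ℤ → Ω → ℝ) (S : Set ℝ), IsGSPZ ρ P f → ρ Set.univ = 1 →
        specMom ρ δ = ENNReal.ofReal m →
        S ⊆ Set.Ioi (0 : ℝ) → ¬ BddAbove S →
        (∀ N ∈ S, b * N ^ (-γ) ≤ sig2 ρ N) →
        ∀ N ∈ S, N₀ < N →
          (γ < 1 → -C * N ^ γ * Real.log N ≤ Real.log (persZ P f N)) ∧
          (γ = 1 → -C * N ≤ Real.log (persZ P f N)) ∧
          (1 < γ → -C * (γ - 1) * N * Real.log N ≤ Real.log (persZ P f N))) := by
  refine ⟨512 / b + 44 + (32 / b + 17) / |γ - 1|, by positivity, rexp 1, Real.exp_pos _, ?_⟩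
  intro Ω _ P ρ f S h hρ _ _ _ hS N hNS hN
  have hN0 : 0 < N := (Real.exp_pos _).trans hN
  have hl : 1 ≤ Real.log N := (Real.le_log_iff_exp_le hN0).2 hN.le
  have hN1 : 1 ≤ N := by linarith [Real.add_one_le_exp 1]
  have hE : 0 ≤ (32 / b + 17) / |γ - 1| := by positivity
  refine ⟨fun hg => ?_, fun hg => ?_, fun hg => ?_⟩
  · refine le_trans ?_ (aux_Z1 P ρ f h hρ b γ N (Real.log N) hb hN0 hl (hS N hNS))
    rw [Real.exp_neg, Real.exp_log hN0]
    have h1 : 1 ≤ N ^ γ := Real.one_le_rpow hN1 hγ.le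
    have h2 : 44 * N * Real.log N * N⁻¹ = 44 * Real.log N := by field_simp
    have h3 : Real.log N ≤ N ^ γ * Real.log N := le_mul_of_one_le_left (by linarith) h1
    have h4 : 0 ≤ (32 / b + 17) / |γ - 1| * (N ^ γ * Real.log N) := by positivity
    have h5 : 512 * Real.log N * N ^ γ / b = 512 / b * (N ^ γ * Real.log N) := by ring
    rw [h2, h5]
    linarith
  · refine le_trans ?_ (aux_Z1 P ρ f h hρ b γ N 1 hb hN0 le_rfl (hS N hNS))
    have h1 : rexp (-1) ≤ 1 := Real.exp_le_one_iff.2 (by norm_num)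
    have h2 : N * rexp (-1) ≤ N := mul_le_of_le_one_right hN0.le h1
    have h4 : 0 ≤ (32 / b + 17) / |γ - 1| * N := by positivity
    have h5 : 512 * 1 * N ^ γ / b = 512 / b * N := by rw [hg, Real.rpow_one]; ring
    rw [h5]
    linarith
  · refine le_trans ?_ (aux_Z2 P ρ f h hρ b γ N hb hN1 hg (hS N hNS))
    have hg0 : 0 < γ - 1 := by linarith
    rw [abs_of_pos hg0]
    have h4 : (32 / b + 17) / (γ - 1) * (γ - 1) * N * Real.log N = (32 / b + 17) * (N * Real.log N) := by
      field_simp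
    have h5 : (32 / b + 17) * N ≤ (32 / b + 17) * (N * Real.log N) :=
      mul_le_mul_of_nonneg_left (le_mul_of_one_le_right hN0.le hl) (by positivity)
    have h6 : 0 ≤ 512 / b * ((γ - 1) * (N * Real.log N)) := by positivity
    have h7 : 0 ≤ ((γ - 1) * (N * Real.log N)) := by positivity
    have h8 : 32 * N / b = 32 / b * N := by ring
    rw [h8]
    linarith

lemma aux_fam {Ω : Type} [MeasurableSpace Ω] (P : Measure Ω) (f : ℝ → Ω → ℝ)
    (hG : ∀ (n : ℕ) (t a : Fin n → ℝ), ∃ v : ℝ≥0,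
      P.map (fun ω => ∑ i, a i * f (t i) ω) = gaussianReal 0 v)
    {ι : Type} [Fintype ι] (t a : ι → ℝ) :
    ∃ v : ℝ≥0, P.map (fun ω => ∑ i, a i * f (t i) ω) = gaussianReal 0 v := by
  obtain ⟨v, hv⟩ := hG (Fintype.card ι) (t ∘ (Fintype.equivFin ι).symm)
    (a ∘ (Fintype.equivFin ι).symm)
  refine ⟨v, ?_⟩
  rw [← hv]
  congr 1
  ext ω
  exact (Equiv.sum_comp (Fintype.equivFin ι).symm (fun i => a i * f (t i) ω)).symm

lemma aux_comb {Ω : Type} [MeasurableSpace Ω] (P : Measure Ω) (f : ℝ → Ω → ℝ)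
    (hG : ∀ (n : ℕ) (t a : Fin n → ℝ), ∃ v : ℝ≥0,
      P.map (fun ω => ∑ i, a i * f (t i) ω) = gaussianReal 0 v)
    {ι : Type} [Fintype ι] (T S c a : ι → ℝ) :
    ∃ v : ℝ≥0, P.map (fun ω => ∑ i, a i * (f (T i) ω - c i * f (S i) ω))
      = gaussianReal 0 v := by
  obtain ⟨v, hv⟩ := aux_fam P f hG (ι := ι ⊕ ι) (Sum.elim T S) (Sum.elim a (fun i => -(a i * c i)))
  refine ⟨v, ?_⟩
  rw [← hv]
  congr 1
  ext ω
  rw [Fintype.sum_sum_type, ← Finset.sum_add_distrib]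
  refine Finset.sum_congr rfl fun i _ => ?_
  simp only [Sum.elim_inl, Sum.elim_inr]
  ring

lemma aux_cost (Q : ℝ) (hQ : 1 < Q) : ∃ C : ℝ, 0 < C ∧ ∀ (l : ℝ), 1 ≤ l → ∀ k : ℕ,
    2 ^ k * (40 * (k + l) * rexp (-(l * Q ^ k)) + 4 * rexp (-(2 * (k + l))))
      ≤ C * (l * rexp (-l)) * (1/2) ^ k := by
  obtain ⟨M, hM⟩ := pow_unbounded_of_one_lt 8 hQ
  refine ⟨120 * M.factorial + 4, by positivity, fun l hl k => ?_⟩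
  have hQk : 1 ≤ Q ^ k := one_le_pow₀ hQ.le
  have hk2 : (k:ℝ) + 1 ≤ 2 ^ k := by
    have : k + 1 ≤ 2 ^ k := Nat.lt_two_pow_self
    exact_mod_cast this
  have hk1 : (k:ℝ) + l ≤ l * 2 ^ k := by
    have : (0:ℝ) ≤ k := Nat.cast_nonneg k
    nlinarith
  have h1 : rexp (-(l * Q ^ k)) ≤ rexp (-l) * (3 * rexp (-(Q ^ k))) := by
    calc rexp (-(l * Q ^ k)) ≤ rexp (-l + (1 + -(Q ^ k))) :=
          Real.exp_le_exp.2 (by nlinarith)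
      _ = rexp (-l) * (rexp 1 * rexp (-(Q ^ k))) := by rw [Real.exp_add, Real.exp_add]
      _ ≤ _ := by
        gcongr
        linarith [Real.exp_one_lt_d9]
  have h2 : rexp (-(Q ^ k)) ≤ M.factorial * (1/8) ^ k := by
    have h3 := Real.pow_div_factorial_le_exp (Q ^ k) (by linarith) M
    have h4 : (8:ℝ) ^ k ≤ (Q ^ k) ^ M := by
      rw [← pow_mul, mul_comm, pow_mul]
      exact pow_le_pow_left₀ (by norm_num) hM.le k
    have hf : (0:ℝ) < M.factorial := by positivity
    have h5 : (8:ℝ) ^ k / M.factorial ≤ rexp (Q ^ k) :=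
      le_trans (by gcongr) h3
    rw [Real.exp_neg, one_div, inv_pow, ← div_eq_mul_inv]
    rw [inv_le_comm₀ (Real.exp_pos _) (by positivity), inv_div]
    exact h5
  have h6 : rexp (-(2 * (k + l))) ≤ (1/4) ^ k * (l * rexp (-l)) := by
    have e1 : rexp (-(2 * (k + l))) = rexp (-2) ^ k * rexp (-(2 * l)) := by
      rw [← Real.exp_nat_mul, ← Real.exp_add]; congr 1; ring
    rw [e1]
    have h7 : rexp (-2) ≤ 1/4 := by
      rw [Real.exp_neg, one_div]
      apply inv_anti₀ (by norm_num)
      have : rexp 2 = rexp 1 ^ 2 := by rw [← Real.exp_nat_mul]; norm_num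
      rw [this]
      nlinarith [Real.exp_one_gt_d9]
    have h8 : rexp (-(2*l)) ≤ l * rexp (-l) := by
      have : rexp (-(2*l)) ≤ rexp (-l) := Real.exp_le_exp.2 (by linarith)
      have := Real.exp_pos (-l)
      nlinarith
    exact mul_le_mul (pow_le_pow_left₀ (Real.exp_pos _).le h7 k) h8 (Real.exp_pos _).le (by positivity)
  have h9 : 40 * (k + l) * rexp (-(l * Q ^ k)) ≤
      40 * (l * 2 ^ k) * (rexp (-l) * (3 * (M.factorial * (1/8) ^ k))) := by
    refine mul_le_mul (by linarith) (h1.trans ?_) (Real.exp_pos _).le (by positivity)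
    gcongr
  calc _ ≤ 2 ^ k * (40 * (l * 2 ^ k) * (rexp (-l) * (3 * (M.factorial * (1/8) ^ k)))
        + 4 * ((1/4) ^ k * (l * rexp (-l)))) := by gcongr
    _ = 120 * M.factorial * (l * rexp (-l)) * (2 ^ k * 2 ^ k * (1/8) ^ k)
        + 4 * (l * rexp (-l)) * (2 ^ k * (1/4) ^ k) := by ring
    _ = _ := by
      rw [← mul_pow, ← mul_pow, ← mul_pow]; norm_num; ring

lemma aux_chain (η K : ℝ) (hη : 0 < η) (hK : 1 ≤ K) :
    ∃ W C : ℝ, 0 < W ∧ 0 < C ∧ ∀ (Ω : Type) (_ : MeasurableSpace Ω) (P : Measure Ω)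
      (_ : IsProbabilityMeasure P) (f : ℝ → Ω → ℝ), (∀ t, Measurable (f t)) →
      (∀ (n : ℕ) (t a : Fin n → ℝ), ∃ v : ℝ≥0,
        P.map (fun ω => ∑ i, a i * f (t i) ω) = gaussianReal 0 v) →
      (∀ t, P.map (f t) = gaussianReal 0 1) →
      (∀ s t, ∃ v : ℝ≥0, P.map (fun ω => f t ω - f s ω) = gaussianReal 0 v ∧
        (v:ℝ) ≤ (K * |t - s| ^ η) ^ 2) →
      ∀ (n L : ℕ) (l : ℝ), 1 ≤ l →
        rexp (-(C * (n + 1) * l * rexp (-l))) ≤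
          P.real {ω | ∀ i : Fin (n * 2 ^ L + 1), |f ((i:ℕ) / 2 ^ L) ω| ≤ W * √l} := by
  have hK0 : 0 < K := by linarith
  set q : ℝ := 2 ^ (-η / 2) with hq
  have hq0 : 0 < q := Real.rpow_pos_of_pos (by norm_num) _
  have hq1 : q < 1 := Real.rpow_lt_one_of_one_lt_of_neg (by norm_num) (by linarith)
  have hq2 : 1 < (q⁻¹) ^ 2 := one_lt_pow₀ ((one_lt_inv₀ hq0).2 hq1) (by norm_num)
  obtain ⟨C, hC, hcost⟩ := aux_cost _ hq2
  refine ⟨4 * K / (1 - q), 2 * C, div_pos (by linarith) (by linarith), by linarith, ?_⟩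
  intro Ω _ P _ f hm hG h1 hinc n L l hl
  have hsl : 1 ≤ √l := Real.one_le_sqrt.2 hl
  have hsq : √l ^ 2 = l := Real.sq_sqrt (by linarith)
  let ι := Σ k : Fin (L + 1), Fin (n * 2 ^ (k:ℕ) + 1)
  let T : ι → ℝ := fun x => ((x.2:ℕ):ℝ) / 2 ^ (x.1:ℕ)
  let S : ι → ℝ := fun x => (((x.2:ℕ) / 2 : ℕ):ℝ) / 2 ^ ((x.1:ℕ) - 1)
  let c : ι → ℝ := fun x => if (x.1:ℕ) = 0 then 0 else 1
  let X : ι → Ω → ℝ := fun x ω => f (T x) ω - c x * f (S x) ω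
  have hsb := aux_sb2 P X (fun x => (hm _).sub ((hm _).const_mul _))
    (fun a => aux_comb P f hG T S c a)
    (fun x => 4 * K * √l * q ^ (x.1:ℕ)) (fun x => (x.1:ℕ) + l) (fun x => K * (q ^ (x.1:ℕ)) ^ 2)
    (fun x => by positivity)
    (fun x => by
      have h3 : q ^ (x.1:ℕ) ≤ 1 := pow_le_one₀ hq0.le hq1.le
      have h4 : 0 < q ^ (x.1:ℕ) := by positivity
      have h5 : (q ^ (x.1:ℕ)) ^ 2 ≤ q ^ (x.1:ℕ) := by nlinarith
      have h6 : K ≤ 4 * K * √l := by nlinarith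
      exact mul_le_mul h6 h5 (by positivity) (by positivity))
    (fun x => by
      have : (0:ℝ) ≤ (x.1:ℕ) := Nat.cast_nonneg _
      linarith)
    (fun x => by
      by_cases hx : (x.1:ℕ) = 0
      · refine ⟨1, ?_, ?_⟩
        · have : X x = f (T x) := by
            ext ω; simp only [X, c]; rw [if_pos hx]; ring
          rw [this]; exact h1 _
        · rw [hx, pow_zero, one_pow, mul_one, NNReal.coe_one]; nlinarith
      · obtain ⟨v, hv, hv2⟩ := hinc (S x) (T x)
        refine ⟨v, ?_, hv2.trans ?_⟩
        · have : X x = fun ω => f (T x) ω - f (S x) ω := by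
            ext ω; simp only [X, c]; rw [if_neg hx]; ring
          rw [this]; exact hv
        · have hd : |T x - S x| ≤ (2 ^ (x.1:ℕ))⁻¹ := by
            obtain ⟨j, hj⟩ := Nat.exists_eq_succ_of_ne_zero hx
            have e1 : T x - S x = (((x.2:ℕ) % 2 : ℕ):ℝ) * (2 ^ (x.1:ℕ))⁻¹ := by
              simp only [T, S]
              generalize (x.2:ℕ) = z
              rw [hj]
              have : (z:ℝ) = 2 * ((z / 2 : ℕ):ℝ) + ((z % 2 : ℕ):ℝ) := by
                exact_mod_cast (Nat.div_add_mod z 2).symm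
              rw [this, Nat.succ_sub_one, pow_succ]
              field_simp
              ring
            rw [e1, abs_of_nonneg (by positivity)]
            apply mul_le_of_le_one_left (by positivity)
            have : (x.2:ℕ) % 2 ≤ 1 := by omega
            exact_mod_cast this
          have e2 : ((2 ^ (x.1:ℕ))⁻¹ : ℝ) ^ η = (q ^ (x.1:ℕ)) ^ 2 := by
            rw [← Real.rpow_natCast 2, ← Real.rpow_neg (by norm_num), ← Real.rpow_mul (by norm_num),
              hq, ← pow_mul, ← Real.rpow_natCast, ← Real.rpow_mul (by norm_num)]
            congr 1
            push_cast; ring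
          rw [← e2]
          gcongr)
  refine le_trans (Real.exp_le_exp.2 (neg_le_neg ?_)) (hsb.trans ?_)
  · rw [Fintype.sum_sigma]
    simp only [Finset.sum_const, Finset.card_univ, Fintype.card_fin, nsmul_eq_mul]
    have hB : ∀ k : Fin (L + 1), ((n * 2 ^ (k:ℕ) + 1 : ℕ):ℝ) *
        (40 * ((k:ℕ) + l) * rexp (-((4 * K * √l * q ^ (k:ℕ) / (K * (q ^ (k:ℕ)) ^ 2)) ^ 2 / 16))
          + 4 * rexp (-(2 * ((k:ℕ) + l)))) ≤ (n + 1) * (C * (l * rexp (-l))) * (1/2) ^ (k:ℕ) := by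
      intro k
      have e3 : (4 * K * √l * q ^ (k:ℕ) / (K * (q ^ (k:ℕ)) ^ 2)) ^ 2 / 16 = l * ((q⁻¹) ^ 2) ^ (k:ℕ) := by
        have : 4 * K * √l * q ^ (k:ℕ) / (K * (q ^ (k:ℕ)) ^ 2) = 4 * √l * (q⁻¹) ^ (k:ℕ) := by
          rw [inv_pow]; field_simp
        rw [this, mul_pow, mul_pow, hsq, pow_right_comm]; ring
      rw [e3]
      have h5 : ((n * 2 ^ (k:ℕ) + 1 : ℕ):ℝ) ≤ (n + 1) * 2 ^ (k:ℕ) := by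
        push_cast
        have : (1:ℝ) ≤ 2 ^ (k:ℕ) := one_le_pow₀ (by norm_num)
        linarith
      have h6 := hcost l hl k
      calc _ ≤ ((n:ℝ) + 1) * 2 ^ (k:ℕ) * (40 * ((k:ℕ) + l) * rexp (-(l * ((q⁻¹) ^ 2) ^ (k:ℕ)))
          + 4 * rexp (-(2 * ((k:ℕ) + l)))) := by
            apply mul_le_mul_of_nonneg_right h5
            positivity
        _ ≤ _ := by
            have h7 := mul_le_mul_of_nonneg_left h6 (by positivity : (0:ℝ) ≤ (n:ℝ) + 1)
            linarith
    refine (Finset.sum_le_sum fun k _ => hB k).trans ?_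
    rw [← Finset.mul_sum, Fin.sum_univ_eq_sum_range (fun k => ((1:ℝ)/2) ^ k)]
    have h7 : ∑ k ∈ Finset.range (L + 1), ((1:ℝ)/2) ^ k ≤ 2 := sum_geometric_two_le _
    calc _ ≤ (n + 1) * (C * (l * rexp (-l))) * 2 := by gcongr
      _ = _ := by ring
  · refine measureReal_mono ?_ (measure_ne_top _ _)
    intro ω hω
    have hind : ∀ k ≤ L, ∀ i ≤ n * 2 ^ k, |f ((i:ℕ) / 2 ^ k) ω| ≤
        ∑ j ∈ Finset.range (k + 1), 4 * K * √l * q ^ j := by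
      intro k
      induction k with
      | zero =>
        intro _ i hi
        have := hω ⟨⟨0, by omega⟩, ⟨i, by simp only; omega⟩⟩
        simp only [X, T, c] at this
        simpa using this
      | succ k ih =>
        intro hk i hi
        have h1 := hω ⟨⟨k + 1, by omega⟩, ⟨i, by simp only; omega⟩⟩
        have h2 := ih (by omega) (i / 2) (by rw [pow_succ, ← mul_assoc] at hi; omega)
        simp only [X, T, S, c] at h1
        rw [if_neg (by omega), one_mul, Nat.add_sub_cancel] at h1
        rw [Finset.sum_range_succ]
        have := abs_sub_abs_le_abs_sub (f ((i:ℕ) / 2 ^ (k+1)) ω) (f (((i/2:ℕ):ℝ) / 2 ^ k) ω)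
        linarith
    intro i
    refine (hind L le_rfl i (by omega)).trans ?_
    rw [← Finset.mul_sum]
    have h8 : ∑ j ∈ Finset.range (L + 1), q ^ j ≤ (1 - q)⁻¹ := by
      rw [← tsum_geometric_of_lt_one hq0.le hq1]
      exact (summable_geometric_of_lt_one hq0.le hq1).sum_le_tsum _ (fun j _ => by positivity)
    calc _ ≤ 4 * K * √l * (1 - q)⁻¹ := by gcongr
      _ = _ := by ring

lemma aux_cosb (p x : ℝ) (hp : 0 < p) (hp2 : p ≤ 2) : 1 - Real.cos x ≤ 2 * |x| ^ p := by
  by_cases hx : |x| ≤ 1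
  · by_cases h0 : x = 0
    · subst h0; simp; positivity
    have h1 := Real.one_sub_sq_div_two_le_cos (x := x)
    have h2 : |x| ^ (2:ℝ) ≤ |x| ^ p :=
      Real.rpow_le_rpow_of_exponent_ge (abs_pos.2 h0) hx hp2
    rw [Real.rpow_two, sq_abs] at h2
    nlinarith [sq_nonneg x]
  · push Not at hx
    have := Real.one_le_rpow hx.le hp.le
    linarith [Real.neg_one_le_cos x]

lemma aux_mom (ρ : Measure ℝ) [IsFiniteMeasure ρ] (δ m : ℝ)
    (hm : specMom ρ δ = ENNReal.ofReal m) (hδ : 0 < δ) :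
    Integrable (fun l => |l| ^ δ) ρ ∧ ∫ l, |l| ^ δ ∂ρ ≤ |m| := by
  have e : ∀ l : ℝ, ENNReal.ofReal (|l| ^ δ) = (ENNReal.ofReal |l|) ^ δ := fun l =>
    (ENNReal.ofReal_rpow_of_nonneg (abs_nonneg l) hδ.le).symm
  have hme : AEStronglyMeasurable (fun l : ℝ => |l| ^ δ) ρ := by
    apply Measurable.aestronglyMeasurable
    fun_prop
  have hl : ∫⁻ l, ENNReal.ofReal (|l| ^ δ) ∂ρ = ENNReal.ofReal m := by
    simp only [e]; exact hm
  constructor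
  · refine ⟨hme, ?_⟩
    rw [hasFiniteIntegral_iff_ofReal (Filter.Eventually.of_forall fun l => by positivity), hl]
    exact ENNReal.ofReal_lt_top
  · rw [integral_eq_lintegral_of_nonneg_ae (Filter.Eventually.of_forall fun l => by positivity) hme, hl]
    rw [ENNReal.toReal_ofReal']
    exact max_le (le_abs_self m) (abs_nonneg m)

lemma aux_int (ρ : Measure ℝ) [IsFiniteMeasure ρ] (hρ : ρ univ = 1) (δ m : ℝ)
    (hm : specMom ρ δ = ENNReal.ofReal m) (hδ : 0 < δ) (h : ℝ) :
    1 - ∫ l, Real.cos (l * h) ∂ρ ≤ 2 * |h| ^ (min δ 2) * (1 + |m|) := by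
  obtain ⟨hi, hb⟩ := aux_mom ρ δ m hm hδ
  have hP : ρ.real univ = 1 := by simp [measureReal_def, hρ]
  have hp : 0 < min δ 2 := lt_min hδ (by norm_num)
  have hc : Integrable (fun l => Real.cos (l * h)) ρ := by
    apply Integrable.of_bound (C := 1)
    · apply Measurable.aestronglyMeasurable; fun_prop
    · exact Filter.Eventually.of_forall fun l => by
        rw [Real.norm_eq_abs]; exact Real.abs_cos_le_one _
  have e1 : 1 - ∫ l, Real.cos (l * h) ∂ρ = ∫ l, (1 - Real.cos (l * h)) ∂ρ := by
    rw [integral_sub (integrable_const _) hc]; simp [hP]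
  have e2 : ∫ l, 2 * |h| ^ (min δ 2) * (1 + |l| ^ δ) ∂ρ
      = 2 * |h| ^ (min δ 2) * (1 + ∫ l, |l| ^ δ ∂ρ) := by
    rw [integral_const_mul, integral_add (integrable_const _) hi]; simp [hP]
  rw [e1]
  calc _ ≤ ∫ l, 2 * |h| ^ (min δ 2) * (1 + |l| ^ δ) ∂ρ := by
        refine integral_mono ((integrable_const _).sub hc)
          (((integrable_const _).add hi).const_mul _) fun l => ?_
        have h1 := aux_cosb (min δ 2) (l * h) hp (min_le_right _ _)
        rw [abs_mul, Real.mul_rpow (abs_nonneg _) (abs_nonneg _)] at h1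
        have h2 : |l| ^ (min δ 2) ≤ 1 + |l| ^ δ := by
          by_cases hl : |l| ≤ 1
          · have := Real.rpow_le_one (abs_nonneg l) hl hp.le
            have : 0 ≤ |l| ^ δ := by positivity
            linarith
          · push Not at hl
            have := Real.rpow_le_rpow_of_exponent_le hl.le (min_le_left δ 2)
            linarith
        have h3 : 0 ≤ |h| ^ (min δ 2) := by positivity
        simp only
        nlinarith [mul_le_mul_of_nonneg_right h2 h3]
    _ = _ := e2
    _ ≤ _ := by gcongr

lemma aux_Rlaw {Ω : Type} [MeasurableSpace Ω] (P : Measure Ω) (ρ : Measure ℝ)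
    (f : ℝ → Ω → ℝ) (h : IsGSPR ρ P f) (hρ : ρ univ = 1) (t : ℝ) :
    P.map (f t) = gaussianReal 0 1 := by
  have := h.2.2.2.2.2 1 (fun _ => t) (fun _ => 1)
  simpa [measureReal_def, hρ] using this

lemma aux_Rinc {Ω : Type} [MeasurableSpace Ω] (P : Measure Ω) (ρ : Measure ℝ)
    (f : ℝ → Ω → ℝ) (h : IsGSPR ρ P f) (hρ : ρ univ = 1) (δ m : ℝ)
    (hm : specMom ρ δ = ENNReal.ofReal m) (hδ : 0 < δ) (s t : ℝ) :
    ∃ v : ℝ≥0, P.map (fun ω => f t ω - f s ω) = gaussianReal 0 v ∧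
        (v:ℝ) ≤ (2 * √(1 + |m|) * |t - s| ^ (min δ 2 / 2)) ^ 2 := by
  have hf := h.1
  refine ⟨(2 * (1 - ∫ l, Real.cos (l * (t - s)) ∂ρ)).toNNReal, ?_, ?_⟩
  · have := h.2.2.2.2.2 2 ![t, s] ![1, -1]
    have hc : ∀ l : ℝ, Real.cos (l * (s - t)) = Real.cos (l * (t - s)) := fun l => by
      rw [← Real.cos_neg]; congr 1; ring
    simp [Fin.sum_univ_two, measureReal_def, hρ, hc] at this
    rw [show (fun ω => f t ω - f s ω) = fun ω => f t ω + -f s ω from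
      funext fun ω => sub_eq_add_neg _ _, this]
    congr 2
    ring
  · rw [Real.coe_toNNReal']
    have e : (2 * √(1 + |m|) * |t - s| ^ (min δ 2 / 2)) ^ 2
        = 2 * (2 * |t - s| ^ (min δ 2) * (1 + |m|)) := by
      rw [mul_pow, mul_pow, Real.sq_sqrt (by positivity), ← Real.rpow_natCast (_ ^ _),
        ← Real.rpow_mul (abs_nonneg _)]
      have : min δ 2 / 2 * ((2:ℕ):ℝ) = min δ 2 := by push_cast; ring
      rw [this]; ring
    refine max_le ?_ (by positivity)
    rw [e]
    linarith [aux_int ρ hρ δ m hm hδ (t - s)]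

lemma aux_lim {Ω : Type} [MeasurableSpace Ω] (P : Measure Ω) [IsProbabilityMeasure P]
    (f : ℝ → Ω → ℝ) (hm : ∀ t, Measurable (f t)) (hc : ∀ᵐ ω ∂P, Continuous fun t => f t ω)
    (n : ℕ) (N y p : ℝ) (hN : N ≤ n) (hN0 : 0 < N) (hy : 0 < y)
    (h : ∀ L : ℕ, p ≤ P.real {ω | ∀ i : Fin (n * 2 ^ L + 1), y ≤ f ((i:ℕ) / 2 ^ L) ω}) :
    p ≤ persR P f N := by
  set E : ℕ → Set Ω := fun L => {ω | ∀ i : Fin (n * 2 ^ L + 1), y ≤ f ((i:ℕ) / 2 ^ L) ω} with hE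
  have hEm : ∀ L, MeasurableSet (E L) := fun L => by
    simp only [hE, ofPred_forall]
    exact MeasurableSet.iInter fun i => measurableSet_le measurable_const (hm _)
  have hanti : Antitone E := by
    refine antitone_nat_of_succ_le fun L ω hω i => ?_
    have := hω ⟨2 * i, by
      have := i.2
      rw [pow_succ, ← mul_assoc]; omega⟩
    have e : ((2 * (i:ℕ) : ℕ):ℝ) / 2 ^ (L + 1) = (i:ℕ) / 2 ^ L := by
      push_cast; rw [pow_succ]; field_simp
    simp only [e] at this
    exact this
  have ht := tendsto_measure_iInter_atTop (μ := P) (fun L => (hEm L).nullMeasurableSet) hanti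
    ⟨0, measure_ne_top _ _⟩
  have ht2 := (ENNReal.tendsto_toReal (measure_ne_top P _)).comp ht
  have h1 : p ≤ (P (⋂ L, E L)).toReal := ge_of_tendsto' ht2 h
  refine h1.trans (ENNReal.toReal_mono (measure_ne_top _ _) (measure_mono_ae ?_))
  filter_upwards [hc] with ω hcω hω
  change ω ∈ ⋂ L, E L at hω
  change ω ∈ {ω | ∀ t ∈ Set.Ioc (0:ℝ) N, 0 < f t ω}
  intro t htN
  refine hy.trans_le ?_
  have hlim : Filter.Tendsto (fun L : ℕ => ((⌊t * 2 ^ L⌋₊ : ℕ):ℝ) / 2 ^ L) Filter.atTop (nhds t) := by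
    have := (tendsto_nat_floor_mul_div_atTop (R := ℝ) htN.1.le).comp
      (tendsto_pow_atTop_atTop_of_one_lt (r := (2:ℝ)) (by norm_num))
    exact this
  have hlim2 := (hcω.tendsto t).comp hlim
  refine ge_of_tendsto' hlim2 fun L => ?_
  have hb : ⌊t * 2 ^ L⌋₊ < n * 2 ^ L + 1 := by
    apply Nat.lt_succ_of_le
    apply Nat.floor_le_of_le
    push_cast
    exact mul_le_mul_of_nonneg_right (htN.2.trans hN) (by positivity)
  exact (mem_iInter.1 hω L) ⟨_, hb⟩

lemma aux_Rmain (b γ δ m : ℝ) (hb : 0 < b) (hγ : 0 < γ) (hδ : 0 < δ) :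
    (∃ C : ℝ, 0 < C ∧ ∃ N₀ : ℝ, 0 < N₀ ∧
      ∀ (Ω : Type) (_ : MeasurableSpace Ω) (P : Measure Ω) (ρ : Measure ℝ)
        (f : ℝ → Ω → ℝ) (S : Set ℝ), IsGSPR ρ P f → ρ Set.univ = 1 →
        specMom ρ δ = ENNReal.ofReal m →
        S ⊆ Set.Ioi (0 : ℝ) → ¬ BddAbove S →
        (∀ N ∈ S, b * N ^ (-γ) ≤ sig2 ρ N) →
        ∀ N ∈ S, N₀ < N →
          (γ < 1 → -C * N ^ γ * Real.log N ≤ Real.log (persR P f N)) ∧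
          (γ = 1 → -C * N ≤ Real.log (persR P f N))) := by
  have hp : 0 < min δ 2 := lt_min hδ (by norm_num)
  obtain ⟨W, C, hW, hC, hch⟩ := aux_chain (min δ 2 / 2) (2 * √(1 + |m|)) (by linarith) (by
    have : 1 ≤ √(1 + |m|) := Real.one_le_sqrt.2 (by linarith [abs_nonneg m])
    linarith)
  refine ⟨32 * W ^ 2 / b + 2 * C, by positivity, 10, by norm_num, ?_⟩
  intro Ω _ P ρ f S h hρ hmom _ _ hS N hNS hN
  have hN0 : 0 < N := by linarith
  have hf := h.1
  have hP := h.2.2.1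
  have hm : ∀ t, Measurable (f t) := fun t => h.2.2.2.1.comp measurable_prodMk_left
  have hG := h.2.2.2.2.2
  have hbn : 0 < b * N ^ (-γ) := mul_pos hb (Real.rpow_pos_of_pos hN0 _)
  have key : ∀ l : ℝ, 1 ≤ l →
      -(32 * W ^ 2 / b * (l * N ^ γ) + 2 * C * (N * l * rexp (-l))) ≤ Real.log (persR P f N) := by
    intro l hl
    have hsl : 1 ≤ √l := Real.one_le_sqrt.2 hl
    have hsq : √l ^ 2 = l := Real.sq_sqrt (by linarith)
    have hce : N ≤ ⌈N⌉₊ := Nat.le_ceil N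
    have hce2 : (⌈N⌉₊ : ℝ) < N + 1 := Nat.ceil_lt_add_one hN0.le
    apply aux_logle
    refine aux_lim P f hm h.2.2.2.2.1 ⌈N⌉₊ N (W * √l) _ hce hN0 (by positivity) fun L => ?_
    have h1 := hch Ω _ P hP f hm (fun n t a => ⟨_, hG n t a⟩) (aux_Rlaw P ρ f h hρ)
      (aux_Rinc P ρ f h hρ δ m hmom hδ) ⌈N⌉₊ L l hl
    have h2 := aux_shift P ρ (fun (i : Fin (⌈N⌉₊ * 2 ^ L + 1)) => f ((i:ℕ) / 2 ^ L)) (fun i => hm _)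
      (fun i => (i:ℕ) / 2 ^ L) N hN0 (fun i => by
        have h3 : ((i:ℕ):ℝ) ≤ ⌈N⌉₊ * 2 ^ L := by
          have := i.2
          exact_mod_cast (by omega : (i:ℕ) ≤ ⌈N⌉₊ * 2 ^ L)
        rw [abs_of_nonneg (by positivity), div_le_iff₀ (by positivity)]
        refine h3.trans (mul_le_mul_of_nonneg_right ?_ (by positivity))
        linarith)
      (fun a => hG _ _ a) (hbn.trans_le (hS N hNS)) (W * √l) (by positivity)
    refine aux_final (Ω := Ω) _ _ _ _ (sig2 ρ N) b γ N (W * √l) hb hN0 (hS N hNS) h1 h2 ?_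
    have e1 : 32 * (W * √l) ^ 2 * N ^ γ / b = 32 * W ^ 2 / b * (l * N ^ γ) := by
      rw [mul_pow, hsq]; ring
    rw [e1]
    have h4 : C * (⌈N⌉₊ + 1) * l * rexp (-l) ≤ C * (2 * N) * l * rexp (-l) := by
      gcongr; linarith
    linarith
  refine ⟨fun hg => ?_, fun hg => ?_⟩
  · have hl : 1 ≤ Real.log N :=
      (Real.le_log_iff_exp_le hN0).2 (by linarith [Real.exp_one_lt_d9])
    refine le_trans ?_ (key (Real.log N) hl)
    rw [Real.exp_neg, Real.exp_log hN0]
    have h1 : 1 ≤ N ^ γ := Real.one_le_rpow (by linarith) hγ.le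
    have h2 : N * Real.log N * N⁻¹ = Real.log N := by field_simp
    have h3 : 2 * C * Real.log N ≤ 2 * C * (N ^ γ * Real.log N) :=
      mul_le_mul_of_nonneg_left (le_mul_of_one_le_left (by linarith) h1) (by linarith)
    rw [h2]
    linarith
  · refine le_trans ?_ (key 1 le_rfl)
    have h1 : rexp (-1) ≤ 1 := Real.exp_le_one_iff.2 (by norm_num)
    have h2 : 2 * C * (N * rexp (-1)) ≤ 2 * C * N :=
      mul_le_mul_of_nonneg_left (mul_le_of_le_one_right hN0.le h1) (by linarith)
    rw [hg, Real.rpow_one]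
    linarith


/-- **Explicit lower bounds (Corollary 2.3).** Fix `b, γ, δ > 0` and `m`. There are
`C, N₀ > 0` (depending only on `b, γ, δ, m_δ = m`) such that for any normalized GSP (on `ℤ`
resp. `ℝ`) with `m_δ = m` and `σ_N² ≥ b·N^{-γ}` for all `N` in an unbounded set
`S ⊆ (0,∞)`, and every `N ∈ S` with `N > N₀`: if `γ < 1` then
`log P_f(N) ≥ -C·N^γ·log N`; if `γ = 1` then `log P_f(N) ≥ -C·N`; and if `γ > 1` and the
process is over `ℤ` then `log P_f(N) ≥ -C·(γ-1)·N·log N`. -/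
theorem statement3 (b γ δ m : ℝ) (hb : 0 < b) (hγ : 0 < γ) (hδ : 0 < δ) :
    (∃ C : ℝ, 0 < C ∧ ∃ N₀ : ℝ, 0 < N₀ ∧
      ∀ (Ω : Type) (_ : MeasurableSpace Ω) (P : Measure Ω) (ρ : Measure ℝ)
        (f : ℤ → Ω → ℝ) (S : Set ℝ), IsGSPZ ρ P f → ρ Set.univ = 1 →
        specMom ρ δ = ENNReal.ofReal m →
        S ⊆ Set.Ioi (0 : ℝ) → ¬ BddAbove S →
        (∀ N ∈ S, b * N ^ (-γ) ≤ sig2 ρ N) →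
        ∀ N ∈ S, N₀ < N →
          (γ < 1 → -C * N ^ γ * Real.log N ≤ Real.log (persZ P f N)) ∧
          (γ = 1 → -C * N ≤ Real.log (persZ P f N)) ∧
          (1 < γ → -C * (γ - 1) * N * Real.log N ≤ Real.log (persZ P f N))) ∧
    (∃ C : ℝ, 0 < C ∧ ∃ N₀ : ℝ, 0 < N₀ ∧
      ∀ (Ω : Type) (_ : MeasurableSpace Ω) (P : Measure Ω) (ρ : Measure ℝ)
        (f : ℝ → Ω → ℝ) (S : Set ℝ), IsGSPR ρ P f → ρ Set.univ = 1 →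
        specMom ρ δ = ENNReal.ofReal m →
        S ⊆ Set.Ioi (0 : ℝ) → ¬ BddAbove S →
        (∀ N ∈ S, b * N ^ (-γ) ≤ sig2 ρ N) →
        ∀ N ∈ S, N₀ < N →
          (γ < 1 → -C * N ^ γ * Real.log N ≤ Real.log (persR P f N)) ∧
          (γ = 1 → -C * N ≤ Real.log (persR P f N))) := by
  exact ⟨aux_Zmain b γ δ m hb hγ hδ, aux_Rmain b γ δ m hb hγ hδ⟩

end
end
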